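/- Let (G,+) be a discrete abelian group with the counting measure |·| and let p_1(t), …, p_l(t) ∈ ℤ[t] be polynomials with p_i(0) = 0 for 1 ≤ i ≤ l. If E ⊆ G has positive upper Banach density with respect to Følner nets, i.e., there is a Følner net (F_θ)_{θ∈Θ} with limsup_θ |E ∩ F_θ| / |F_θ| > 0, then for any g_1, …, g_l ∈ G, the set {d ∈ ℤ : BD*({u ∈ E : u + p_i(d)·g_i ∈ E for i = 1,…,l}) > 0} has positive lower Banach density in ℤ, where BD*(A) > 0 means that limsup_θ |A ∩ F'_θ| / |F'_θ| > 0 for some Følner net (F'_θ) in G. -/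

import Mathlib

universe u

open Filter Topology
open scoped Classical symmDiff

/-- A Følner net in a discrete abelian group `G` (with the counting measure): a net
`(F_θ)_{θ ∈ Θ}` of nonempty finite subsets of `G`, indexed by a nonempty directed set `Θ`,
such that `|(g + F_θ) ∆ F_θ| / |F_θ| → 0` for every `g ∈ G`. -/
structure FolnerNet (G : Type u) [AddCommGroup G] : Type (u + 1) where
  /-- the (directed) index set of the net -/
  Θ : Type u
  [pre : Preorder Θ]
  [dir : IsDirected Θ (· ≤ ·)]
  [nonemptyIdx : Nonempty Θ]
  /-- the finite sets constituting the net -/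
  F : Θ → Finset G
  nonempty : ∀ θ, (F θ).Nonempty
  folner : ∀ g : G, Filter.Tendsto
    (fun θ => (((((F θ).image (g + ·)) ∆ (F θ)).card : ℝ) / ((F θ).card : ℝ)))
    Filter.atTop (nhds 0)

attribute [instance] FolnerNet.pre FolnerNet.dir FolnerNet.nonemptyIdx

/-- `A ⊆ G` has positive upper Banach density with respect to Følner nets:
`limsup_θ |A ∩ F_θ| / |F_θ| > 0` for some Følner net `(F_θ)` in `G`. -/
def HasPosUpperBanachDensityNet {G : Type*} [AddCommGroup G] (A : Set G) : Prop :=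
  ∃ 𝒩 : FolnerNet G, 0 < Filter.limsup
    (fun θ => ((((𝒩.F θ).filter (fun u => u ∈ A)).card : ℝ) / ((𝒩.F θ).card : ℝ)))
    Filter.atTop

/-- `D ⊆ ℤ` has positive lower Banach density: there are `c > 0` and `N₀` such that
`|D ∩ [M, M+N)| ≥ c N` for every `M ∈ ℤ` and every `N ≥ N₀`. -/
def HasPosLowerBanachDensity (D : Set ℤ) : Prop :=
  ∃ c : ℝ, 0 < c ∧ ∃ N₀ : ℕ, ∀ M : ℤ, ∀ N : ℕ, N₀ ≤ N →
    c * N ≤ (((Finset.Ico M (M + (N : ℤ))).filter (fun d => d ∈ D)).card : ℝ)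

section PS1file
open Filter Topology
open scoped Classical symmDiff

/-! ### Averages -/

/-- `a` has arbitrarily small uniform upper averages. -/
def NullS {V : Type} [AddCommGroup V] (a : V → ℝ) : Prop :=
  ∀ ε : ℝ, 0 < ε → ∃ (ι : Type) (_ : Fintype ι) (w : ι → ℝ) (u : ι → V),
    (∀ i, 0 ≤ w i) ∧ ∑ i, w i = 1 ∧ ∀ v, ∑ i, w i * a (v + u i) ≤ ε

section nulls
variable {V : Type} [AddCommGroup V]

lemma NullS.of_const {a : V → ℝ} (h : ∀ v, a v ≤ 0) : NullS a := by
  intro ε hε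
  refine ⟨Unit, inferInstance, fun _ => 1, fun _ => 0, by simp, by simp, fun v => ?_⟩
  simpa using (h v).trans hε.le

lemma NullS.mono {a b : V → ℝ} (hb : NullS b) (h : ∀ v, a v ≤ b v) : NullS a := by
  intro ε hε
  obtain ⟨ι, _, w, u, hw, hs, hu⟩ := hb ε hε
  exact ⟨ι, _, w, u, hw, hs, fun v => (Finset.sum_le_sum fun i _ =>
    mul_le_mul_of_nonneg_left (h _) (hw i)).trans (hu v)⟩

lemma NullS.add {a b : V → ℝ} (ha : NullS a) (hb : NullS b) : NullS (fun v => a v + b v) := by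
  intro ε hε
  obtain ⟨ι, _, w, u, hw, hs, hu⟩ := ha (ε/2) (by linarith)
  obtain ⟨κ, _, w', u', hw', hs', hu'⟩ := hb (ε/2) (by linarith)
  refine ⟨ι × κ, inferInstance, fun p => w p.1 * w' p.2, fun p => u p.1 + u' p.2,
    fun p => mul_nonneg (hw _) (hw' _), ?_, fun v => ?_⟩
  · rw [Fintype.sum_prod_type]
    simp [← Finset.mul_sum, hs, hs']
  · have h1 : ∑ p : ι × κ, w p.1 * w' p.2 * a (v + (u p.1 + u' p.2)) ≤ ε/2 := by
      rw [Fintype.sum_prod_type_right]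
      calc _ = ∑ k, w' k * ∑ i, w i * a ((v + u' k) + u i) := by
            refine Finset.sum_congr rfl fun k _ => ?_
            rw [Finset.mul_sum]
            refine Finset.sum_congr rfl fun i _ => ?_
            rw [show v + (u i + u' k) = v + u' k + u i by abel]; ring
        _ ≤ ∑ k, w' k * (ε/2) := Finset.sum_le_sum fun k _ =>
            mul_le_mul_of_nonneg_left (hu _) (hw' k)
        _ = ε/2 := by rw [← Finset.sum_mul, hs', one_mul]
    have h2 : ∑ p : ι × κ, w p.1 * w' p.2 * b (v + (u p.1 + u' p.2)) ≤ ε/2 := by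
      rw [Fintype.sum_prod_type]
      calc _ = ∑ i, w i * ∑ k, w' k * b ((v + u i) + u' k) := by
            refine Finset.sum_congr rfl fun k _ => ?_
            rw [Finset.mul_sum]
            refine Finset.sum_congr rfl fun i _ => ?_
            rw [← add_assoc]; ring
        _ ≤ ∑ i, w i * (ε/2) := Finset.sum_le_sum fun k _ =>
            mul_le_mul_of_nonneg_left (hu' _) (hw k)
        _ = ε/2 := by rw [← Finset.sum_mul, hs, one_mul]
    simp only [mul_add, Finset.sum_add_distrib]
    linarith

lemma NullS.smul {a : V → ℝ} (ha : NullS a) {c : ℝ} (hc : 0 ≤ c) : NullS (fun v => c * a v) := by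
  intro ε hε
  obtain ⟨ι, _, w, u, hw, hs, hu⟩ := ha (ε/(c+1)) (by positivity)
  refine ⟨ι, _, w, u, hw, hs, fun v => ?_⟩
  calc ∑ i, w i * (c * a (v + u i)) = c * ∑ i, w i * a (v + u i) := by
        rw [Finset.mul_sum]; exact Finset.sum_congr rfl fun i _ => by ring
    _ ≤ c * (ε/(c+1)) := mul_le_mul_of_nonneg_left (hu v) hc
    _ ≤ ε := by
        rw [mul_div_assoc', div_le_iff₀ (by linarith)]; nlinarith

lemma NullS.sum {κ : Type*} (s : Finset κ) {a : κ → V → ℝ} (ha : ∀ k ∈ s, NullS (a k)) :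
    NullS (fun v => ∑ k ∈ s, a k v) := by
  induction s using Finset.induction_on with
  | empty => exact NullS.of_const (by simp)
  | insert k s hk ih =>
    simp only [Finset.sum_insert hk]
    exact (ha k (by simp)).add (ih fun j hj => ha j (by simp [hj]))

/-- It suffices to be null up to arbitrarily small constants. -/
lemma NullS.of_approx {a : V → ℝ} (h : ∀ ε : ℝ, 0 < ε → ∃ b, NullS b ∧ ∀ v, a v ≤ b v + ε) :
    NullS a := by
  intro ε hε
  obtain ⟨b, hb, hab⟩ := h (ε/2) (by linarith)
  obtain ⟨ι, _, w, u, hw, hs, hu⟩ := hb (ε/2) (by linarith)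
  refine ⟨ι, _, w, u, hw, hs, fun v => ?_⟩
  calc ∑ i, w i * a (v + u i) ≤ ∑ i, w i * (b (v + u i) + ε/2) :=
        Finset.sum_le_sum fun i _ => mul_le_mul_of_nonneg_left (hab _) (hw i)
    _ = ∑ i, w i * b (v + u i) + (∑ i, w i) * (ε/2) := by
        simp only [mul_add, Finset.sum_add_distrib, Finset.sum_mul]
    _ ≤ ε := by rw [hs]; linarith [hu v]

lemma NullS.comp_surj {W : Type} [AddCommGroup W] {a : V → ℝ} (ha : NullS a) (φ : W →+ V)
    (hφ : Function.Surjective φ) : NullS (fun x => a (φ x)) := by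
  intro ε hε
  obtain ⟨ι, _, w, u, hw, hs, hu⟩ := ha ε hε
  choose s hs' using hφ
  refine ⟨ι, _, w, fun i => s (u i), hw, hs, fun v => ?_⟩
  simpa [map_add, hs'] using hu (φ v)

lemma NullS.shift {a : V → ℝ} (ha : NullS a) (t : V) : NullS (fun x => a (x + t)) := by
  intro ε hε
  obtain ⟨ι, _, w, u, hw, hs, hu⟩ := ha ε hε
  refine ⟨ι, _, w, u, hw, hs, fun v => ?_⟩
  simpa [add_right_comm] using hu (v + t)

/-- Square root / Cauchy-Schwarz: if `a^2` is null then so is `a`. -/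
lemma NullS.of_sq {a b : V → ℝ} (hb : NullS b) (h : ∀ v, (a v)^2 ≤ b v) : NullS a := by
  refine NullS.of_approx fun ε hε => ⟨fun v => ε⁻¹ * b v, hb.smul (by positivity), fun v => ?_⟩
  have h1 := h v
  have : ε * a v ≤ b v + ε * ε := by nlinarith [sq_nonneg (a v - ε), sq_nonneg (a v + ε)]
  have : a v ≤ (b v + ε * ε) / ε := by rw [le_div_iff₀ hε]; linarith
  calc a v ≤ _ := this
    _ = _ := by field_simp

/-- Syndetic sets. -/
def Synd (S : Set V) : Prop := ∃ F : Finset V, ∀ v, ∃ u ∈ F, v + u ∈ S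

lemma Synd.mono {S S' : Set V} (h : Synd S) (hs : S ⊆ S') : Synd S' := by
  obtain ⟨F, hF⟩ := h
  exact ⟨F, fun v => let ⟨u, hu, h⟩ := hF v; ⟨u, hu, hs h⟩⟩

lemma Synd.diff_null {S B : Set V} (h : Synd S)
    (hB : NullS (fun v => if v ∈ B then (1:ℝ) else 0)) : Synd (S \ B) := by
  obtain ⟨F, hF⟩ := h
  have h2 : NullS (fun v => ∑ u ∈ F, (if v + u ∈ B then (1:ℝ) else 0)) :=
    NullS.sum F fun u _ => hB.shift u
  obtain ⟨ι, _, w, t, hw, hs, ht⟩ := h2 (1/2) (by norm_num)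
  refine ⟨(Finset.univ ×ˢ F).image fun p => t p.1 + p.2, fun v => ?_⟩
  by_contra! hcon
  have h3 : ∀ i, (1:ℝ) ≤ ∑ u ∈ F, (if v + t i + u ∈ B then (1:ℝ) else 0) := by
    intro i
    obtain ⟨u, hu, huS⟩ := hF (v + t i)
    have : v + t i + u ∈ B := by
      by_contra hb
      refine hcon (t i + u) (Finset.mem_image.2 ⟨(i,u), by simp [hu], rfl⟩) ?_
      rw [← add_assoc]; exact ⟨huS, hb⟩
    calc (1:ℝ) = (if v + t i + u ∈ B then (1:ℝ) else 0) := by simp [this]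
      _ ≤ _ := Finset.single_le_sum (f := fun u => if v + t i + u ∈ B then (1:ℝ) else 0)
            (fun j _ => by positivity) hu
  have h4 := ht v
  have : ∑ i, w i * 1 ≤ ∑ i, w i * ∑ u ∈ F, (if v + t i + u ∈ B then (1:ℝ) else 0) :=
    Finset.sum_le_sum fun i _ => mul_le_mul_of_nonneg_left (h3 i) (hw i)
  simp only [mul_one, hs] at this
  linarith

lemma NullS.indicator {a : V → ℝ} (ha : NullS a) (h0 : ∀ v, 0 ≤ a v) {c : ℝ} (hc : 0 < c) :
    NullS (fun v => if v ∈ {v | c ≤ a v} then (1:ℝ) else 0) := by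
  refine (ha.smul (c := c⁻¹) (by positivity)).mono fun v => ?_
  split_ifs with h
  · have : c ≤ a v := h
    rw [inv_mul_eq_div, le_div_iff₀ hc]; linarith
  · have := h0 v; positivity

/-- van der Corput. -/
lemma NullS.vdc {E : Type*} [NormedAddCommGroup E] [InnerProductSpace ℝ E] (U : V → E)
    (b : V → ℝ) (hb : NullS b)
    (h : ∀ x y, NullS (fun n => inner ℝ (U (n + x)) (U (n + y)) - b (x - y))) (e : E) :
    NullS (fun n => inner ℝ e (U n)) := by
  intro ε hε
  obtain ⟨δ, hδ, hδε⟩ : ∃ δ : ℝ, 0 < δ ∧ δ * ‖e‖^2 ≤ ε := by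
    refine ⟨ε / (‖e‖^2 + 1), by positivity, ?_⟩
    rw [div_mul_eq_mul_div, div_le_iff₀ (by positivity)]; nlinarith
  obtain ⟨κ, _, q, u, hq, hqs, hu⟩ := hb (δ * ε/2) (by positivity)
  have hn : NullS (fun n => ∑ k, ∑ k', q k * q k' *
      (inner ℝ (U (n + u k)) (U (n + u k')) - b (u k - u k'))) :=
    NullS.sum _ fun k _ => NullS.sum _ fun k' _ =>
      (h (u k) (u k')).smul (mul_nonneg (hq _) (hq _))
  obtain ⟨ι, _, w, t, hw, hs, ht⟩ := hn (δ * ε/2) (by positivity)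
  have key : ∀ n, ‖∑ k, q k • U (n + u k)‖^2 ≤ (∑ k, ∑ k', q k * q k' *
      (inner ℝ (U (n + u k)) (U (n + u k')) - b (u k - u k'))) + δ * ε/2 := by
    intro n
    have h1 : ‖∑ k, q k • U (n + u k)‖^2 = ∑ k, ∑ k', q k * q k' *
      (inner ℝ (U (n + u k)) (U (n + u k'))) := by
      rw [← real_inner_self_eq_norm_sq, sum_inner]
      refine Finset.sum_congr rfl fun k _ => ?_
      rw [inner_sum]
      refine Finset.sum_congr rfl fun k' _ => ?_
      rw [real_inner_smul_left, real_inner_smul_right]; ring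
    have h2 : ∑ k, ∑ k', q k * q k' * b (u k - u k') ≤ δ * ε / 2 := by
      rw [Finset.sum_comm]
      calc _ = ∑ k', q k' * ∑ k, q k * b (-u k' + u k) := by
            refine Finset.sum_congr rfl fun k' _ => ?_
            rw [Finset.mul_sum]
            refine Finset.sum_congr rfl fun k _ => ?_
            rw [neg_add_eq_sub]; ring
        _ ≤ ∑ k', q k' * (δ * ε/2) := Finset.sum_le_sum fun k' _ =>
            mul_le_mul_of_nonneg_left (hu _) (hq k')
        _ = _ := by rw [← Finset.sum_mul, hqs, one_mul]
    rw [h1]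
    simp only [mul_sub, Finset.sum_sub_distrib]
    linarith
  refine ⟨ι × κ, inferInstance, fun p => w p.1 * q p.2, fun p => t p.1 + u p.2,
    fun p => mul_nonneg (hw _) (hq _), ?_, fun v => ?_⟩
  · rw [Fintype.sum_prod_type]
    simp [← Finset.mul_sum, hs, hqs]
  · rw [Fintype.sum_prod_type]
    have e1 : ∀ i, ∑ k, w i * q k * inner ℝ e (U (v + (t i + u k)))
        = w i * inner ℝ e (∑ k, q k • U ((v + t i) + u k)) := by
      intro i
      rw [inner_sum, Finset.mul_sum]
      refine Finset.sum_congr rfl fun k _ => ?_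
      rw [real_inner_smul_right, add_assoc]; ring
    simp only [e1]
    have e2 : ∀ y : E, inner ℝ e y ≤ (δ * ‖e‖^2 + δ⁻¹ * ‖y‖^2)/2 := by
      intro y
      have h1 := real_inner_le_norm e y
      have h2 : ‖e‖ * ‖y‖ ≤ (δ * ‖e‖^2 + δ⁻¹ * ‖y‖^2)/2 := by
        have h3 : 0 ≤ δ⁻¹ * (δ * ‖e‖ - ‖y‖)^2 := by positivity
        have h4 : δ⁻¹ * (δ * ‖e‖ - ‖y‖)^2 = δ * ‖e‖^2 + δ⁻¹ * ‖y‖^2 - 2 * (‖e‖ * ‖y‖) := by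
          field_simp; ring
        linarith
      linarith
    calc ∑ i, w i * inner ℝ e (∑ k, q k • U ((v + t i) + u k))
        ≤ ∑ i, w i * ((δ * ‖e‖^2 + δ⁻¹ * ((∑ k, ∑ k', q k * q k' *
      (inner ℝ (U (v + t i + u k)) (U (v + t i + u k')) - b (u k - u k'))) + δ * ε/2))/2) := by
          refine Finset.sum_le_sum fun i _ => mul_le_mul_of_nonneg_left ?_ (hw i)
          refine (e2 _).trans ?_
          have := key (v + t i)
          have := mul_le_mul_of_nonneg_left this (inv_nonneg.2 hδ.le)
          linarith
      _ = δ * ‖e‖^2/2 * (∑ i, w i) + δ⁻¹ / 2 * (∑ i, w i * (∑ k, ∑ k', q k * q k' *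
      (inner ℝ (U (v + t i + u k)) (U (v + t i + u k')) - b (u k - u k'))))
        + δ⁻¹ / 2 * (δ * ε / 2) * ∑ i, w i := by
          rw [Finset.mul_sum, Finset.mul_sum, Finset.mul_sum, ← Finset.sum_add_distrib,
            ← Finset.sum_add_distrib]
          exact Finset.sum_congr rfl fun i _ => by ring
      _ ≤ ε := by
          rw [hs]
          have h5 := mul_le_mul_of_nonneg_left (ht v) (show 0 ≤ δ⁻¹/2 by positivity)
          have h6 : δ⁻¹/2 * (δ * ε/2) = ε/4 := by field_simp; norm_num
          linarith

/-- Mean ergodic theorem, abstractly. -/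
lemma mean_erg {E : Type*} [NormedAddCommGroup E] [InnerProductSpace ℝ E] [CompleteSpace E]
    (A : V → E →ₗᵢ[ℝ] E) (hA : ∀ u v x, A (u + v) x = A u (A v x)) (h : E) :
    ∃ H : E, (∀ v, A v H = H) ∧ inner ℝ H h = ‖H‖^2 ∧
      ∀ ε : ℝ, 0 < ε → ∃ (ι : Type) (_ : Fintype ι) (w : ι → ℝ) (u : ι → V),
      (∀ i, 0 ≤ w i) ∧ ∑ i, w i = 1 ∧ ‖(∑ i, w i • A (u i) h) - H‖ ≤ ε := by
  set C0 : Set E := convexHull ℝ (Set.range fun v => A v h)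
  set C := closure C0
  have hCc : Convex ℝ C := (convex_convexHull ℝ _).closure
  have hCn : C.Nonempty := ⟨A 0 h, subset_closure (subset_convexHull ℝ _ ⟨0, rfl⟩)⟩
  obtain ⟨H, hH, hmin⟩ := exists_norm_eq_iInf_of_complete_convex hCn isClosed_closure.isComplete
    hCc (0 : E)
  have hvar := (norm_eq_iInf_iff_real_inner_le_zero hCc hH).1 hmin
  have hle : ∀ w ∈ C, ‖H‖^2 ≤ inner ℝ H w := by
    intro w hw
    have := hvar w hw
    simp only [zero_sub, inner_neg_left, inner_sub_right, real_inner_self_eq_norm_sq] at this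
    linarith
  have hmap : ∀ v, ∀ x ∈ C, A v x ∈ C := by
    intro v x hx
    have hm : Set.MapsTo (A v) C0 C0 := by
      intro y hy
      have : A v y ∈ (A v) '' C0 := ⟨y, hy, rfl⟩
      have e := (A v).toLinearMap.image_convexHull (Set.range fun v => A v h)
      simp only [LinearIsometry.coe_toLinearMap] at e
      rw [e] at this
      refine convexHull_mono ?_ this
      rintro _ ⟨_, ⟨t, rfl⟩, rfl⟩
      exact ⟨v + t, hA _ _ _⟩
    exact (hm.closure (A v).continuous) hx
  have hinv : ∀ v, A v H = H := by
    intro v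
    have h1 := hle _ (hmap v H hH)
    have h2 : ‖A v H - H‖^2 = 2 * ‖H‖^2 - 2 * inner ℝ H (A v H) := by
      rw [norm_sub_sq_real, LinearIsometry.norm_map, real_inner_comm]; ring
    have : ‖A v H - H‖^2 ≤ 0 := by linarith
    have : ‖A v H - H‖ = 0 := by nlinarith [norm_nonneg (A v H - H)]
    exact sub_eq_zero.1 (norm_eq_zero.1 this)
  refine ⟨H, hinv, ?_, ?_⟩
  · have hc : ∀ v, inner ℝ H (A v h) = inner ℝ H h := fun v => by
      conv_lhs => rw [← hinv v]
      exact (A v).inner_map_map _ _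
    have hsub : C ⊆ {x | inner ℝ H x = inner ℝ H h} := by
      refine closure_minimal (convexHull_min ?_ ?_) ?_
      · rintro _ ⟨v, rfl⟩; exact hc v
      · intro x hx y hy a b ha hb hab
        simp only [Set.mem_ofPred_eq] at hx hy ⊢
        rw [inner_add_right, real_inner_smul_right, real_inner_smul_right, hx, hy, ← add_mul,
          hab, one_mul]
      · exact isClosed_eq (by fun_prop) continuous_const
    have := hsub hH
    rw [← real_inner_self_eq_norm_sq]; exact this.symm
  · intro ε hε
    obtain ⟨y, hy, hd⟩ := Metric.mem_closure_iff.1 hH ε hε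
    change y ∈ convexHull ℝ _ at hy
    rw [convexHull_eq] at hy
    obtain ⟨ι, t, w, z, hw0, hw1, hz, rfl⟩ := hy
    have hz' : ∀ i : t, ∃ v, A v h = z i := fun i => hz i i.2
    choose u hu using hz'
    refine ⟨Fin (Fintype.card t), inferInstance, fun i => w ((Fintype.equivFin t).symm i),
      fun i => u ((Fintype.equivFin t).symm i), fun i => hw0 _ (Subtype.mem _), ?_, ?_⟩
    · rw [(Fintype.equivFin t).symm.sum_comp (fun i : t => w i), ← hw1]
      exact Finset.sum_coe_sort t w
    · rw [(Fintype.equivFin t).symm.sum_comp (fun i : t => w i • A (u i) h)]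
      simp only [hu]
      rw [Finset.sum_coe_sort t (fun i => w i • z i), ← t.centerMass_eq_of_sum_1 z hw1]
      rw [← dist_eq_norm, dist_comm]; exact hd.le

end nulls
end PS1file

section PS2file
open Filter Topology
open scoped Classical symmDiff

/-! ### Polynomial maps and weights -/

section polymaps
variable {V W Γ Γ' : Type} [AddCommGroup V] [AddCommGroup W] [AddCommGroup Γ] [AddCommGroup Γ']

/-- `PD d`: polynomial maps of degree `< d`. -/
def PD (V Γ : Type) [AddCommGroup V] [AddCommGroup Γ] : ℕ → AddSubgroup (V → Γ)
  | 0 => ⊥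
  | d+1 =>
    { carrier := {P | ∀ h, (fun x => P (x + h) - P x) ∈ PD V Γ d}
      zero_mem' := fun h => by
        convert (PD V Γ d).zero_mem using 1
        funext x; simp
      add_mem' := by
        intro P Q hP hQ h
        have := (PD V Γ d).add_mem (hP h) (hQ h)
        convert this using 1
        funext x; simp only [Pi.add_apply]; abel
      neg_mem' := by
        intro P hP h
        have := (PD V Γ d).neg_mem (hP h)
        convert this using 1
        funext x; simp only [Pi.neg_apply]; abel }

lemma PD_zero_iff {P : V → Γ} : P ∈ PD V Γ 0 ↔ P = 0 := Iff.rfl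

lemma PD_succ_iff {d : ℕ} {P : V → Γ} :
    P ∈ PD V Γ (d+1) ↔ ∀ h, (fun x => P (x + h) - P x) ∈ PD V Γ d := Iff.rfl

lemma PD_le_succ (d : ℕ) : PD V Γ d ≤ PD V Γ (d+1) := by
  induction d with
  | zero =>
    intro P hP
    rw [PD_zero_iff] at hP
    subst hP
    exact zero_mem _
  | succ d ih => intro P hP h; exact ih (hP h)

lemma PD_mono : Monotone (PD V Γ) := monotone_nat_of_le_succ PD_le_succ

lemma PD_comp_hom {d : ℕ} {P : V → Γ} (hP : P ∈ PD V Γ d) (φ : W →+ V) :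
    (fun x => P (φ x)) ∈ PD W Γ d := by
  induction d generalizing P with
  | zero => rw [PD_zero_iff] at *; subst hP; rfl
  | succ d ih =>
    intro h
    simpa only [map_add] using ih (hP (φ h))

lemma PD_shift {d : ℕ} {P : V → Γ} (hP : P ∈ PD V Γ d) (c : V) :
    (fun x => P (x + c)) ∈ PD V Γ d := by
  induction d generalizing P with
  | zero => rw [PD_zero_iff] at *; subst hP; rfl
  | succ d ih =>
    intro h
    simpa only [add_right_comm] using ih (hP h)

lemma PD_map {d : ℕ} {P : V → Γ} (hP : P ∈ PD V Γ d) (ψ : Γ →+ Γ') :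
    (fun x => ψ (P x)) ∈ PD V Γ' d := by
  induction d generalizing P with
  | zero => rw [PD_zero_iff] at *; subst hP; funext x; simp
  | succ d ih =>
    intro h
    simpa only [map_sub] using ih (hP h)

lemma PD_one_iff {P : V → Γ} : P ∈ PD V Γ 1 ↔ ∀ x, P x = P 0 := by
  rw [PD_succ_iff]
  constructor
  · intro h x
    have := congrFun (PD_zero_iff.1 (h x)) 0
    simp only [zero_add, Pi.zero_apply] at this
    exact sub_eq_zero.1 this
  · intro h y
    rw [PD_zero_iff]
    funext x
    simp [h (x+y), h x]

lemma PD_const (d : ℕ) (c : Γ) : (fun _ : V => c) ∈ PD V Γ (d+1) :=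
  PD_mono (Nat.succ_le_succ (Nat.zero_le d)) (PD_one_iff.2 fun _ => rfl)

lemma PD_two_hom {P : V → Γ} (hP : P ∈ PD V Γ 2) : ∃ L : V →+ Γ, ∀ x y, P (x + y) = P x + L y := by
  have h1 : ∀ h x, P (x + h) - P x = P h - P 0 := by
    intro h x
    have := PD_one_iff.1 (hP h) x
    simpa using this
  refine ⟨AddMonoidHom.mk' (fun y => P y - P 0) ?_, ?_⟩
  · intro a b
    have := h1 b a
    rw [sub_eq_iff_eq_add] at this
    simp only [this]; abel
  · intro x y
    have := h1 y x
    rw [sub_eq_iff_eq_add] at this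
    rw [this, add_comm]; rfl

lemma PD_hom (L : V →+ Γ) : (fun x => L x) ∈ PD V Γ 2 := by
  intro h
  rw [PD_one_iff]
  intro x; simp

/-- Polynomial maps. -/
def PolyMap (P : V → Γ) : Prop := ∃ N, P ∈ PD V Γ N

lemma PolyMap.add {P Q : V → Γ} (hP : PolyMap P) (hQ : PolyMap Q) : PolyMap (fun x => P x + Q x) := by
  obtain ⟨N, hN⟩ := hP
  obtain ⟨M, hM⟩ := hQ
  exact ⟨max N M, add_mem (PD_mono (le_max_left _ _) hN) (PD_mono (le_max_right _ _) hM)⟩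

lemma PolyMap.sub {P Q : V → Γ} (hP : PolyMap P) (hQ : PolyMap Q) : PolyMap (fun x => P x - Q x) := by
  obtain ⟨N, hN⟩ := hP
  obtain ⟨M, hM⟩ := hQ
  exact ⟨max N M, sub_mem (PD_mono (le_max_left _ _) hN) (PD_mono (le_max_right _ _) hM)⟩

lemma PolyMap.comp_hom {P : V → Γ} (hP : PolyMap P) (φ : W →+ V) : PolyMap (fun x => P (φ x)) := by
  obtain ⟨N, hN⟩ := hP
  exact ⟨N, PD_comp_hom hN φ⟩

lemma PolyMap.map {P : V → Γ} (hP : PolyMap P) (ψ : Γ →+ Γ') : PolyMap (fun x => ψ (P x)) := by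
  obtain ⟨N, hN⟩ := hP
  exact ⟨N, PD_map hN ψ⟩

lemma PolyMap.shift {P : V → Γ} (hP : PolyMap P) (c : V) : PolyMap (fun x => P (x + c)) := by
  obtain ⟨N, hN⟩ := hP
  exact ⟨N, PD_shift hN c⟩

lemma PolyMap.zero : PolyMap (fun _ : V => (0:Γ)) := ⟨0, zero_mem _⟩

lemma PolyMap.const (c : Γ) : PolyMap (fun _ : V => c) := ⟨1, PD_const 0 c⟩

lemma polyMap_prodMk {P : V → Γ} {Q : V → Γ'} (hP : PolyMap P) (hQ : PolyMap Q) :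
    PolyMap (fun x => (P x, Q x)) := by
  have h1 := hP.map (AddMonoidHom.inl Γ Γ')
  have h2 := hQ.map (AddMonoidHom.inr Γ Γ')
  have := h1.add h2
  simpa using this

lemma polyMap_bound {J : Type*} [Finite J] {P : J → V → Γ} (h : ∀ j, PolyMap (P j)) :
    ∃ N, ∀ j, P j ∈ PD V Γ N := by
  have := Fintype.ofFinite J
  choose N hN using h
  exact ⟨Finset.univ.sup N, fun j => PD_mono (Finset.le_sup (Finset.mem_univ j)) (hN j)⟩

end polymaps

section weights

/-- weight of a set with respect to a filtration -/
noncomputable def wt {A : Type*} [AddCommGroup A] (D : ℕ → AddSubgroup A) (S : Set A) (d : ℕ) : ℕ :=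
  ((QuotientAddGroup.mk : A → A ⧸ D d) '' {P | P ∈ S ∧ P ∈ D (d+1) ∧ P ∉ D d}).ncard

/-- ordering of weights -/
def WR (N : ℕ) (w' w : ℕ → ℕ) : Prop :=
  ∃ d0 < N, w' d0 < w d0 ∧ ∀ d, d0 < d → d < N → w' d ≤ w d

lemma WR_wf (N : ℕ) : WellFounded (WR N) := by
  induction N with
  | zero => exact ⟨fun w => ⟨_, fun w' ⟨d, hd, _⟩ => absurd hd (by simp)⟩⟩
  | succ N ih =>
    have h := InvImage.wf (fun w : ℕ → ℕ => (w N, w)) (WellFounded.prod_lex Nat.lt_wfRel.wf ih)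
    refine Subrelation.wf ?_ h
    rintro w' w ⟨d0, hd0, hlt, hle⟩
    rcases Nat.lt_succ_iff_lt_or_eq.1 hd0 with hd | rfl
    · rcases (hle N hd (Nat.lt_succ_self _)).lt_or_eq with h1 | h1
      · exact Prod.Lex.left _ _ h1
      · change Prod.Lex _ _ (w' N, w') (w N, w)
        rw [h1]
        exact Prod.Lex.right _ ⟨d0, hd, hlt, fun d h2 h3 => hle d h2 (h3.trans (Nat.lt_succ_self _))⟩
    · exact Prod.Lex.left _ _ hlt

variable {A A' : Type*} [AddCommGroup A] [AddCommGroup A']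

lemma wt_mono {D : ℕ → AddSubgroup A} {S S' : Set A} (h : S ⊆ S') (hf : S'.Finite) (d : ℕ) :
    wt D S d ≤ wt D S' d :=
  Set.ncard_le_ncard (Set.image_mono fun _ hP => ⟨h hP.1, hP.2⟩)
    ((hf.subset fun _ hP => hP.1).image _)

lemma wt_comap {D : ℕ → AddSubgroup A} {D' : ℕ → AddSubgroup A'} (φ : A →+ A')
    (hφ : ∀ P d, φ P ∈ D' d ↔ P ∈ D d) {S : Set A} (hf : S.Finite) (d : ℕ) :
    wt D' (φ '' S) d ≤ wt D S d := by
  have hle : D d ≤ (D' d).comap φ := fun P hP => (hφ P d).2 hP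
  have hfin : ((QuotientAddGroup.mk : A → A ⧸ D d) '' {P | P ∈ S ∧ P ∈ D (d+1) ∧ P ∉ D d}).Finite :=
    (hf.subset fun _ hP => hP.1).image _
  refine le_trans (Set.ncard_le_ncard ?_ (hfin.image (QuotientAddGroup.map _ _ φ hle)))
    (Set.ncard_image_le hfin)
  rintro _ ⟨_, ⟨⟨P, hP, rfl⟩, h1, h2⟩, rfl⟩
  refine ⟨QuotientAddGroup.mk P, ⟨P, ⟨hP, (hφ _ _).1 h1, fun h => h2 ((hφ _ _).2 h)⟩, rfl⟩, rfl⟩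

lemma exists_deg {D : ℕ → AddSubgroup A} {P : A} {N d0 : ℕ} (hm : Monotone D) (hP : P ∈ D N)
    (h0 : P ∉ D d0) : ∃ e, d0 ≤ e ∧ e < N ∧ P ∈ D (e+1) ∧ P ∉ D e := by
  have hex : ∃ n, P ∈ D n := ⟨N, hP⟩
  have h1 : d0 < Nat.find hex := by
    by_contra! h
    exact h0 (hm h (Nat.find_spec hex))
  obtain ⟨e, he⟩ : ∃ e, Nat.find hex = e + 1 := ⟨Nat.find hex - 1, by omega⟩
  refine ⟨e, by omega, ?_, he ▸ Nat.find_spec hex, Nat.find_min hex (by omega)⟩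
  have := Nat.find_min' hex hP
  omega

lemma wt_decrease {D : ℕ → AddSubgroup A} (hm : Monotone D) {N : ℕ} {S S' : Set A}
    (hf : S.Finite) (hN : ∀ P ∈ S, P ∈ D N) {Q : A} (hQ : Q ∈ S) {d0 : ℕ}
    (hQ1 : Q ∈ D (d0+1)) (hmin : ∀ P ∈ S, P ∉ D d0)
    (hS' : ∀ P' ∈ S', ∃ P ∈ S, ∀ d, d0 ≤ d → P ∈ D (d+1) → P' - (P - Q) ∈ D d) :
    WR N (wt D S') (wt D S) := by
  have hfin : ∀ d, ((QuotientAddGroup.mk : A → A ⧸ D d) ''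
      {P | P ∈ S ∧ P ∈ D (d+1) ∧ P ∉ D d}).Finite := fun d => (hf.subset fun _ hP => hP.1).image _
  have hd0N : d0 < N := by
    by_contra! h
    exact hmin Q hQ (hm h (hN Q hQ))
  have key : ∀ P' ∈ S', ∃ P ∈ S, ∃ e, d0 ≤ e ∧ P ∈ D (e+1) ∧ P ∉ D e ∧ P' - (P - Q) ∈ D e := by
    intro P' hP'
    obtain ⟨P, hP, h⟩ := hS' P' hP'
    obtain ⟨e, he, _, h1, h2⟩ := exists_deg hm (hN P hP) (hmin P hP)
    exact ⟨P, hP, e, he, h1, h2, h e he h1⟩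
  refine ⟨d0, hd0N, ?_, fun d hd hdN => ?_⟩
  · have hQm : (QuotientAddGroup.mk Q : A ⧸ D d0) ∈ ((QuotientAddGroup.mk : A → A ⧸ D d0) ''
      {P | P ∈ S ∧ P ∈ D (d0+1) ∧ P ∉ D d0}) := ⟨Q, ⟨hQ, hQ1, hmin Q hQ⟩, rfl⟩
    have hsub : ((QuotientAddGroup.mk : A → A ⧸ D d0) ''
      {P | P ∈ S' ∧ P ∈ D (d0+1) ∧ P ∉ D d0}) ⊆ (fun x => x - (QuotientAddGroup.mk Q : A ⧸ D d0)) ''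
        (((QuotientAddGroup.mk : A → A ⧸ D d0) ''
      {P | P ∈ S ∧ P ∈ D (d0+1) ∧ P ∉ D d0}) \ {(QuotientAddGroup.mk Q : A ⧸ D d0)}) := by
      rintro _ ⟨P', ⟨hP', h1, h2⟩, rfl⟩
      obtain ⟨P, hP, e, he, h3, h4, h5⟩ := key P' hP'
      rcases he.lt_or_eq with he | rfl
      · exfalso
        apply h4
        have : P = P' - (P' - (P - Q)) + Q := by abel
        rw [this]
        exact add_mem (sub_mem (hm he h1) h5) (hm he hQ1)
      · refine ⟨QuotientAddGroup.mk P, ⟨⟨P, ⟨hP, h3, h4⟩, rfl⟩, ?_⟩, ?_⟩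
        · intro h
          rw [Set.mem_singleton_iff, QuotientAddGroup.eq, ] at h
          apply h2
          have : P' = P' - (P - Q) - (-P + Q) := by abel
          rw [this]
          exact sub_mem h5 h
        · change (QuotientAddGroup.mk (P - Q) : A ⧸ D d0) = _
          rw [QuotientAddGroup.eq]
          convert h5 using 1; abel
    calc wt D S' d0 ≤ _ := Set.ncard_le_ncard hsub (((hfin d0).subset Set.sdiff_subset).image _)
      _ ≤ _ := Set.ncard_image_le ((hfin d0).subset Set.sdiff_subset)
      _ < wt D S d0 := Set.ncard_sdiff_singleton_lt_of_mem hQm (hfin d0)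
  · refine Set.ncard_le_ncard ?_ (hfin d)
    rintro _ ⟨P', ⟨hP', h1, h2⟩, rfl⟩
    obtain ⟨P, hP, e, he, h3, h4, h5⟩ := key P' hP'
    rcases he.lt_or_eq with he | rfl
    · have hQe : Q ∈ D e := hm he hQ1
      have h6 : P' - P ∈ D e := by
        have : P' - P = P' - (P - Q) - Q := by abel
        rw [this]; exact sub_mem h5 hQe
      have h7 : P' ∈ D (e+1) := by
        have : P' = (P' - P) + P := by abel
        rw [this]; exact add_mem (hm (Nat.le_succ e) h6) h3
      have h8 : P' ∉ D e := fun h => h4 (by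
        have : P = P' - (P' - P) := by abel
        rw [this]; exact sub_mem h h6)
      have : e = d := by
        by_contra hne
        rcases lt_or_gt_of_ne hne with hlt | hlt
        · exact h2 (hm hlt h7)
        · exact h8 (hm hlt h1)
      subst this
      refine ⟨P, ⟨hP, h3, h4⟩, ?_⟩
      rw [QuotientAddGroup.eq]
      convert h6 using 1; abel
    · exfalso
      apply h2
      have : P' = P' - (P - Q) + (P - Q) := by abel
      rw [this]
      exact hm hd (add_mem (hm (Nat.le_succ d0) h5) (sub_mem h3 hQ1))

end weights
end PS2file

section PS3file
open Filter Topology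
open scoped Classical symmDiff

/-! ### Parametric IP polynomial van der Waerden -/

section vdw

/-- Sum over a finset as a homomorphism. -/
def sH {ι V : Type} [AddCommGroup V] (α : Finset ι) : (ι → V) →+ V where
  toFun n := ∑ i ∈ α, n i
  map_zero' := by simp
  map_add' := by intro x y; simp [Finset.sum_add_distrib]

lemma sH_apply {ι V : Type} [AddCommGroup V] (α : Finset ι) (n : ι → V) :
    sH α n = ∑ i ∈ α, n i := rfl

lemma sH_surj {ι V : Type} [AddCommGroup V] {α : Finset ι} (h : α.Nonempty) :
    Function.Surjective (sH (V := V) α) := by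
  obtain ⟨i, hi⟩ := h
  intro v
  refine ⟨Pi.single i v, ?_⟩
  rw [sH_apply, Finset.sum_eq_single i]
  · simp
  · intro b _ hb; simp [hb]
  · intro h; exact absurd hi h

/-- filtration by degree in the second variable -/
def FD (M V Γ : Type) [AddCommGroup V] [AddCommGroup Γ] (d : ℕ) :
    AddSubgroup (M × V → Γ) where
  carrier := {Q | ∀ m, (fun v => Q (m, v)) ∈ PD V Γ d}
  zero_mem' := fun _ => (PD V Γ d).zero_mem
  add_mem' := fun hP hQ m => (PD V Γ d).add_mem (hP m) (hQ m)
  neg_mem' := fun hP m => (PD V Γ d).neg_mem (hP m)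

variable {V Γ : Type} [AddCommGroup V] [AddCommGroup Γ]

lemma FD_iff {M : Type} {d : ℕ} {Q : M × V → Γ} :
    Q ∈ FD M V Γ d ↔ ∀ m, (fun v => Q (m, v)) ∈ PD V Γ d := Iff.rfl

lemma FD_mono (M : Type) : Monotone (FD M V Γ) := fun _ _ h _ hQ m => PD_mono h (hQ m)

theorem vdw_param (N : ℕ) (w0 : ℕ → ℕ) : ∀ (M : Type) (_ : AddCommGroup M) (J : Type) (_ : Fintype J)
    (Q : J → M × V → Γ), (∀ j, PolyMap (Q j)) → (∀ j, Q j ∈ FD M V Γ N) → (∀ j m, Q j (m, 0) = 0) →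
    wt (FD M V Γ) {P | P ∈ Set.range Q ∧ P ≠ 0} = w0 →
    ∀ (K : Type) (_ : Fintype K), ∃ (ι : Type) (_ : Fintype ι) (A : Type) (_ : Fintype A)
      (w : A → M × (ι → V) → Γ), (∀ a, PolyMap (w a)) ∧ (∀ a, w a 0 = 0) ∧
      ∀ m n (χ : Γ → K), ∃ a, ∃ α : Finset ι, α.Nonempty ∧
        ∀ j, χ (w a (m, n) + Q j (m, sH α n)) = χ (w a (m, n)) := by
  induction w0 using (WR_wf N).induction with
  | _ w0 IH =>
  intro M _ J _ Q hpoly hN h0 hw K _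
  -- trivial case
  by_cases hJ : ∀ j, Q j = 0
  · refine ⟨Unit, inferInstance, Unit, inferInstance, fun _ _ => 0, fun _ => PolyMap.zero,
      fun _ => rfl, fun m n χ => ⟨(), {()}, by simp, fun j => ?_⟩⟩
    simp [hJ j]
  push Not at hJ
  set S : Set (M × V → Γ) := {P | P ∈ Set.range Q ∧ P ≠ 0} with hS
  have hSf : S.Finite := (Set.finite_range Q).subset fun _ h => h.1
  have hnot1 : ∀ P ∈ S, P ∉ FD M V Γ 1 := by
    rintro _ ⟨⟨j, rfl⟩, hne⟩ h1
    apply hne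
    funext ⟨m, v⟩
    have := PD_one_iff.1 (h1 m) v
    simpa [h0] using this
  -- minimal degree element
  obtain ⟨d0, Q1, hd0, hQ1S, hQ1d, hmin⟩ : ∃ d0, ∃ Q1 : M × V → Γ, 1 ≤ d0 ∧ Q1 ∈ S ∧
      Q1 ∈ FD M V Γ (d0+1) ∧ ∀ P ∈ S, P ∉ FD M V Γ d0 := by
    have hex : ∃ d, ∃ P ∈ S, P ∈ FD M V Γ d := by
      obtain ⟨j, hj⟩ := hJ
      exact ⟨N, Q j, ⟨⟨j, rfl⟩, hj⟩, hN j⟩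
    obtain ⟨P, hP, hPd⟩ := Nat.find_spec hex
    have h2 : 1 < Nat.find hex := by
      by_contra! h
      exact hnot1 P hP (FD_mono M h hPd)
    refine ⟨Nat.find hex - 1, P, by omega, hP, ?_, fun P' hP' h => ?_⟩
    · rwa [Nat.sub_add_cancel (by omega)]
    · exact Nat.find_min hex (m := Nat.find hex - 1) (by omega) ⟨P', hP', h⟩
  obtain ⟨j1, hj1⟩ := hQ1S.1
  -- colour focusing
  have focus : ∀ t : ℕ, ∃ (ι : Type) (_ : Fintype ι) (A : Type) (_ : Fintype A)
      (w : A → M × (ι → V) → Γ), (∀ a, PolyMap (w a)) ∧ (∀ a, w a 0 = 0) ∧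
      ∀ m n (χ : Γ → K), ∃ a, (∃ α : Finset ι, α.Nonempty ∧
        ∀ j, χ (w a (m, n) + Q j (m, sH α n)) = χ (w a (m, n))) ∨
        ∃ C : Finset K, C.card = t ∧ ∀ c ∈ C, ∃ α : Finset ι, α.Nonempty ∧
          ∀ j, Q j ≠ 0 → χ (w a (m, n) + Q j (m, sH α n)) = c := by
    intro t
    induction t with
    | zero =>
      exact ⟨Unit, inferInstance, Unit, inferInstance, fun _ _ => 0, fun _ => PolyMap.zero,
        fun _ => rfl, fun m n χ => ⟨(), Or.inr ⟨∅, by simp, by simp⟩⟩⟩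
    | succ t ih =>
      obtain ⟨ι, _, A, _, w, hwp, hw0, hwt⟩ := ih
      -- derived family
      let P : {j // Q j ≠ 0} × Finset ι → (M × (ι → V)) × V → Γ := fun p y =>
        Q p.1 (y.1.1, y.2 + sH p.2 y.1.2) - Q p.1 (y.1.1, sH p.2 y.1.2) - Q1 (y.1.1, y.2)
      have hP0 : ∀ p m, P p (m, 0) = 0 := by
        intro p m
        simp [P, ← hj1, h0]
      have hPpoly : ∀ p, PolyMap (P p) := by
        intro p
        let φ1 : (M × (ι → V)) × V →+ M × V := AddMonoidHom.mk'
          (fun y => (y.1.1, y.2 + sH p.2 y.1.2)) (fun a b => by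
            ext <;> simp [add_add_add_comm])
        let φ2 : (M × (ι → V)) × V →+ M × V := AddMonoidHom.mk'
          (fun y => (y.1.1, sH p.2 y.1.2)) (fun a b => by ext <;> simp)
        let φ3 : (M × (ι → V)) × V →+ M × V := AddMonoidHom.mk'
          (fun y => (y.1.1, y.2)) (fun a b => by ext <;> simp)
        exact (((hpoly p.1).comp_hom φ1).sub ((hpoly p.1).comp_hom φ2)).sub
          ((hj1 ▸ hpoly j1 : PolyMap Q1).comp_hom φ3)
      have hQ1N : Q1 ∈ FD M V Γ N := hj1 ▸ hN j1
      have hNpos : 1 ≤ N := by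
        by_contra! h
        exact hnot1 Q1 hQ1S (FD_mono M (by omega) hQ1N)
      have hPN : ∀ p, P p ∈ FD (M × (ι → V)) V Γ N := by
        intro p m
        exact sub_mem (sub_mem (PD_shift (hN p.1 m.1) (sH p.2 m.2))
          (PD_mono hNpos (PD_one_iff.2 fun _ => rfl))) (hQ1N m.1)
      let Φ : (M × V → Γ) →+ ((M × (ι → V)) × V → Γ) := AddMonoidHom.mk'
        (fun R y => R (y.1.1, y.2)) (fun _ _ => rfl)
      have hΦ : ∀ R d, Φ R ∈ FD (M × (ι → V)) V Γ d ↔ R ∈ FD M V Γ d := by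
        intro R d
        exact ⟨fun h m => h (m, 0), fun h m => h m.1⟩
      have hWR : WR N (wt (FD (M × (ι → V)) V Γ) {R | R ∈ Set.range P ∧ R ≠ 0}) w0 := by
        have h1 : WR N (wt (FD (M × (ι → V)) V Γ) {R | R ∈ Set.range P ∧ R ≠ 0})
            (wt (FD (M × (ι → V)) V Γ) (Φ '' S)) := by
          refine wt_decrease (FD_mono _) (hSf.image _) ?_ (Q := Φ Q1) ⟨Q1, hQ1S, rfl⟩ (d0 := d0)
            ((hΦ _ _).2 hQ1d) ?_ ?_
          · rintro _ ⟨R, ⟨⟨j, rfl⟩, _⟩, rfl⟩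
            exact (hΦ _ _).2 (hN j)
          · rintro _ ⟨R, hR, rfl⟩ h
            exact hmin R hR ((hΦ _ _).1 h)
          · rintro _ ⟨⟨p, rfl⟩, _⟩
            refine ⟨Φ (Q p.1), ⟨Q p.1, ⟨⟨p.1, rfl⟩, p.1.2⟩, rfl⟩, fun d hd hpd m => ?_⟩
            have h2 := (hΦ _ _).1 hpd m.1
            have h3 := sub_mem (h2 (sH p.2 m.2)) (PD_mono (hd0.trans hd)
              (PD_one_iff.2 fun _ => rfl : (fun _ : V => Q p.1 (m.1, sH p.2 m.2)) ∈ PD V Γ 1))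
            convert h3 using 1
            funext v
            simp only [P, Φ, AddMonoidHom.mk'_apply, Pi.sub_apply]
            abel
        obtain ⟨d, hd, hlt, hle⟩ := h1
        subst hw
        exact ⟨d, hd, hlt.trans_le (wt_comap Φ hΦ hSf d), fun e he he' =>
          (hle e he he').trans (wt_comap Φ hΦ hSf e)⟩
      obtain ⟨ι2, _, A2, _, w2, hw2p, hw20, hw2⟩ := IH _ hWR (M × (ι → V)) inferInstance
        ({j // Q j ≠ 0} × Finset ι) inferInstance P hPpoly hPN hP0 rfl
        (A × Option (J × Finset ι) → K) inferInstance
      let r1 : M × (ι ⊕ ι2 → V) →+ M × (ι → V) := AddMonoidHom.mk'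
        (fun y => (y.1, fun i => y.2 (Sum.inl i))) (fun a b => rfl)
      let r2 : M × (ι ⊕ ι2 → V) →+ (M × (ι → V)) × (ι2 → V) := AddMonoidHom.mk'
        (fun y => ((y.1, fun i => y.2 (Sum.inl i)), fun i => y.2 (Sum.inr i))) (fun a b => rfl)
      let r3 : Finset ι2 → M × (ι ⊕ ι2 → V) →+ M × V := fun β => AddMonoidHom.mk'
        (fun y => (y.1, sH β (fun i => y.2 (Sum.inr i)))) (fun a b => by
          ext
          · rfl
          · change sH β ((fun i => a.2 (Sum.inr i)) + (fun i => b.2 (Sum.inr i))) = _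
            rw [map_add]; rfl)
      let wn : A2 × A × Option (Finset ι2) → M × (ι ⊕ ι2 → V) → Γ := fun p y =>
        match p.2.2 with
        | none => w2 p.1 (r2 y) + w p.2.1 (r1 y)
        | some β => w2 p.1 (r2 y) + w p.2.1 (r1 y) - Q1 (r3 β y)
      refine ⟨ι ⊕ ι2, inferInstance, A2 × A × Option (Finset ι2), inferInstance, wn, ?_, ?_, ?_⟩
      · rintro ⟨a2, a, _ | β⟩
        · exact ((hw2p a2).comp_hom r2).add ((hwp a).comp_hom r1)
        · exact (((hw2p a2).comp_hom r2).add ((hwp a).comp_hom r1)).sub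
            ((hj1 ▸ hpoly j1 : PolyMap Q1).comp_hom (r3 β))
      · rintro ⟨a2, a, _ | β⟩
        · simp only [wn, map_zero, hw0, hw20, add_zero]
        · have : Q1 0 = 0 := by rw [← hj1]; exact h0 j1 0
          simp only [wn, map_zero, hw0, hw20, add_zero, this, sub_zero]
      · intro m nn χ
        set n1 : ι → V := fun i => nn (Sum.inl i) with hn1
        set n2 : ι2 → V := fun i => nn (Sum.inr i) with hn2
        have hsum : ∀ (α : Finset ι) (β : Finset ι2), sH (α.disjSum β) nn = sH α n1 + sH β n2 := by
          intro α β
          simp only [sH_apply, Finset.sum_disjSum, hn1, hn2]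
        let χ' : Γ → A × Option (J × Finset ι) → K := fun b p =>
          match p.2 with
          | none => χ (b + w p.1 (m, n1))
          | some q => χ (b + w p.1 (m, n1) + Q q.1 (m, sH q.2 n1))
        obtain ⟨a2, β, hβ, hχ'⟩ := hw2 (m, n1) n2 χ'
        set b := w2 a2 ((m, n1), n2) with hb
        obtain ⟨a, ha⟩ := hwt m n1 (fun g => χ (b + g))
        have lift : ∀ α : Finset ι, α.Nonempty →
            (∀ j, Q j ≠ 0 → χ (b + (w a (m, n1) + Q j (m, sH α n1))) = χ (b + w a (m, n1))) →
            ∃ a, ((∃ α : Finset (ι ⊕ ι2), α.Nonempty ∧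
              ∀ j, χ (wn a (m, nn) + Q j (m, sH α nn)) = χ (wn a (m, nn)))) := by
          intro α hα h
          refine ⟨(a2, a, none), α.disjSum ∅, ?_, fun j => ?_⟩
          · obtain ⟨i, hi⟩ := hα
            exact ⟨Sum.inl i, by simp [hi]⟩
          · rw [hsum]
            have e1 : wn (a2, a, none) (m, nn) = b + w a (m, n1) := rfl
            by_cases hj : Q j = 0
            · simp [hj]
            · have := h j hj
              rw [e1, ← this]
              simp [sH_apply, add_assoc]
        rcases ha with ⟨α, hα, h⟩ | ⟨C, hC, hCc⟩
        · obtain ⟨a', h'⟩ := lift α hα fun j _ => h j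
          exact ⟨a', Or.inl h'⟩
        · by_cases hc : χ (b + w a (m, n1)) ∈ C
          · obtain ⟨α, hα, h⟩ := hCc _ hc
            obtain ⟨a', h'⟩ := lift α hα h
            exact ⟨a', Or.inl h'⟩
          · refine ⟨(a2, a, some β), Or.inr ⟨insert (χ (b + w a (m, n1))) C, by simp [hc, hC], ?_⟩⟩
            have e1 : wn (a2, a, some β) (m, nn) = b + w a (m, n1) - Q1 (m, sH β n2) := rfl
            intro c hcC
            rcases Finset.mem_insert.1 hcC with rfl | hcC
            · refine ⟨(∅ : Finset ι).disjSum β, ?_, fun j hj => ?_⟩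
              · obtain ⟨i, hi⟩ := hβ
                exact ⟨Sum.inr i, by simp [hi]⟩
              · have := congrFun (hχ' (⟨j, hj⟩, ∅)) (a, none)
                simp only [χ', P] at this
                rw [← this, e1, hsum]
                congr 1
                simp only [sH_apply, Finset.sum_empty, zero_add, add_zero, h0]
                abel
            · obtain ⟨α, hα, h⟩ := hCc c hcC
              refine ⟨α.disjSum β, ?_, fun j hj => ?_⟩
              · obtain ⟨i, hi⟩ := hα
                exact ⟨Sum.inl i, by simp [hi]⟩
              · have := congrFun (hχ' (⟨j, hj⟩, α)) (a, some (j, α))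
                simp only [χ', P] at this
                rw [← h j hj, ← add_assoc b, ← this, e1, hsum]
                congr 1
                rw [add_comm (sH α n1)]
                abel
  obtain ⟨ι, _, A, _, w, hwp, hw0, hwt⟩ := focus (Fintype.card K)
  refine ⟨ι, inferInstance, A, inferInstance, w, hwp, hw0, fun m n χ => ?_⟩
  obtain ⟨a, ha⟩ := hwt m n χ
  refine ⟨a, ?_⟩
  rcases ha with h | ⟨C, hC, h⟩
  · exact h
  · have : C = Finset.univ := Finset.card_eq_iff_eq_univ C |>.1 hC
    obtain ⟨α, hα, h'⟩ := h (χ (w a (m, n))) (by simp [this])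
    refine ⟨α, hα, fun j => ?_⟩
    by_cases hj : Q j = 0
    · simp [hj]
    · exact h' j hj

/-- IP polynomial van der Waerden theorem. -/
theorem ip_vdw {J : Type} [Fintype J] (Q : J → V → Γ) (hpoly : ∀ j, PolyMap (Q j))
    (h0 : ∀ j, Q j 0 = 0) (K : Type) [Fintype K] :
    ∃ (ι : Type) (_ : Fintype ι) (A : Type) (_ : Fintype A)
      (w : A → (ι → V) → Γ), (∀ a, PolyMap (w a)) ∧ (∀ a, w a 0 = 0) ∧
      ∀ n (χ : Γ → K), ∃ a, ∃ α : Finset ι, α.Nonempty ∧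
        ∀ j, χ (w a n + Q j (sH α n)) = χ (w a n) := by
  obtain ⟨N, hN⟩ := polyMap_bound hpoly
  obtain ⟨ι, _, A, _, w, hwp, hw0, h⟩ := vdw_param (V := V) (Γ := Γ) N _ Unit inferInstance J inferInstance
    (fun j y => Q j y.2)
    (fun j => (hpoly j).comp_hom (AddMonoidHom.snd Unit V)) (fun j _ => hN j) (fun j _ => h0 j) rfl
    K inferInstance
  refine ⟨ι, inferInstance, A, inferInstance, fun a n => w a ((), n), fun a =>
    (hwp a).comp_hom (AddMonoidHom.inr Unit (ι → V)), fun a => hw0 a, fun n χ => h () n χ⟩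

end vdw
end PS3file

section PS4file
open Filter Topology
open scoped Classical symmDiff
open MeasureTheory ProbabilityTheory

/-! ### Bounded measurable functions and conditional expectations -/

section bm
variable {X : Type}

/-- bounded measurable functions -/
def BM (Z : MeasurableSpace X) (f : X → ℝ) : Prop := Measurable[Z] f ∧ ∃ C : ℝ, ∀ x, |f x| ≤ C

variable {Z Z' : MeasurableSpace X} {f g : X → ℝ}

lemma BM.meas (hf : BM Z f) : Measurable[Z] f := hf.1

lemma BM.bd (hf : BM Z f) : ∃ C : ℝ, 0 < C ∧ ∀ x, |f x| ≤ C := by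
  obtain ⟨C, hC⟩ := hf.2
  exact ⟨max C 1, by positivity, fun x => (hC x).trans (le_max_left _ _)⟩

lemma BM.mono (hf : BM Z f) (h : Z ≤ Z') : BM Z' f := ⟨hf.1.mono h le_rfl, hf.2⟩

lemma BM.const (c : ℝ) : BM Z (fun _ : X => c) := ⟨measurable_const, |c|, fun _ => le_rfl⟩

lemma BM.add (hf : BM Z f) (hg : BM Z g) : BM Z (fun x => f x + g x) := by
  obtain ⟨hf1, C, hC⟩ := hf
  obtain ⟨hg1, D, hD⟩ := hg
  exact ⟨hf1.add hg1, C + D, fun x => (abs_add_le _ _).trans (add_le_add (hC x) (hD x))⟩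

lemma BM.neg (hf : BM Z f) : BM Z (fun x => - f x) := by
  obtain ⟨hf1, C, hC⟩ := hf
  exact ⟨hf1.neg, C, fun x => by simpa using hC x⟩

lemma BM.sub (hf : BM Z f) (hg : BM Z g) : BM Z (fun x => f x - g x) := by
  simpa [sub_eq_add_neg] using hf.add hg.neg

lemma BM.mul (hf : BM Z f) (hg : BM Z g) : BM Z (fun x => f x * g x) := by
  obtain ⟨hf1, C, hC⟩ := hf
  obtain ⟨hg1, D, hD⟩ := hg
  refine ⟨hf1.mul hg1, C * D, fun x => ?_⟩
  rw [abs_mul]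
  exact mul_le_mul (hC x) (hD x) (abs_nonneg _) ((abs_nonneg _).trans (hC x))

lemma BM.abs (hf : BM Z f) : BM Z (fun x => |f x|) := by
  obtain ⟨hf1, C, hC⟩ := hf
  exact ⟨continuous_abs.measurable.comp hf1, C, fun x => by simpa using hC x⟩

lemma BM.pow (hf : BM Z f) (n : ℕ) : BM Z (fun x => f x ^ n) := by
  induction n with
  | zero => simpa using BM.const 1
  | succ n ih => simpa [pow_succ] using ih.mul hf

lemma BM.sum {κ : Type*} (s : Finset κ) {F : κ → X → ℝ} (h : ∀ k ∈ s, BM Z (F k)) :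
    BM Z (fun x => ∑ k ∈ s, F k x) := by
  induction s using Finset.induction_on with
  | empty => simpa using BM.const 0
  | insert k s hk ih =>
    simp only [Finset.sum_insert hk]
    exact (h k (by simp)).add (ih fun j hj => h j (by simp [hj]))

lemma BM.prod {κ : Type*} (s : Finset κ) {F : κ → X → ℝ} (h : ∀ k ∈ s, BM Z (F k)) :
    BM Z (fun x => ∏ k ∈ s, F k x) := by
  induction s using Finset.induction_on with
  | empty => simpa using BM.const 1
  | insert k s hk ih =>
    simp only [Finset.prod_insert hk]
    exact (h k (by simp)).mul (ih fun j hj => h j (by simp [hj]))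

lemma BM.comp {W : Type} {mW : MeasurableSpace W} {T : W → X} (hf : BM Z f) (hT : Measurable[mW, Z] T) :
    BM mW (fun x => f (T x)) := ⟨hf.1.comp hT, hf.2.imp fun _ h _ => h _⟩

lemma BM.ind {A : Set X} (hA : MeasurableSet[Z] A) : BM Z (A.indicator (fun _ => (1:ℝ))) := by
  refine ⟨measurable_const.indicator hA, 1, fun x => ?_⟩
  by_cases h : x ∈ A <;> simp [h]

lemma BM.integrable {mX : MeasurableSpace X} {μ : Measure X} [IsFiniteMeasure μ] (hf : BM mX f) :
    Integrable f μ := by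
  obtain ⟨hf1, C, hC⟩ := hf
  exact Integrable.of_bound hf1.aestronglyMeasurable C (Eventually.of_forall hC)

lemma BM.select {K : Type} [Fintype K] {F : K → X → ℝ} (h : ∀ k, BM Z (F k)) {κ : X → K}
    (hκ : ∀ k, MeasurableSet[Z] (κ ⁻¹' {k})) : BM Z (fun x => F (κ x) x) := by
  have : (fun x => F (κ x) x) = fun x => ∑ k, (κ ⁻¹' {k}).indicator (fun _ => (1:ℝ)) x * F k x := by
    funext x
    rw [Finset.sum_eq_single (κ x)]
    · simp
    · intro b _ hb
      rw [Set.indicator_of_notMem (by simpa using hb.symm), zero_mul]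
    · simp
  rw [this]
  exact BM.sum _ fun k _ => (BM.ind (hκ k)).mul (h k)

end bm

section ce

/-- conditional expectation, everywhere defined version -/
noncomputable def cE {X : Type} {mX : MeasurableSpace X} [StandardBorelSpace X]
    (μ : Measure X) [IsProbabilityMeasure μ] (Y : MeasurableSpace X) (f : X → ℝ)
    (x : X) : ℝ := ∫ y, f y ∂(@condExpKernel X mX _ μ _ Y x)

variable {X : Type} {Y Z : MeasurableSpace X} {f g : X → ℝ}
  [mX : MeasurableSpace X] [StandardBorelSpace X] {μ : Measure X} [IsProbabilityMeasure μ]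

lemma cE_abs_le_of_bd {C : ℝ} (h : ∀ x, |f x| ≤ C) (x : X) : |cE μ Y f x| ≤ C := by
  have := norm_integral_le_of_norm_le_const (μ := condExpKernel μ Y x) (f := f) (C := C)
    (Eventually.of_forall h)
  simpa [cE] using this

lemma BM.cE (hf : BM mX f) : BM Y (cE μ Y f) := by
  obtain ⟨C, _, hC⟩ := hf.bd
  exact ⟨hf.1.stronglyMeasurable.integral_condExpKernel.measurable, C, cE_abs_le_of_bd hC⟩

lemma cE_add (hf : BM mX f) (hg : BM mX g) (x : X) :
    cE μ Y (fun x => f x + g x) x = cE μ Y f x + cE μ Y g x :=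
  integral_add hf.integrable hg.integrable

lemma cE_sub (hf : BM mX f) (hg : BM mX g) (x : X) :
    cE μ Y (fun x => f x - g x) x = cE μ Y f x - cE μ Y g x :=
  integral_sub hf.integrable hg.integrable

lemma cE_const_mul (c : ℝ) (x : X) : cE μ Y (fun x => c * f x) x = c * cE μ Y f x :=
  integral_const_mul c f

lemma cE_const (c : ℝ) (x : X) : cE μ Y (fun _ => c) x = c := by simp [cE]

lemma cE_sum {κ : Type*} (s : Finset κ) {F : κ → X → ℝ} (h : ∀ k ∈ s, BM mX (F k)) (x : X) :
    cE μ Y (fun x => ∑ k ∈ s, F k x) x = ∑ k ∈ s, cE μ Y (F k) x :=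
  integral_finsetSum s fun k hk => (h k hk).integrable

lemma cE_mono (hf : BM mX f) (hg : BM mX g) (h : ∀ x, f x ≤ g x) (x : X) :
    cE μ Y f x ≤ cE μ Y g x := integral_mono hf.integrable hg.integrable h

lemma cE_nonneg (h : ∀ x, 0 ≤ f x) (x : X) : 0 ≤ cE μ Y f x := integral_nonneg h

lemma cE_abs_le (x : X) : |cE μ Y f x| ≤ cE μ Y (fun x => |f x|) x :=
  abs_integral_le_integral_abs

lemma cE_ae (hY : Y ≤ mX) (hf : BM mX f) : cE μ Y f =ᵐ[μ] μ[f|Y] :=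
  (condExp_ae_eq_integral_condExpKernel hY hf.integrable).symm

lemma cE_congr (hY : Y ≤ mX) (hf : BM mX f) (hg : BM mX g) (h : f =ᵐ[μ] g) :
    cE μ Y f =ᵐ[μ] cE μ Y g :=
  (cE_ae hY hf).trans ((condExp_congr_ae h).trans (cE_ae hY hg).symm)

lemma cE_setInt (hY : Y ≤ mX) (hf : BM mX f) {B : Set X} (hB : MeasurableSet[Y] B) :
    ∫ x in B, cE μ Y f x ∂μ = ∫ x in B, f x ∂μ := by
  rw [← setIntegral_condExp hY hf.integrable hB]
  exact setIntegral_congr_ae (hY _ hB) ((cE_ae hY hf).mono fun x hx _ => hx)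

lemma cE_int (hY : Y ≤ mX) (hf : BM mX f) : ∫ x, cE μ Y f x ∂μ = ∫ x, f x ∂μ := by
  simpa using cE_setInt hY hf (B := Set.univ) (@MeasurableSet.univ _ Y)

lemma cE_unique (hY : Y ≤ mX) (hf : BM mX f) (hg : BM Y g)
    (h : ∀ B, MeasurableSet[Y] B → ∫ x in B, g x ∂μ = ∫ x in B, f x ∂μ) : g =ᵐ[μ] cE μ Y f := by
  refine EventuallyEq.trans ?_ (cE_ae hY hf).symm
  exact ae_eq_condExp_of_forall_setIntegral_eq hY hf.integrable
    (fun s _ _ => (hg.mono hY).integrable.integrableOn) (fun s hs _ => h s hs)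
    hg.1.stronglyMeasurable.aestronglyMeasurable

lemma cE_self (hY : Y ≤ mX) (hf : BM Y f) : cE μ Y f =ᵐ[μ] f :=
  (cE_unique hY (hf.mono hY) hf fun _ _ => rfl).symm

lemma cE_mul_left (hY : Y ≤ mX) (hf : BM mX f) (hg : BM Y g) :
    cE μ Y (fun x => g x * f x) =ᵐ[μ] fun x => g x * cE μ Y f x := by
  have h1 : BM mX (fun x => g x * f x) := (hg.mono hY).mul hf
  have h2 := condExp_mul_of_stronglyMeasurable_left (μ := μ) (m := Y) (f := g) (g := f)
    hg.1.stronglyMeasurable h1.integrable hf.integrable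
  filter_upwards [cE_ae hY h1, cE_ae hY hf, h2] with x a b c
  rw [a, b]; exact c

lemma cE_int_mul (hY : Y ≤ mX) (hf : BM mX f) (hg : BM Y g) :
    ∫ x, g x * cE μ Y f x ∂μ = ∫ x, g x * f x ∂μ := by
  rw [← integral_congr_ae (cE_mul_left hY hf hg), cE_int hY ((hg.mono hY).mul hf)]

/-- self-adjointness -/
lemma cE_int_mul' (hY : Y ≤ mX) (hf : BM mX f) (hg : BM mX g) :
    ∫ x, cE μ Y g x * cE μ Y f x ∂μ = ∫ x, g x * cE μ Y f x ∂μ := by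
  have := cE_int_mul (μ := μ) hY hg (hf.cE (Y := Y) (μ := μ))
  simp only [mul_comm] at this ⊢
  exact this

lemma cE_tower (hYZ : Y ≤ Z) (hZ : Z ≤ mX) (hf : BM mX f) :
    cE μ Y (cE μ Z f) =ᵐ[μ] cE μ Y f := by
  have hY := hYZ.trans hZ
  have hb := hf.cE (Y := Z) (μ := μ)
  refine cE_unique hY hf ((hb.mono hZ).cE) fun B hB => ?_
  rw [cE_setInt hY (hb.mono hZ) hB, cE_setInt hZ hf (hYZ _ hB)]

lemma int_abs_cE_le (hY : Y ≤ mX) (hf : BM mX f) : ∫ x, |cE μ Y f x| ∂μ ≤ ∫ x, |f x| ∂μ := by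
  rw [← cE_int hY hf.abs]
  exact integral_mono (((hf.cE).mono hY).abs).integrable ((hf.abs.cE).mono hY).integrable
    fun x => cE_abs_le x

lemma int_sq_cE_le (hY : Y ≤ mX) (hf : BM mX f) : ∫ x, (cE μ Y f x)^2 ∂μ ≤ ∫ x, (f x)^2 ∂μ := by
  have hb : BM mX (cE μ Y f) := hf.cE.mono hY
  have h1 : ∫ x, cE μ Y f x * cE μ Y f x ∂μ = ∫ x, cE μ Y f x * f x ∂μ :=
    cE_int_mul hY hf hf.cE
  have h2 : ∫ x, cE μ Y f x * f x ∂μ ≤ ∫ x, ((cE μ Y f x)^2 * (1/2) + (f x)^2 * (1/2)) ∂μ := by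
    refine integral_mono (hb.mul hf).integrable
      (((hb.pow 2).mul (BM.const _)).add ((hf.pow 2).mul (BM.const _))).integrable fun x => ?_
    simp only
    nlinarith [sq_nonneg (cE μ Y f x - f x)]
  rw [integral_add ((hb.pow 2).mul (BM.const _)).integrable
    ((hf.pow 2).mul (BM.const _)).integrable, integral_mul_const, integral_mul_const] at h2
  simp only [← sq] at h1
  linarith

lemma cE_comp (hY : Y ≤ mX) (hf : BM mX f) {T S : X → X} (hT : MeasurePreserving T μ μ)
    (hS : Measurable[mX, mX] S) (hTY : Measurable[Y, Y] T) (hSY : Measurable[Y, Y] S)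
    (hTS : ∀ x, T (S x) = x) (hST : ∀ x, S (T x) = x) :
    cE μ Y (fun x => f (T x)) =ᵐ[μ] fun x => cE μ Y f (T x) := by
  refine (cE_unique hY (hf.comp hT.measurable) ((hf.cE).comp hTY) fun B hB => ?_).symm
  let e : X ≃ᵐ X := ⟨⟨T, S, hST, hTS⟩, hT.measurable, hS⟩
  have hB' : MeasurableSet[Y] (S ⁻¹' B) := hSY hB
  have hBe : B = T ⁻¹' (S ⁻¹' B) := by
    ext x; simp [hST]
  have hemb : MeasurableEmbedding T := e.measurableEmbedding
  rw [hBe, hT.setIntegral_preimage_emb hemb (fun x => cE μ Y f x),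
    hT.setIntegral_preimage_emb hemb f, cE_setInt hY hf hB']

end ce

/-- measure preserving actions -/
structure Act {X Γ : Type} [MeasurableSpace X] [AddCommGroup Γ] (μ : Measure X) (T : Γ → X → X) :
    Prop where
  zero : ∀ x, T 0 x = x
  add : ∀ a b x, T (a + b) x = T a (T b x)
  mp : ∀ a, MeasurePreserving (T a) μ μ

/-- invariant σ-algebras -/
def InvA {X Γ : Type} (T : Γ → X → X) (Y : MeasurableSpace X) : Prop :=
  ∀ a, Measurable[Y, Y] (T a)

section act
variable {X Γ : Type} {Y : MeasurableSpace X} [mX : MeasurableSpace X] [AddCommGroup Γ] {μ : Measure X} {T : Γ → X → X}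

lemma Act.meas (hT : Act μ T) (a : Γ) : Measurable (T a) := (hT.mp a).measurable

lemma Act.neg_cancel (hT : Act μ T) (a : Γ) (x : X) : T (-a) (T a x) = x := by
  rw [← hT.add, neg_add_cancel, hT.zero]

lemma Act.cancel_neg (hT : Act μ T) (a : Γ) (x : X) : T a (T (-a) x) = x := by
  rw [← hT.add, add_neg_cancel, hT.zero]

lemma Act.emb (hT : Act μ T) (a : Γ) : MeasurableEmbedding (T a) :=
  (⟨⟨T a, T (-a), hT.neg_cancel a, hT.cancel_neg a⟩, hT.meas a, hT.meas (-a)⟩ :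
    X ≃ᵐ X).measurableEmbedding

lemma Act.int (hT : Act μ T) (a : Γ) (f : X → ℝ) : ∫ x, f (T a x) ∂μ = ∫ x, f x ∂μ :=
  (hT.mp a).integral_comp (hT.emb a) f

lemma Act.ae (hT : Act μ T) (a : Γ) {p : X → Prop} (h : ∀ᵐ x ∂μ, p x) : ∀ᵐ x ∂μ, p (T a x) :=
  (hT.mp a).quasiMeasurePreserving.ae h

lemma Act.cE [StandardBorelSpace X] [IsProbabilityMeasure μ] (hT : Act μ T)
    (hY : Y ≤ mX) (hi : InvA T Y) {f : X → ℝ} (hf : BM mX f) (a : Γ) :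
    cE μ Y (fun x => f (T a x)) =ᵐ[μ] fun x => cE μ Y f (T a x) :=
  cE_comp hY hf (hT.mp a) (hT.meas (-a)) (hi a) (hi (-a)) (hT.cancel_neg a) (hT.neg_cancel a)

end act
end PS4file

section PS5file
open Filter Topology
open scoped Classical symmDiff
open MeasureTheory ProbabilityTheory

/-! ### Almost periodicity relative to a factor -/

/-- `κ` is measurable with respect to `Y` -/
def ColM {X K : Type} (Y : MeasurableSpace X) (κ : X → K) : Prop := ∀ k, MeasurableSet[Y] (κ ⁻¹' {k})

lemma ColM.comp {X K : Type} {Y : MeasurableSpace X} {κ : X → K} (h : ColM Y κ) {S : X → X}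
    (hS : Measurable[Y, Y] S) : ColM Y (fun x => κ (S x)) := fun k => hS (h k)

lemma ColM.prod {X K K' : Type} {Y : MeasurableSpace X} {κ : X → K} {κ' : X → K'} (h : ColM Y κ)
    (h' : ColM Y κ') : ColM Y (fun x => (κ x, κ' x)) := by
  rintro ⟨k, k'⟩
  have : (fun x => (κ x, κ' x)) ⁻¹' {(k, k')} = κ ⁻¹' {k} ∩ κ' ⁻¹' {k'} := by
    ext x; simp
  rw [this]
  exact @MeasurableSet.inter _ Y _ _ (h k) (h' k')

lemma ColM.pi {X J K : Type} [Finite J] {Y : MeasurableSpace X} {κ : J → X → K}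
    (h : ∀ j, ColM Y (κ j)) : ColM Y (fun x j => κ j x) := by
  intro k
  have : (fun x j => κ j x) ⁻¹' {k} = ⋂ j, κ j ⁻¹' {k j} := by
    ext x; simp [funext_iff]
  rw [this]
  exact @MeasurableSet.iInter _ _ Y _ _ fun j => h j (k j)

lemma ColM.mono {X K : Type} {Y Y' : MeasurableSpace X} {κ : X → K} (h : ColM Y κ) (hY : Y ≤ Y') :
    ColM Y' κ := fun k => hY _ (h k)

lemma ColM.const {X K : Type} {Y : MeasurableSpace X} (k : K) : ColM Y (fun _ : X => k) :=
  fun k' => by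
  by_cases h : k = k'
  · rw [Set.preimage_const_of_mem (by simpa using h)]
    exact @MeasurableSet.univ _ Y
  · rw [Set.preimage_const_of_notMem (by simpa using h)]
    exact @MeasurableSet.empty _ Y

lemma select_eq {X K : Type} [Fintype K] (F : K → X → ℝ) (κ : X → K) :
    (fun x => F (κ x) x) = fun x => ∑ k, (κ ⁻¹' {k}).indicator (F k) x := by
  funext x
  rw [Finset.sum_eq_single (κ x)]
  · simp
  · intro b _ hb
    rw [Set.indicator_of_notMem (by simpa using hb.symm)]
  · simp

/-- Strong almost periodicity along `Λ` relative to `Y`. -/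
def SAP {X Γ : Type} {mX : MeasurableSpace X} [AddCommGroup Γ] (μ : Measure X)
    (T : Γ → X → X) (Y : MeasurableSpace X) (Λ : AddSubgroup Γ) (f : X → ℝ) : Prop :=
  Measurable[mX] f ∧ Integrable f μ ∧ ∀ ε : ℝ, 0 < ε → ∀ η : ℝ, 0 < η →
    ∃ W, MeasurableSet[Y] W ∧ μ.real Wᶜ ≤ η ∧ ∃ (K : Type) (_ : Fintype K) (g : K → X → ℝ),
      (∀ k, Measurable[mX] (g k) ∧ Integrable (g k) μ) ∧ ∀ l ∈ Λ, ∃ κ : X → K, ColM Y κ ∧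
        ∀ B, MeasurableSet[Y] B → B ⊆ W →
          ∫ x in B, |f (T l x) - g (κ x) x| ∂μ ≤ ε * μ.real B

section ap
set_option linter.unusedSectionVars false
variable {X Γ : Type} {Y Z : MeasurableSpace X} {f g : X → ℝ} [mX : MeasurableSpace X]
  {μ : Measure X} [IsProbabilityMeasure μ] [AddCommGroup Γ] {T : Γ → X → X} {Λ : AddSubgroup Γ}

lemma select_mi {K : Type} [Fintype K] (hY : Y ≤ mX) {F : K → X → ℝ}
    (hF : ∀ k, Measurable (F k) ∧ Integrable (F k) μ) {κ : X → K} (hκ : ColM Y κ) :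
    Measurable (fun x => F (κ x) x) ∧ Integrable (fun x => F (κ x) x) μ := by
  rw [select_eq]
  exact ⟨Finset.measurable_sum _ fun k _ => (hF k).1.indicator (hY _ (hκ k)),
    integrable_finsetSum _ fun k _ => (hF k).2.indicator (hY _ (hκ k))⟩

lemma lip_mi {f f' : X → ℝ} (hf : Measurable f ∧ Integrable f μ)
    (hf' : Measurable f' ∧ Integrable f' μ) {φ : ℝ → ℝ → ℝ}
    (hφ : Continuous (fun p : ℝ × ℝ => φ p.1 p.2)) {C : ℝ}
    (hC : ∀ a b a' b', |φ a b - φ a' b'| ≤ C * (|a - a'| + |b - b'|)) :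
    Measurable (fun x => φ (f x) (f' x)) ∧ Integrable (fun x => φ (f x) (f' x)) μ := by
  have hm : Measurable (fun x => φ (f x) (f' x)) := hφ.measurable.comp (hf.1.prodMk hf'.1)
  refine ⟨hm, ?_⟩
  refine Integrable.mono' (g := fun x => C * (|f x| + |f' x|) + |φ 0 0|)
    (((hf.2.abs.add hf'.2.abs).const_mul C).add (integrable_const _)) hm.aestronglyMeasurable
    (Eventually.of_forall fun x => ?_)
  have h1 := hC (f x) (f' x) 0 0
  simp only [sub_zero] at h1
  rw [Real.norm_eq_abs]
  have h2 := abs_sub_abs_le_abs_sub (φ (f x) (f' x)) (φ 0 0)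
  linarith

lemma SAP.op (hY : Y ≤ mX) (hT : Act μ T) {f f' : X → ℝ} (hf : SAP μ T Y Λ f)
    (hf' : SAP μ T Y Λ f') {φ : ℝ → ℝ → ℝ}
    (hφ : Continuous (fun p : ℝ × ℝ => φ p.1 p.2)) {C : ℝ} (hC0 : 0 < C)
    (hC : ∀ a b a' b', |φ a b - φ a' b'| ≤ C * (|a - a'| + |b - b'|)) :
    SAP μ T Y Λ (fun x => φ (f x) (f' x)) := by
  have hmi := lip_mi (μ := μ) ⟨hf.1, hf.2.1⟩ ⟨hf'.1, hf'.2.1⟩ hφ hC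
  refine ⟨hmi.1, hmi.2, fun ε hε η hη => ?_⟩
  obtain ⟨W, hW, hWη, K, _, g, hg, hκ⟩ := hf.2.2 (ε/(2*C)) (by positivity) (η/2) (by positivity)
  obtain ⟨W', hW', hWη', K', _, g', hg', hκ'⟩ := hf'.2.2 (ε/(2*C)) (by positivity) (η/2)
    (by positivity)
  refine ⟨W ∩ W', @MeasurableSet.inter _ Y _ _ hW hW', ?_, K × K', inferInstance,
    fun k x => φ (g k.1 x) (g' k.2 x), fun k => lip_mi (hg _) (hg' _) hφ hC, fun l hl => ?_⟩
  · rw [Set.compl_inter]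
    linarith [measureReal_union_le (μ := μ) Wᶜ W'ᶜ]
  · obtain ⟨κ, hκm, hκi⟩ := hκ l hl
    obtain ⟨κ', hκm', hκi'⟩ := hκ' l hl
    refine ⟨fun x => (κ x, κ' x), hκm.prod hκm', fun B hB hBW => ?_⟩
    have h1 := hκi B hB (hBW.trans Set.inter_subset_left)
    have h2 := hκi' B hB (hBW.trans Set.inter_subset_right)
    have hfT : Measurable (fun x => f (T l x)) ∧ Integrable (fun x => f (T l x)) μ :=
      ⟨hf.1.comp (hT.meas l), (hT.mp l).integrable_comp_of_integrable hf.2.1⟩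
    have hfT' : Measurable (fun x => f' (T l x)) ∧ Integrable (fun x => f' (T l x)) μ :=
      ⟨hf'.1.comp (hT.meas l), (hT.mp l).integrable_comp_of_integrable hf'.2.1⟩
    have hs := select_mi (μ := μ) hY hg hκm
    have hs' := select_mi (μ := μ) hY hg' hκm'
    have i1 : Integrable (fun x => |f (T l x) - g (κ x) x|) μ := (hfT.2.sub hs.2).abs
    have i2 : Integrable (fun x => |f' (T l x) - g' (κ' x) x|) μ := (hfT'.2.sub hs'.2).abs
    calc ∫ x in B, |φ (f (T l x)) (f' (T l x)) - φ (g (κ x) x) (g' (κ' x) x)| ∂μ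
        ≤ ∫ x in B, C * (|f (T l x) - g (κ x) x| + |f' (T l x) - g' (κ' x) x|) ∂μ := by
          refine integral_mono (((lip_mi hfT hfT' hφ hC).2.sub (lip_mi hs hs' hφ hC).2).abs.integrableOn)
            ((i1.add i2).const_mul C).integrableOn fun x => hC _ _ _ _
      _ = C * (∫ x in B, |f (T l x) - g (κ x) x| ∂μ + ∫ x in B, |f' (T l x) - g' (κ' x) x| ∂μ) := by
          rw [integral_const_mul, integral_add i1.integrableOn i2.integrableOn]
      _ ≤ C * (ε/(2*C) * μ.real B + ε/(2*C) * μ.real B) := by gcongr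
      _ = ε * μ.real B := by field_simp; ring

lemma SAP.const (c : ℝ) : SAP μ T Y Λ (fun _ => c) := by
  refine ⟨measurable_const, integrable_const c, fun ε hε η hη => ⟨Set.univ, @MeasurableSet.univ _ Y,
    by simpa using hη.le, Unit, inferInstance, fun _ _ => c,
    fun _ => ⟨measurable_const, integrable_const c⟩, fun l _ => ⟨fun _ => (), ColM.const _,
      fun B _ _ => ?_⟩⟩⟩
  simp only [sub_self, abs_zero, integral_zero]
  positivity

lemma SAP.ind (hY : Y ≤ mX) (hi : InvA T Y) {S : Set X} (hS : MeasurableSet[Y] S) :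
    SAP μ T Y Λ (S.indicator fun _ => (1:ℝ)) := by
  refine ⟨((BM.ind hS).mono hY).1, ((BM.ind hS).mono hY).integrable, fun ε hε η hη =>
    ⟨Set.univ, @MeasurableSet.univ _ Y,
    by simpa using hη.le, Bool, inferInstance, fun b _ => if b then 1 else 0,
    fun _ => ⟨measurable_const, integrable_const _⟩, fun l _ => ⟨fun x => decide (T l x ∈ S), ?_,
      fun B _ _ => ?_⟩⟩⟩
  · intro b
    cases b
    · have : (fun x => decide (T l x ∈ S)) ⁻¹' {false} = T l ⁻¹' Sᶜ := by ext x; simp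
      rw [this]
      exact hi l (@MeasurableSet.compl _ _ Y hS)
    · have : (fun x => decide (T l x ∈ S)) ⁻¹' {true} = T l ⁻¹' S := by ext x; simp
      rw [this]
      exact hi l hS
  · have : ∀ x, |S.indicator (fun _ => (1:ℝ)) (T l x) - if (decide (T l x ∈ S)) = true then 1 else 0|
      = 0 := by
      intro x
      by_cases h : T l x ∈ S <;> simp [h]
    simp only [this, integral_zero]
    positivity

lemma SAP.comp (hY : Y ≤ mX) (hT : Act μ T) (hi : InvA T Y) (hf : SAP μ T Y Λ f) (a : Γ) :
    SAP μ T Y Λ (fun x => f (T a x)) := by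
  refine ⟨hf.1.comp (hT.meas a), (hT.mp a).integrable_comp_of_integrable hf.2.1,
    fun ε hε η hη => ?_⟩
  obtain ⟨W, hW, hWη, K, _, g, hg, hκ⟩ := hf.2.2 ε hε η hη
  refine ⟨T a ⁻¹' W, hi a hW, ?_, K, inferInstance, fun k x => g k (T a x), fun k =>
    ⟨(hg k).1.comp (hT.meas a), (hT.mp a).integrable_comp_of_integrable (hg k).2⟩, fun l hl => ?_⟩
  · rw [← Set.preimage_compl, (hT.mp a).measureReal_preimage (hY _ hW).compl.nullMeasurableSet]
    exact hWη
  · obtain ⟨κ, hκm, hκi⟩ := hκ l hl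
    refine ⟨fun x => κ (T a x), hκm.comp (hi a), fun B hB hBW => ?_⟩
    have hB' : MeasurableSet[Y] (T (-a) ⁻¹' B) := hi (-a) hB
    have e : B = T a ⁻¹' (T (-a) ⁻¹' B) := by ext x; simp [hT.neg_cancel]
    have h1 := hκi (T (-a) ⁻¹' B) hB' (fun x hx => by
      have := hBW hx
      simpa [hT.cancel_neg] using this)
    rw [e, (hT.mp a).measureReal_preimage (hY _ hB').nullMeasurableSet]
    rw [← (hT.mp a).setIntegral_preimage_emb (hT.emb a)] at h1
    refine le_trans (le_of_eq ?_) h1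
    refine integral_congr_ae (Eventually.of_forall fun x => ?_)
    simp only
    rw [← hT.add, ← hT.add, add_comm a l]

lemma SAP.anti {Λ' : AddSubgroup Γ} (h : Λ' ≤ Λ) (hf : SAP μ T Y Λ f) : SAP μ T Y Λ' f := by
  refine ⟨hf.1, hf.2.1, fun ε hε η hη => ?_⟩
  obtain ⟨W, hW, hWη, K, _, g, hg, hκ⟩ := hf.2.2 ε hε η hη
  exact ⟨W, hW, hWη, K, inferInstance, g, hg, fun l hl => hκ l (h hl)⟩

lemma SAP.bot (hT : Act μ T) (hf : Measurable f ∧ Integrable f μ) : SAP μ T Y ⊥ f := by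
  refine ⟨hf.1, hf.2, fun ε hε η hη => ⟨Set.univ, @MeasurableSet.univ _ Y,
    by simpa using hη.le, Unit, inferInstance, fun _ => f,
    fun _ => hf, fun l hl => ⟨fun _ => (), ColM.const _,
      fun B _ _ => ?_⟩⟩⟩
  rw [AddSubgroup.mem_bot] at hl
  subst hl
  simp only [hT.zero, sub_self, abs_zero, integral_zero]
  positivity

/-- approximability by SAP functions -/
def SApp {X Γ : Type} {mX : MeasurableSpace X} [AddCommGroup Γ] (μ : Measure X)
    (T : Γ → X → X) (Y : MeasurableSpace X) (Λ : AddSubgroup Γ) (f : X → ℝ) : Prop :=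
  ∀ ε : ℝ, 0 < ε → ∃ h, SAP μ T Y Λ h ∧ ∫ x, |f x - h x| ∂μ ≤ ε

lemma SApp.op (hY : Y ≤ mX) (hT : Act μ T) {f f' : X → ℝ} (hf : SApp μ T Y Λ f)
    (hf' : SApp μ T Y Λ f') (hm : Measurable f ∧ Integrable f μ) (hm' : Measurable f' ∧ Integrable f' μ)
    {φ : ℝ → ℝ → ℝ}
    (hφ : Continuous (fun p : ℝ × ℝ => φ p.1 p.2)) {C : ℝ} (hC0 : 0 < C)
    (hC : ∀ a b a' b', |φ a b - φ a' b'| ≤ C * (|a - a'| + |b - b'|)) :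
    SApp μ T Y Λ (fun x => φ (f x) (f' x)) := by
  intro ε hε
  obtain ⟨h, hs, hi⟩ := hf (ε/(2*C)) (by positivity)
  obtain ⟨h', hs', hi'⟩ := hf' (ε/(2*C)) (by positivity)
  refine ⟨_, hs.op hY hT hs' hφ hC0 hC, ?_⟩
  have i1 : Integrable (fun x => |f x - h x|) μ := (hm.2.sub hs.2.1).abs
  have i2 : Integrable (fun x => |f' x - h' x|) μ := (hm'.2.sub hs'.2.1).abs
  calc ∫ x, |φ (f x) (f' x) - φ (h x) (h' x)| ∂μ
      ≤ ∫ x, C * (|f x - h x| + |f' x - h' x|) ∂μ := by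
        refine integral_mono (((lip_mi hm hm' hφ hC).2.sub
          (lip_mi ⟨hs.1, hs.2.1⟩ ⟨hs'.1, hs'.2.1⟩ hφ hC).2).abs)
          ((i1.add i2).const_mul C) fun x => hC _ _ _ _
    _ = C * (∫ x, |f x - h x| ∂μ + ∫ x, |f' x - h' x| ∂μ) := by
        rw [integral_const_mul, integral_add i1 i2]
    _ ≤ C * (ε/(2*C) + ε/(2*C)) := by gcongr
    _ = ε := by field_simp; ring

lemma SApp.closed (hf : Integrable f μ)
    (h : ∀ ε : ℝ, 0 < ε → ∃ f', SApp μ T Y Λ f' ∧ Integrable f' μ ∧ ∫ x, |f x - f' x| ∂μ ≤ ε) :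
    SApp μ T Y Λ f := by
  intro ε hε
  obtain ⟨f', h1, h2, h3⟩ := h (ε/2) (by positivity)
  obtain ⟨k, hk, hk'⟩ := h1 (ε/2) (by positivity)
  refine ⟨k, hk, ?_⟩
  calc ∫ x, |f x - k x| ∂μ ≤ ∫ x, (|f x - f' x| + |f' x - k x|) ∂μ :=
        integral_mono (hf.sub hk.2.1).abs ((hf.sub h2).abs.add (h2.sub hk.2.1).abs)
          fun x => abs_sub_le _ _ _
    _ = _ := integral_add (hf.sub h2).abs (h2.sub hk.2.1).abs
    _ ≤ ε := by linarith

lemma abs_max_lip (a b a' b' : ℝ) : |max a b - max a' b'| ≤ 1 * (|a - a'| + |b - b'|) := by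
  rw [one_mul]
  exact (abs_max_sub_max_le_max a b a' b').trans (max_le_add_of_nonneg (abs_nonneg _) (abs_nonneg _))

lemma ind_mi {S : Set X} (hS : MeasurableSet S) : Measurable (S.indicator fun _ => (1:ℝ)) ∧
    Integrable (S.indicator fun _ => (1:ℝ)) μ := ⟨(BM.ind hS).1, (BM.ind hS).integrable⟩

/-- The σ-algebra of almost periodic sets along `Λ` relative to `Y`. -/
def ZA {X Γ : Type} {Y : MeasurableSpace X} [mX : MeasurableSpace X] [AddCommGroup Γ] {μ : Measure X}
    [IsProbabilityMeasure μ] {T : Γ → X → X} (hT : Act μ T) (hY : Y ≤ mX)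
    (Λ : AddSubgroup Γ) : MeasurableSpace X where
  MeasurableSet' S := MeasurableSet[mX] S ∧ SApp μ T Y Λ (S.indicator fun _ => (1:ℝ))
  measurableSet_empty := ⟨@MeasurableSet.empty _ mX, fun ε hε => ⟨fun _ => 0, SAP.const 0, by
    simpa using hε.le⟩⟩
  measurableSet_compl := by
    rintro S ⟨hS, h⟩
    refine ⟨hS.compl, ?_⟩
    have := h.op hY hT h (ind_mi hS) (ind_mi hS) (φ := fun a _ => 1 - a) (by fun_prop) (C := 1)
      one_pos (fun a b a' b' => by
        rw [show (1 - a) - (1 - a') = -(a - a') by ring, abs_neg]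
        linarith [abs_nonneg (b - b')])
    convert this using 1
    funext x
    by_cases hx : x ∈ S <;> simp [hx]
  measurableSet_iUnion := by
    intro F hF
    have hm : MeasurableSet[mX] (⋃ i, F i) := MeasurableSet.iUnion fun i => (hF i).1
    refine ⟨hm, ?_⟩
    have hfin : ∀ n, MeasurableSet[mX] (⋃ i ∈ Finset.range n, F i) ∧
        SApp μ T Y Λ ((⋃ i ∈ Finset.range n, F i).indicator fun _ => (1:ℝ)) := by
      intro n
      induction n with
      | zero => exact ⟨by simp, fun ε hε => ⟨fun _ => 0, SAP.const 0, by
          simpa using hε.le⟩⟩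
      | succ n ih =>
        have e : (⋃ i ∈ Finset.range (n+1), F i) = F n ∪ ⋃ i ∈ Finset.range n, F i := by
          rw [Finset.range_add_one, Finset.set_biUnion_insert]
        rw [e]
        refine ⟨(hF n).1.union ih.1, ?_⟩
        have := (hF n).2.op hY hT ih.2 (ind_mi (hF n).1) (ind_mi ih.1) (φ := fun a b => max a b)
          (by fun_prop) (C := 1) one_pos abs_max_lip
        convert this using 1
        funext x
        by_cases h1 : x ∈ F n <;> by_cases h2 : x ∈ ⋃ i ∈ Finset.range n, F i
        · rw [Set.indicator_of_mem (Set.mem_union_left _ h1), Set.indicator_of_mem h1, Set.indicator_of_mem h2]; simp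
        · rw [Set.indicator_of_mem (Set.mem_union_left _ h1), Set.indicator_of_mem h1, Set.indicator_of_notMem h2]
          simp
        · rw [Set.indicator_of_mem (Set.mem_union_right _ h2), Set.indicator_of_notMem h1, Set.indicator_of_mem h2]
          simp
        · rw [Set.indicator_of_notMem (by simp only [Set.mem_union]; tauto),
            Set.indicator_of_notMem h1, Set.indicator_of_notMem h2]
          simp
    refine SApp.closed (ind_mi hm).2 fun ε hε => ?_
    have hlim : Tendsto (fun n => ∫ x, |(⋃ i, F i).indicator (fun _ => (1:ℝ)) x
        - (⋃ i ∈ Finset.range n, F i).indicator (fun _ => (1:ℝ)) x| ∂μ) atTop (𝓝 (∫ _, (0:ℝ) ∂μ)) := by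
      refine tendsto_integral_of_dominated_convergence (fun _ => (1:ℝ))
        (fun n => ((ind_mi (μ := μ) hm).2.sub (ind_mi (hfin n).1).2).abs.aestronglyMeasurable)
        (integrable_const _) (fun n => Eventually.of_forall fun x => ?_)
        (Eventually.of_forall fun x => ?_)
      · by_cases h1 : x ∈ ⋃ i, F i <;> by_cases h2 : x ∈ ⋃ i ∈ Finset.range n, F i <;>
          simp only [Set.indicator_of_mem, Set.indicator_of_notMem, h1, h2, not_false_eq_true] <;>
          norm_num
      · by_cases h1 : x ∈ ⋃ i, F i
        · obtain ⟨i, hi⟩ := Set.mem_iUnion.1 h1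
          refine tendsto_const_nhds.congr' ?_
          filter_upwards [eventually_gt_atTop i] with n hn
          have h2 : x ∈ ⋃ i ∈ Finset.range n, F i := Set.mem_biUnion (by simpa using hn) hi
          simp only [Set.indicator_of_mem h1, Set.indicator_of_mem h2, sub_self, abs_zero]
        · refine tendsto_const_nhds.congr fun n => ?_
          have h2 : x ∉ ⋃ i ∈ Finset.range n, F i := fun h => by
            obtain ⟨i, hi⟩ := Set.mem_iUnion.1 h
            obtain ⟨_, hi⟩ := Set.mem_iUnion.1 hi
            exact h1 (Set.mem_iUnion.2 ⟨i, hi⟩)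
          simp only [Set.indicator_of_notMem h1, Set.indicator_of_notMem h2, sub_self, abs_zero]
    rw [integral_zero] at hlim
    obtain ⟨n, hn⟩ := (hlim.eventually_le_const hε).exists
    exact ⟨_, (hfin n).2, (ind_mi (hfin n).1).2, hn⟩

lemma ZA_iff (hT : Act μ T) (hY : Y ≤ mX) {S : Set X} : MeasurableSet[ZA hT hY Λ] S ↔
    MeasurableSet[mX] S ∧ SApp μ T Y Λ (S.indicator fun _ => (1:ℝ)) := Iff.rfl

lemma ZA_le (hT : Act μ T) (hY : Y ≤ mX) : ZA hT hY Λ ≤ mX := fun _ h => h.1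

lemma SAP.sapp (hf : SAP μ T Y Λ f) : SApp μ T Y Λ f :=
  fun ε hε => ⟨f, hf, by simpa using hε.le⟩

lemma le_ZA (hT : Act μ T) (hY : Y ≤ mX) (hi : InvA T Y) : Y ≤ ZA hT hY Λ :=
  fun S hS => ⟨hY S hS, (SAP.ind hY hi hS).sapp⟩

lemma ZA_bot (hT : Act μ T) (hY : Y ≤ mX) : mX ≤ ZA hT hY ⊥ :=
  fun S hS => ⟨hS, (SAP.bot hT (ind_mi hS)).sapp⟩

lemma ZA_anti (hT : Act μ T) (hY : Y ≤ mX) {Λ' : AddSubgroup Γ} (h : Λ' ≤ Λ) :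
    ZA hT hY Λ ≤ ZA hT hY Λ' := fun S hS => ⟨hS.1, fun ε hε => by
  obtain ⟨k, hk, hk'⟩ := hS.2 ε hε
  exact ⟨k, hk.anti h, hk'⟩⟩

lemma ZA_inv (hT : Act μ T) (hY : Y ≤ mX) (hi : InvA T Y) : InvA T (ZA hT hY Λ) := by
  intro a S hS
  refine ⟨hT.meas a hS.1, fun ε hε => ?_⟩
  obtain ⟨k, hk, hk'⟩ := hS.2 ε hε
  refine ⟨_, hk.comp hY hT hi a, ?_⟩
  rw [← hT.int a] at hk'
  exact hk'

end ap
end PS5file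

section PS5bfile
open Filter Topology
open scoped Classical symmDiff
open MeasureTheory ProbabilityTheory

section ap2
set_option linter.unusedSectionVars false

/-- discretization of a bounded real -/
lemma disc (C ε : ℝ) (hε : 0 < ε) : ∃ (K : Type) (_ : Fintype K) (val : K → ℝ) (q : ℝ → K),
    (∀ k, MeasurableSet (q ⁻¹' {k})) ∧ ∀ x, |x| ≤ C → |val (q x) - x| ≤ ε := by
  set N : ℤ := ⌈C/ε⌉ + 1 with hN
  set N' : ℤ := max N 0 with hN'
  refine ⟨Finset.Icc (-N') N', inferInstance, fun k => (k:ℤ) * ε,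
    fun x => ⟨max (-N') (min N' ⌊x/ε⌋), ?_⟩, fun k => ?_, fun x hx => ?_⟩
  · rw [Finset.mem_Icc]
    have : 0 ≤ N' := le_max_right _ _
    exact ⟨le_max_left _ _, max_le (by omega) (min_le_left _ _)⟩
  · have : (fun x : ℝ => (⟨max (-N') (min N' ⌊x/ε⌋), by
        rw [Finset.mem_Icc]
        have : 0 ≤ N' := le_max_right _ _
        exact ⟨le_max_left _ _, max_le (by omega) (min_le_left _ _)⟩⟩ : Finset.Icc (-N') N')) ⁻¹' {k}
        = (fun x : ℝ => ⌊x/ε⌋) ⁻¹' {m | max (-N') (min N' m) = k} := by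
      ext x
      simp [Subtype.ext_iff]
    rw [this]
    exact (Int.measurable_floor.comp (measurable_id.div_const ε)) trivial
  · have hC := abs_le.1 hx
    have h1 : ⌊x/ε⌋ ≤ N' := by
      refine le_trans ?_ (le_max_left _ _)
      rw [hN]
      have : ⌊x/ε⌋ ≤ ⌈C/ε⌉ := (Int.floor_le_ceil _).trans (Int.ceil_mono (by gcongr; exact hC.2))
      omega
    have h2 : -N' ≤ ⌊x/ε⌋ := by
      have h3 : N ≤ N' := le_max_left _ _
      have : -⌈C/ε⌉ ≤ ⌊x/ε⌋ := by
        rw [← Int.floor_neg, ← neg_div]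
        exact Int.floor_mono (by gcongr; exact hC.1)
      omega
    simp only
    rw [min_eq_right h1, max_eq_right h2]
    have h3 := Int.floor_le (x/ε)
    have h4 := Int.lt_floor_add_one (x/ε)
    rw [le_div_iff₀ hε] at h3
    rw [div_lt_iff₀ hε] at h4
    rw [abs_le]
    constructor <;> nlinarith

variable {X Γ : Type} {Y Z : MeasurableSpace X} {f g : X → ℝ} [mX : MeasurableSpace X]
  {μ : Measure X} [IsProbabilityMeasure μ] [AddCommGroup Γ] {T : Γ → X → X} {Λ : AddSubgroup Γ}

/-- clipping -/
def clip (C x : ℝ) : ℝ := max (-C) (min C x)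

lemma clip_abs {C : ℝ} (hC : 0 ≤ C) (x : ℝ) : |clip C x| ≤ C := by
  unfold clip
  rw [abs_le]
  exact ⟨le_max_left _ _, max_le (by linarith) (min_le_left _ _)⟩

lemma clip_lip (C x y : ℝ) : |clip C x - clip C y| ≤ |x - y| := by
  unfold clip
  refine (abs_max_sub_max_le_max _ _ _ _).trans ?_
  simp only [sub_self, abs_zero]
  refine max_le (abs_nonneg _) ((abs_min_sub_min_le_max _ _ _ _).trans ?_)
  simp

lemma clip_eq {C x : ℝ} (h : |x| ≤ C) : clip C x = x := by
  have := abs_le.1 h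
  unfold clip
  rw [min_eq_right this.2, max_eq_right this.1]

lemma clip_cont (C : ℝ) : Continuous (clip C) := by unfold clip; fun_prop

lemma clip_le {C x y : ℝ} (h : |x| ≤ C) : |x - clip C y| ≤ |x - y| := by
  simpa [clip_eq h] using clip_lip C x y

lemma SAP.measurable (hT : Act μ T) (hY : Y ≤ mX) (hf : SAP μ T Y Λ f) :
    Measurable[ZA hT hY Λ] f := by
  refine @measurable_of_Ioi _ _ _ _ _ (ZA hT hY Λ) _ _ _ _ fun a => ?_
  have hm : MeasurableSet (f ⁻¹' Set.Ioi a) := hf.1 measurableSet_Ioi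
  refine ⟨hm, SApp.closed (ind_mi hm).2 fun ε hε => ?_⟩
  have hs : ∀ n : ℕ, SAP μ T Y Λ (fun x => clip 1 (max 0 (n * (f x - a)))) := fun n => by
    refine hf.op hY hT hf (φ := fun u _ => clip 1 (max 0 (n * (u - a)))) ?_ (C := n + 1)
      (by positivity) fun u v u' v' => ?_
    · have := clip_cont 1
      fun_prop
    · refine (clip_lip _ _ _).trans ((abs_max_sub_max_le_max _ _ _ _).trans ?_)
      simp only [sub_self, abs_zero]
      refine max_le (by positivity) ?_
      rw [← mul_sub, abs_mul, sub_sub_sub_cancel_right, Nat.abs_cast]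
      nlinarith [abs_nonneg (u - u'), abs_nonneg (v - v'), (Nat.cast_nonneg n : (0:ℝ) ≤ n)]
  have hlim : Tendsto (fun n : ℕ => ∫ x, |(f ⁻¹' Set.Ioi a).indicator (fun _ => (1:ℝ)) x
        - clip 1 (max 0 (n * (f x - a)))| ∂μ) atTop (𝓝 (∫ _, (0:ℝ) ∂μ)) := by
    refine tendsto_integral_of_dominated_convergence (fun _ => (2:ℝ))
      (fun n => ((ind_mi (μ := μ) hm).2.sub (hs n).2.1).abs.aestronglyMeasurable)
      (integrable_const _) (fun n => Eventually.of_forall fun x => ?_)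
      (Eventually.of_forall fun x => ?_)
    · have h1 := clip_abs zero_le_one (max 0 (n * (f x - a)))
      have h2 : |(f ⁻¹' Set.Ioi a).indicator (fun _ => (1:ℝ)) x| ≤ 1 := by
        by_cases h : x ∈ f ⁻¹' Set.Ioi a
        · rw [Set.indicator_of_mem h]; norm_num
        · rw [Set.indicator_of_notMem h]; norm_num
      rw [Real.norm_eq_abs, abs_abs]
      linarith [abs_sub ((f ⁻¹' Set.Ioi a).indicator (fun _ => (1:ℝ)) x)
        (clip 1 (max 0 (n * (f x - a))))]
    · by_cases h : x ∈ f ⁻¹' Set.Ioi a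
      · have h' : 0 < f x - a := sub_pos.2 h
        obtain ⟨N, hN⟩ := exists_nat_gt (1 / (f x - a))
        refine tendsto_const_nhds.congr' ?_
        filter_upwards [eventually_ge_atTop N] with n hn
        rw [Set.indicator_of_mem h]
        have h1 : 1 ≤ (n:ℝ) * (f x - a) := by
          rw [div_lt_iff₀ h'] at hN
          have : (N:ℝ) ≤ n := by exact_mod_cast hn
          nlinarith
        rw [max_eq_right (by linarith), clip, min_eq_left h1]
        norm_num
      · refine tendsto_const_nhds.congr fun n => ?_
        rw [Set.indicator_of_notMem h]
        have h' : f x - a ≤ 0 := sub_nonpos.2 (not_lt.1 h)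
        rw [max_eq_left (mul_nonpos_of_nonneg_of_nonpos (Nat.cast_nonneg n) h'),
          clip_eq (by norm_num)]
        norm_num
  rw [integral_zero] at hlim
  obtain ⟨n, hn⟩ := (hlim.eventually_le_const hε).exists
  exact ⟨_, (hs n).sapp, (hs n).2.1, hn⟩

lemma SApp.lin (hY : Y ≤ mX) (hT : Act μ T) {f f' : X → ℝ} (hf : SApp μ T Y Λ f)
    (hf' : SApp μ T Y Λ f') (hm : Measurable f ∧ Integrable f μ)
    (hm' : Measurable f' ∧ Integrable f' μ) (c : ℝ) : SApp μ T Y Λ (fun x => c * f x + f' x) := by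
  refine hf.op hY hT hf' hm hm' (φ := fun a b => c * a + b) (by fun_prop) (C := |c| + 1)
    (by positivity) fun a b a' b' => ?_
  calc |c * a + b - (c * a' + b')| = |c * (a - a') + (b - b')| := by ring_nf
    _ ≤ |c * (a - a')| + |b - b'| := abs_add_le _ _
    _ = |c| * |a - a'| + |b - b'| := by rw [abs_mul]
    _ ≤ _ := by nlinarith [abs_nonneg (a - a'), abs_nonneg (b - b'), abs_nonneg c]

lemma BM.sapp (hT : Act μ T) (hY : Y ≤ mX) (hf : BM (ZA hT hY Λ) f) : SApp μ T Y Λ f := by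
  have hfm : BM mX f := hf.mono (ZA_le hT hY)
  refine SApp.closed hfm.integrable fun ε hε => ?_
  obtain ⟨C, hC0, hC⟩ := hf.bd
  obtain ⟨K, _, val, q, hq, hval⟩ := disc C ε hε
  have hS : ∀ k, MeasurableSet[ZA hT hY Λ] ((fun x => q (f x)) ⁻¹' {k}) := fun k => hf.1 (hq k)
  have key : ∀ s : Finset K, SApp μ T Y Λ (fun x => ∑ k ∈ s, val k *
      ((fun x => q (f x)) ⁻¹' {k}).indicator (fun _ => (1:ℝ)) x) ∧ BM mX (fun x => ∑ k ∈ s, val k *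
      ((fun x => q (f x)) ⁻¹' {k}).indicator (fun _ => (1:ℝ)) x) := by
    intro s
    induction s using Finset.induction_on with
    | empty =>
      simp only [Finset.sum_empty]
      exact ⟨(SAP.const 0).sapp, BM.const 0⟩
    | insert k s hk ih =>
      simp only [Finset.sum_insert hk]
      exact ⟨(hS k).2.lin hY hT ih.1 (ind_mi (hS k).1) ⟨ih.2.1, ih.2.integrable⟩ _,
        ((BM.const _).mul (BM.ind (hS k).1)).add ih.2⟩
  refine ⟨_, (key Finset.univ).1, (key Finset.univ).2.integrable, ?_⟩
  have : ∀ x, ∑ k, val k * ((fun x => q (f x)) ⁻¹' {k}).indicator (fun _ => (1:ℝ)) x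
      = val (q (f x)) := by
    intro x
    rw [Finset.sum_eq_single (q (f x))]
    · simp
    · intro b _ hb
      rw [Set.indicator_of_notMem (by simpa using hb.symm), mul_zero]
    · simp
  simp only [this]
  calc ∫ x, |f x - val (q (f x))| ∂μ ≤ ∫ _, ε ∂μ := by
        refine integral_mono_of_nonneg (Eventually.of_forall fun x => abs_nonneg _)
          (integrable_const _) (Eventually.of_forall fun x => ?_)
        simp only
        rw [abs_sub_comm]
        exact hval _ (hC x)
    _ = ε := by simp

/-- weakly almost periodic families -/
def WAP {X N : Type} {mX : MeasurableSpace X} (μ : Measure X) (Y Z : MeasurableSpace X) (C : ℝ)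
    (a : N → X → ℝ) : Prop :=
  (∀ n, Measurable[mX] (a n) ∧ ∀ x, |a n x| ≤ C) ∧ ∀ ε : ℝ, 0 < ε →
    ∃ (K : Type) (_ : Fintype K) (g : K → X → ℝ), (∀ k, Measurable[Z] (g k) ∧ ∀ x, |g k x| ≤ C) ∧
      ∀ n, ∃ κ : X → K, ColM Y κ ∧ ∫ x, |a n x - g (κ x) x| ∂μ ≤ ε

lemma WAP.bm {N : Type} {C : ℝ} {a : N → X → ℝ} (h : WAP μ Y Z C a) (n : N) : BM mX (a n) :=
  ⟨(h.1 n).1, C, (h.1 n).2⟩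

lemma WAP.comp {N M : Type} {C : ℝ} {a : N → X → ℝ} (h : WAP μ Y Z C a) (φ : M → N) :
    WAP μ Y Z C (fun m => a (φ m)) := by
  refine ⟨fun m => h.1 _, fun ε hε => ?_⟩
  obtain ⟨K, _, g, hg, hκ⟩ := h.2 ε hε
  exact ⟨K, inferInstance, g, hg, fun m => hκ _⟩

lemma WAP.mono {N : Type} {C : ℝ} {a : N → X → ℝ} {Y' Z' : MeasurableSpace X}
    (h : WAP μ Y Z C a) (hY : Y ≤ Y') (hZ : Z ≤ Z') : WAP μ Y' Z' C a := by
  refine ⟨h.1, fun ε hε => ?_⟩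
  obtain ⟨K, _, g, hg, hκ⟩ := h.2 ε hε
  refine ⟨K, inferInstance, g, fun k => ⟨(hg k).1.mono hZ le_rfl, (hg k).2⟩, fun m => ?_⟩
  obtain ⟨κ, h1, h2⟩ := hκ m
  exact ⟨κ, h1.mono hY, h2⟩

lemma BM.wap (hT : Act μ T) (hY : Y ≤ mX) (hf : BM (ZA hT hY Λ) f) {C : ℝ} (hC0 : 0 < C)
    (hC : ∀ x, |f x| ≤ C) : WAP μ Y mX C (fun (l : Λ) x => f (T l x)) := by
  have hfm : BM mX f := hf.mono (ZA_le hT hY)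
  refine ⟨fun l => ⟨hfm.1.comp (hT.meas _), fun x => hC _⟩, fun ε hε => ?_⟩
  obtain ⟨h, hs, hi⟩ := hf.sapp hT hY (ε/3) (by positivity)
  obtain ⟨W, hW, hWη, K, _, g, hg, hκ⟩ := hs.2.2 (ε/3) (by positivity) (ε/(6*C)) (by positivity)
  refine ⟨K, inferInstance, fun k x => clip C (g k x), fun k =>
    ⟨(clip_cont C).measurable.comp (hg k).1, fun x => clip_abs hC0.le _⟩, fun l => ?_⟩
  obtain ⟨κ, hκ1, hκ2⟩ := hκ l l.2
  refine ⟨κ, hκ1, ?_⟩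
  have hsel := select_mi (μ := μ) hY hg hκ1
  have hfT : Integrable (fun x => f (T l x)) μ := (hfm.comp (hT.meas l)).integrable
  have hhT : Integrable (fun x => h (T l x)) μ := (hT.mp l).integrable_comp_of_integrable hs.2.1
  have hclip : BM mX (fun x => clip C (g (κ x) x)) :=
    ⟨(clip_cont C).measurable.comp hsel.1, C, fun x => clip_abs hC0.le _⟩
  have hWm := hY _ hW
  have i0 : Integrable (fun x => |f (T l x) - clip C (g (κ x) x)|) μ :=
    (hfT.sub hclip.integrable).abs
  rw [← integral_add_compl hWm i0]
  have h1 : ∫ x in W, |f (T l x) - clip C (g (κ x) x)| ∂μ ≤ ε/3 + ε/3 := by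
    calc _ ≤ ∫ x in W, (|f (T l x) - h (T l x)| + |h (T l x) - g (κ x) x|) ∂μ := by
          refine integral_mono i0.integrableOn
            ((hfT.sub hhT).abs.add (hhT.sub hsel.2).abs).integrableOn fun x => ?_
          exact (clip_le (hC _)).trans (abs_sub_le _ _ _)
      _ = ∫ x in W, |f (T l x) - h (T l x)| ∂μ + ∫ x in W, |h (T l x) - g (κ x) x| ∂μ :=
          integral_add (hfT.sub hhT).abs.integrableOn (hhT.sub hsel.2).abs.integrableOn
      _ ≤ ε/3 + ε/3 := by
          refine add_le_add ?_ ?_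
          · refine (setIntegral_le_integral (hfT.sub hhT).abs
              (Eventually.of_forall fun x => abs_nonneg _)).trans ?_
            have := hT.int l (fun x => |f x - h x|)
            exact this.trans_le hi
          · refine (hκ2 W hW le_rfl).trans ?_
            have : μ.real W ≤ 1 := measureReal_le_one
            nlinarith
  have h2 : ∫ x in Wᶜ, |f (T l x) - clip C (g (κ x) x)| ∂μ ≤ ε/3 := by
    calc _ ≤ ∫ x in Wᶜ, (2 * C) ∂μ := by
          refine integral_mono i0.integrableOn (integrable_const _) fun x => ?_
          have := abs_sub (f (T l x)) (clip C (g (κ x) x))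
          have h1 := hC (T l x)
          have h2 := clip_abs hC0.le (g (κ x) x)
          simp only
          linarith
      _ = μ.real Wᶜ * (2 * C) := by simp
      _ ≤ ε/(6*C) * (2 * C) := by gcongr
      _ = ε/3 := by field_simp; ring
  linarith

lemma WAP.mul (hY : Y ≤ mX) (hZ : Z ≤ mX) {N : Type} {C D : ℝ} {a b : N → X → ℝ}
    (hC0 : 0 < C) (hD0 : 0 < D)
    (h : WAP μ Y Z C a) (h' : WAP μ Y Z D b) : WAP μ Y Z (C * D) (fun n x => a n x * b n x) := by
  refine ⟨fun n => ⟨(h.1 n).1.mul (h'.1 n).1, fun x => ?_⟩, fun ε hε => ?_⟩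
  · rw [abs_mul]
    exact mul_le_mul ((h.1 n).2 x) ((h'.1 n).2 x) (abs_nonneg _) hC0.le
  obtain ⟨K, _, g, hg, hκ⟩ := h.2 (ε/(2*D)) (by positivity)
  obtain ⟨K', _, g', hg', hκ'⟩ := h'.2 (ε/(2*C)) (by positivity)
  refine ⟨K × K', inferInstance, fun k x => g k.1 x * g' k.2 x, fun k =>
    ⟨(hg _).1.mul (hg' _).1, fun x => ?_⟩, fun n => ?_⟩
  · rw [abs_mul]
    exact mul_le_mul ((hg _).2 x) ((hg' _).2 x) (abs_nonneg _) hC0.le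
  obtain ⟨κ, h1, h2⟩ := hκ n
  obtain ⟨κ', h1', h2'⟩ := hκ' n
  refine ⟨fun x => (κ x, κ' x), h1.prod h1', ?_⟩
  have hs : BM mX (fun x => g (κ x) x) := BM.select (fun k => BM.mono (Z := Z) ⟨(hg k).1, C, (hg k).2⟩ hZ) (h1.mono hY)
  have hs' : BM mX (fun x => g' (κ' x) x) := BM.select (fun k => BM.mono (Z := Z) ⟨(hg' k).1, D, (hg' k).2⟩ hZ) (h1'.mono hY)
  have ha := h.bm n
  have hb := h'.bm n
  calc ∫ x, |a n x * b n x - g (κ x) x * g' (κ' x) x| ∂μ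
      ≤ ∫ x, (D * |a n x - g (κ x) x| + C * |b n x - g' (κ' x) x|) ∂μ := by
        refine integral_mono ((ha.mul hb).sub (hs.mul hs')).abs.integrable
          (((BM.const D).mul (ha.sub hs).abs).add ((BM.const C).mul (hb.sub hs').abs)).integrable
          fun x => ?_
        simp only
        rw [show a n x * b n x - g (κ x) x * g' (κ' x) x = (a n x - g (κ x) x) * b n x +
          g (κ x) x * (b n x - g' (κ' x) x) by ring]
        refine (abs_add_le _ _).trans ?_
        rw [abs_mul, abs_mul, mul_comm |a n x - g (κ x) x|]
        gcongr
        · exact (h'.1 n).2 x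
        · exact (hg _).2 x
    _ = D * ∫ x, |a n x - g (κ x) x| ∂μ + C * ∫ x, |b n x - g' (κ' x) x| ∂μ := by
        rw [integral_add ((BM.const D).mul (ha.sub hs).abs).integrable
          ((BM.const C).mul (hb.sub hs').abs).integrable, integral_const_mul, integral_const_mul]
    _ ≤ D * (ε/(2*D)) + C * (ε/(2*C)) := by gcongr
    _ = ε := by field_simp; ring

lemma WAP.prod (hY : Y ≤ mX) (hZ : Z ≤ mX) {N J : Type} {a : J → N → X → ℝ} (s : Finset J)
    (h : ∀ j ∈ s, WAP μ Y Z 1 (a j)) : WAP μ Y Z 1 (fun n x => ∏ j ∈ s, a j n x) := by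
  induction s using Finset.induction_on with
  | empty =>
    simp only [Finset.prod_empty]
    refine ⟨fun n => ⟨measurable_const, by simp⟩, fun ε hε => ⟨Unit, inferInstance, fun _ _ => 1,
      fun _ => ⟨measurable_const, by simp⟩, fun n => ⟨fun _ => (), ColM.const _, by simpa using hε.le⟩⟩⟩
  | insert j s hj ih =>
    simp only [Finset.prod_insert hj]
    have := (h j (by simp)).mul hY hZ one_pos one_pos (ih fun i hi => h i (by simp [hi]))
    rwa [one_mul] at this

variable [StandardBorelSpace X]

lemma cE_select (hYZ : Y ≤ Z) (hZ : Z ≤ mX) {K : Type} [Fintype K] {g : K → X → ℝ}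
    (hg : ∀ k, BM mX (g k)) {κ : X → K} (hκ : ColM Y κ) :
    cE μ Z (fun x => g (κ x) x) =ᵐ[μ] fun x => cE μ Z (g (κ x)) x := by
  have h1 : (fun x => g (κ x) x) = fun x => ∑ k, (κ ⁻¹' {k}).indicator (fun _ => (1:ℝ)) x * g k x := by
    rw [select_eq]
    funext x
    refine Finset.sum_congr rfl fun k _ => ?_
    by_cases h : x ∈ κ ⁻¹' {k}
    · rw [Set.indicator_of_mem h, Set.indicator_of_mem h, one_mul]
    · rw [Set.indicator_of_notMem h, Set.indicator_of_notMem h, zero_mul]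
  have h2 : (fun x => cE μ Z (g (κ x)) x) = fun x => ∑ k, (κ ⁻¹' {k}).indicator (fun _ => (1:ℝ)) x *
      cE μ Z (g k) x := by
    rw [select_eq (fun k => cE μ Z (g k))]
    funext x
    refine Finset.sum_congr rfl fun k _ => ?_
    by_cases h : x ∈ κ ⁻¹' {k}
    · rw [Set.indicator_of_mem h, Set.indicator_of_mem h, one_mul]
    · rw [Set.indicator_of_notMem h, Set.indicator_of_notMem h, zero_mul]
  have h3 : ∀ k, BM Z ((κ ⁻¹' {k}).indicator (fun _ => (1:ℝ))) := fun k => BM.ind (hYZ _ (hκ k))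
  rw [h1, h2]
  have h4 : ∀ᵐ x ∂μ, ∀ k, cE μ Z (fun x => (κ ⁻¹' {k}).indicator (fun _ => (1:ℝ)) x * g k x) x
      = (κ ⁻¹' {k}).indicator (fun _ => (1:ℝ)) x * cE μ Z (g k) x :=
    ae_all_iff.2 fun k => cE_mul_left hZ (hg k) (h3 k)
  filter_upwards [h4] with x hx
  rw [cE_sum _ fun k _ => ((h3 k).mono hZ).mul (hg k)]
  exact Finset.sum_congr rfl fun k _ => hx k

lemma WAP.cE (hYZ : Y ≤ Z) (hZ : Z ≤ mX) {N : Type} {C : ℝ} {a : N → X → ℝ}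
    (h : WAP μ Y mX C a) : WAP μ Y Z C (fun n => cE μ Z (a n)) := by
  refine ⟨fun n => ⟨((h.bm n).cE.mono hZ).1, cE_abs_le_of_bd (h.1 n).2⟩, fun ε hε => ?_⟩
  obtain ⟨K, _, g, hg, hκ⟩ := h.2 ε hε
  have hg' : ∀ k, BM mX (g k) := fun k => ⟨(hg k).1, C, (hg k).2⟩
  refine ⟨K, inferInstance, fun k => _root_.cE μ Z (g k), fun k => ⟨(hg' k).cE.1,
    cE_abs_le_of_bd (hg k).2⟩, fun n => ?_⟩
  obtain ⟨κ, h1, h2⟩ := hκ n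
  refine ⟨κ, h1, le_trans ?_ h2⟩
  have hs : BM mX (fun x => g (κ x) x) := BM.select hg' (h1.mono (hYZ.trans hZ))
  have e := int_abs_cE_le (μ := μ) hZ ((h.bm n).sub hs)
  refine le_trans (le_of_eq (integral_congr_ae ?_)) e
  filter_upwards [cE_select (μ := μ) hYZ hZ hg' h1] with x hx
  rw [cE_sub (h.bm n) hs, hx]

lemma WAP.congr {N : Type} {C : ℝ} {a b : N → X → ℝ} (h : WAP μ Y Z C a)
    (hb : ∀ n, Measurable (b n) ∧ ∀ x, |b n x| ≤ C) (hab : ∀ n, a n =ᵐ[μ] b n) : WAP μ Y Z C b := by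
  refine ⟨hb, fun ε hε => ?_⟩
  obtain ⟨K, _, g, hg, hκ⟩ := h.2 ε hε
  refine ⟨K, inferInstance, g, hg, fun n => ?_⟩
  obtain ⟨κ, h1, h2⟩ := hκ n
  refine ⟨κ, h1, le_trans (le_of_eq (integral_congr_ae ?_)) h2⟩
  filter_upwards [hab n] with x hx
  rw [hx]

/-- families along `Λ`, with approximants measurable in `ZA` -/
lemma BM.wapZ (hT : Act μ T) (hY : Y ≤ mX) (hi : InvA T Y) (hf : BM (ZA hT hY Λ) f) {C : ℝ}
    (hC0 : 0 < C) (hC : ∀ x, |f x| ≤ C) : WAP μ Y (ZA hT hY Λ) C (fun (l : Λ) x => f (T l x)) := by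
  have h1 := (hf.wap hT hY hC0 hC).cE (le_ZA (Λ := Λ) hT hY hi) (ZA_le hT hY)
  refine h1.congr (hf.wap hT hY hC0 hC).1 fun l => ?_
  exact cE_self (ZA_le hT hY) (hf.comp (ZA_inv hT hY hi l))

end ap2
end PS5bfile

section PS6file
open Filter Topology
open scoped Classical symmDiff
open MeasureTheory ProbabilityTheory

section toE
variable {Ω : Type} [mΩ : MeasurableSpace Ω] {ν : Measure Ω} [IsProbabilityMeasure ν]

lemma BM.memLp {F : Ω → ℝ} (hF : BM mΩ F) : MemLp F 2 ν := by
  obtain ⟨C, _, hC⟩ := hF.bd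
  exact MemLp.of_bound hF.1.aestronglyMeasurable C (Eventually.of_forall hC)

/-- class of a bounded measurable function in `L²` -/
noncomputable def toE (ν : Measure Ω) (F : Ω → ℝ) : Lp ℝ 2 ν :=
  if h : MemLp F 2 ν then h.toLp F else 0

lemma toE_coe {F : Ω → ℝ} (hF : BM mΩ F) : (toE ν F : Ω → ℝ) =ᵐ[ν] F := by
  unfold toE
  rw [dif_pos hF.memLp]
  exact hF.memLp.coeFn_toLp

lemma inner_toE (H : Lp ℝ 2 ν) {F : Ω → ℝ} (hF : BM mΩ F) :
    inner ℝ H (toE ν F) = ∫ x, H x * F x ∂ν := by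
  rw [L2.inner_def]
  refine integral_congr_ae ?_
  filter_upwards [toE_coe (ν := ν) hF] with x hx
  rw [hx]
  simp [mul_comm]

lemma inner_toE' {F G : Ω → ℝ} (hF : BM mΩ F) (hG : BM mΩ G) :
    inner ℝ (toE ν F) (toE ν G) = ∫ x, F x * G x ∂ν := by
  rw [inner_toE _ hG]
  refine integral_congr_ae ?_
  filter_upwards [toE_coe (ν := ν) hF] with x hx
  rw [hx]

lemma toE_add {F G : Ω → ℝ} (hF : BM mΩ F) (hG : BM mΩ G) :
    toE ν (fun x => F x + G x) = toE ν F + toE ν G := by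
  apply Lp.ext
  filter_upwards [toE_coe (ν := ν) hF, toE_coe (ν := ν) hG, toE_coe (ν := ν) (hF.add hG),
    Lp.coeFn_add (toE ν F) (toE ν G)] with x h1 h2 h3 h4
  rw [h3, h4, Pi.add_apply, h1, h2]

lemma toE_smul {F : Ω → ℝ} (hF : BM mΩ F) (c : ℝ) :
    toE ν (fun x => c * F x) = c • toE ν F := by
  apply Lp.ext
  filter_upwards [toE_coe (ν := ν) hF, toE_coe (ν := ν) ((BM.const c).mul hF),
    Lp.coeFn_smul c (toE ν F)] with x h1 h2 h3
  rw [h2, h3, Pi.smul_apply, h1, smul_eq_mul]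

lemma toE_zero : toE ν (fun _ => (0:ℝ)) = 0 := by
  have := toE_smul (ν := ν) (F := fun _ => (0:ℝ)) (BM.const 0) 0
  simpa using this

lemma toE_sum {κ : Type*} (s : Finset κ) {F : κ → Ω → ℝ} (hF : ∀ k, BM mΩ (F k)) :
    toE ν (fun x => ∑ k ∈ s, F k x) = ∑ k ∈ s, toE ν (F k) := by
  induction s using Finset.induction_on with
  | empty => simpa using toE_zero
  | insert k s hk ih =>
    simp only [Finset.sum_insert hk]
    rw [toE_add (hF k) (BM.sum s fun j _ => hF j), ih]

lemma compMP_toE {S : Ω → Ω} (hS : MeasurePreserving S ν ν) {F : Ω → ℝ} (hF : BM mΩ F) :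
    Lp.compMeasurePreservingₗᵢ ℝ S hS (toE ν F) = toE ν (fun x => F (S x)) := by
  apply Lp.ext
  have h1 := Lp.coeFn_compMeasurePreserving (toE ν F) hS
  filter_upwards [h1, toE_coe (ν := ν) (hF.comp hS.measurable),
    hS.quasiMeasurePreserving.ae (toE_coe (ν := ν) hF)] with x h2 h3 h4
  rw [h3]
  refine Eq.trans h2 ?_
  exact h4

/-- `L¹`-norm is bounded by `L²` norm -/
lemma int_abs_le_norm (H : Lp ℝ 2 ν) : ∫ x, |H x| ∂ν ≤ ‖H‖ := by
  have hm := Lp.memLp H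
  have h1 : ‖H‖^2 = ∫ x, (H x)^2 ∂ν := by
    rw [← real_inner_self_eq_norm_sq, L2.inner_def]
    refine integral_congr_ae (Eventually.of_forall fun x => ?_)
    simp [sq]
  have hi : Integrable (fun x => (H x)^2) ν := hm.integrable_sq
  have hi1 : Integrable (fun x => |H x|) ν := (hm.integrable (by norm_num)).abs
  have h2 : (∫ x, |H x| ∂ν)^2 ≤ ∫ x, (H x)^2 ∂ν := by
    set c := ∫ x, |H x| ∂ν
    have : 0 ≤ ∫ x, (|H x| - c)^2 ∂ν := integral_nonneg fun x => sq_nonneg _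
    have e : ∫ x, (|H x| - c)^2 ∂ν = ∫ x, (H x)^2 ∂ν - 2 * c * c + c^2 := by
      have : (fun x => (|H x| - c)^2) = fun x => ((H x)^2 - 2 * c * |H x|) + c^2 := by
        funext x
        rw [← sq_abs (H x)]
        ring
      have hi2 : Integrable (fun x => (H x)^2 - 2 * c * |H x|) ν := hi.sub (hi1.const_mul _)
      rw [this, integral_add hi2 (integrable_const _),
        integral_sub hi (hi1.const_mul _), integral_const_mul]
      simp
      exact Or.inl rfl
    nlinarith
  rw [← h1] at h2
  exact abs_le_of_sq_le_sq' h2 (norm_nonneg _) |>.2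

end toE

section relprod
set_option linter.unusedSectionVars false
variable {X Γ : Type} {Y Z : MeasurableSpace X} {f g : X → ℝ} [mX : MeasurableSpace X]
  [StandardBorelSpace X]
  {μ : Measure X} [IsProbabilityMeasure μ] [AddCommGroup Γ] {T : Γ → X → X} {Λ : AddSubgroup Γ}

/-- conditional measures as a kernel from the full σ-algebra -/
noncomputable def kY (μ : Measure X) [IsProbabilityMeasure μ] (hY : Y ≤ mX) : Kernel X X :=
  @Kernel.comap X X Y mX X mX (condExpKernel μ Y) id (measurable_id'' hY)

lemma kY_apply (hY : Y ≤ mX) (x : X) : kY μ hY x = condExpKernel μ Y x := by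
  unfold kY
  rw [Kernel.comap_apply]; rfl

instance kY_markov (hY : Y ≤ mX) : IsMarkovKernel (kY μ hY) :=
  ⟨fun x => by rw [kY_apply]; infer_instance⟩

/-- relative product -/
noncomputable def nu (μ : Measure X) [IsProbabilityMeasure μ] (hY : Y ≤ mX) : Measure (X × X) :=
  μ ⊗ₘ kY μ hY

instance nu_prob (hY : Y ≤ mX) : IsProbabilityMeasure (nu μ hY) := by
  unfold nu; infer_instance

lemma nu_int (hY : Y ≤ mX) {F : X × X → ℝ} (hF : BM inferInstance F) :
    ∫ p, F p ∂(nu μ hY) = ∫ x, ∫ y, F (x, y) ∂(kY μ hY x) ∂μ := by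
  unfold nu
  exact Measure.integral_compProd (hF.integrable (μ := μ ⊗ₘ kY μ hY))

lemma cE_eq (hY : Y ≤ mX) (x : X) : cE μ Y f x = ∫ y, f y ∂(kY μ hY x) := by
  rw [kY_apply]; rfl

lemma BM.tens (hf : BM mX f) (hg : BM mX g) :
    BM inferInstance (fun p : X × X => f p.1 * g p.2) :=
  (hf.comp (T := Prod.fst) measurable_fst).mul (hg.comp (T := Prod.snd) measurable_snd)

lemma nu_tens (hY : Y ≤ mX) (hf : BM mX f) (hg : BM mX g) :
    ∫ p, f p.1 * g p.2 ∂(nu μ hY) = ∫ x, f x * cE μ Y g x ∂μ := by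
  rw [nu_int hY (hf.tens hg)]
  refine integral_congr_ae (Eventually.of_forall fun x => ?_)
  simp only [cE_eq hY]
  rw [integral_const_mul]

/-- diagonal action -/
def dT (T : Γ → X → X) (a : Γ) (p : X × X) : X × X := (T a p.1, T a p.2)

lemma dT_meas (hT : Act μ T) (a : Γ) : Measurable (dT T a) :=
  ((hT.meas a).comp measurable_fst).prodMk ((hT.meas a).comp measurable_snd)

lemma nu_rect (hY : Y ≤ mX) {s t : Set X} (hs : MeasurableSet s) (ht : MeasurableSet t) :
    (nu μ hY).real (s ×ˢ t) = ∫ x, s.indicator (fun _ => (1:ℝ)) x *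
      cE μ Y (t.indicator (fun _ => (1:ℝ))) x ∂μ := by
  rw [← nu_tens hY (BM.ind hs) (BM.ind ht), ← integral_indicator_one (hs.prod ht)]
  refine integral_congr_ae (Eventually.of_forall fun p => ?_)
  by_cases h1 : p.1 ∈ s <;> by_cases h2 : p.2 ∈ t <;> simp [Set.indicator, h1, h2]

lemma dT_mp (hT : Act μ T) (hY : Y ≤ mX) (hi : InvA T Y) (a : Γ) :
    MeasurePreserving (dT T a) (nu μ hY) (nu μ hY) := by
  refine ⟨dT_meas hT a, ?_⟩
  have : IsProbabilityMeasure (Measure.map (dT T a) (nu μ hY)) :=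
    Measure.isProbabilityMeasure_map (dT_meas hT a).aemeasurable
  refine Measure.ext_prod fun {s t} hs ht => ?_
  rw [← measureReal_eq_measureReal_iff, map_measureReal_apply (dT_meas hT a) (hs.prod ht)]
  have e : dT T a ⁻¹' (s ×ˢ t) = (T a ⁻¹' s) ×ˢ (T a ⁻¹' t) := rfl
  rw [e, nu_rect hY (hT.meas a hs) (hT.meas a ht), nu_rect hY hs ht]
  rw [← hT.int a (fun x => s.indicator (fun _ => (1:ℝ)) x * _)]
  refine integral_congr_ae ?_
  filter_upwards [hT.cE hY hi (BM.ind ht) a] with x hx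
  rw [← hx]
  rfl

lemma dT_act (hT : Act μ T) (hY : Y ≤ mX) (hi : InvA T Y) : Act (nu μ hY) (dT T) where
  zero p := by simp [dT, hT.zero]
  add a b p := by simp [dT, hT.add]
  mp a := dT_mp hT hY hi a

/-- composition operators -/
noncomputable def Uop (hT : Act μ T) (hY : Y ≤ mX) (hi : InvA T Y) (a : Γ) :
    Lp ℝ 2 (nu μ hY) →ₗᵢ[ℝ] Lp ℝ 2 (nu μ hY) :=
  Lp.compMeasurePreservingₗᵢ ℝ (dT T a) (dT_mp hT hY hi a)

lemma Uop_coe (hT : Act μ T) (hY : Y ≤ mX) (hi : InvA T Y) (a : Γ) (H : Lp ℝ 2 (nu μ hY)) :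
    (Uop hT hY hi a H : X × X → ℝ) =ᵐ[nu μ hY] fun p => H (dT T a p) :=
  Lp.coeFn_compMeasurePreserving H (dT_mp hT hY hi a)

lemma Uop_add (hT : Act μ T) (hY : Y ≤ mX) (hi : InvA T Y) (a b : Γ) (H : Lp ℝ 2 (nu μ hY)) :
    Uop hT hY hi (a + b) H = Uop hT hY hi a (Uop hT hY hi b H) := by
  apply Lp.ext
  filter_upwards [Uop_coe hT hY hi (a+b) H, Uop_coe hT hY hi a (Uop hT hY hi b H),
    (dT_act hT hY hi).ae a (Uop_coe hT hY hi b H)] with x h1 h2 h3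
  rw [h1, h2, h3, add_comm a b, (dT_act hT hY hi).add]

/-- `∫ cE(f g|Y)^2` as an inner product -/
lemma sq_cE_eq (hY : Y ≤ mX) {F : X → ℝ} (hF : BM mX F) :
    ∫ x, (cE μ Y F x)^2 ∂μ = ∫ p, F p.1 * F p.2 ∂(nu μ hY) := by
  rw [nu_tens hY hF hF, ← cE_int_mul' hY hF hF]
  simp only [sq]

end relprod
end PS6file

section PS6bfile
open Filter Topology
open scoped Classical symmDiff
open MeasureTheory ProbabilityTheory

section lemA
set_option linter.unusedSectionVars false
variable {X Γ : Type} {Y Z : MeasurableSpace X} {f g : X → ℝ} [mX : MeasurableSpace X]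
  [StandardBorelSpace X]
  {μ : Measure X} [IsProbabilityMeasure μ] [AddCommGroup Γ] {T : Γ → X → X} {Λ : AddSubgroup Γ}

/-- fibre integral -/
noncomputable def IK (μ : Measure X) [IsProbabilityMeasure μ] (hY : Y ≤ mX) (F : X × X → ℝ) (x : X) :
    ℝ := ∫ y, F (x, y) ∂(kY μ hY x)

lemma BM.slice {F : X × X → ℝ} (hF : BM inferInstance F) (x : X) : BM mX (fun y => F (x, y)) :=
  hF.comp (measurable_const.prodMk measurable_id)

lemma BM.IK (hY : Y ≤ mX) {F : X × X → ℝ} (hF : BM inferInstance F) : BM mX (IK μ hY F) := by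
  obtain ⟨C, _, hC⟩ := hF.bd
  refine ⟨(hF.1.stronglyMeasurable.integral_kernel_prod_right' (κ := kY μ hY)).measurable, C,
    fun x => ?_⟩
  have := norm_integral_le_of_norm_le_const (μ := kY μ hY x) (f := fun y => F (x, y)) (C := C)
    (Eventually.of_forall fun y => hC _)
  simpa [_root_.IK] using this

lemma IK_mul (hY : Y ≤ mX) {F : X × X → ℝ} (hF : BM inferInstance F) (hf : BM mX f) :
    ∫ x, f x * IK μ hY F x ∂μ = ∫ p, f p.1 * F p ∂(nu μ hY) := by
  rw [nu_int hY ((hf.comp measurable_fst).mul hF)]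
  refine integral_congr_ae (Eventually.of_forall fun x => ?_)
  simp only [IK]
  rw [integral_const_mul]

lemma IK_int (hY : Y ≤ mX) {F : X × X → ℝ} (hF : BM inferInstance F) :
    ∫ x, IK μ hY F x ∂μ = ∫ p, F p ∂(nu μ hY) := (nu_int hY hF).symm

lemma ae_eq_test (hf : BM mX f) (hg : BM mX g)
    (h : ∀ φ : X → ℝ, BM mX φ → ∫ x, φ x * f x ∂μ = ∫ x, φ x * g x ∂μ) : f =ᵐ[μ] g := by
  refine Integrable.ae_eq_of_forall_setIntegral_eq _ _ hf.integrable hg.integrable fun A hA _ => ?_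
  have := h _ (BM.ind hA)
  rw [← integral_indicator hA, ← integral_indicator hA]
  have e : ∀ f : X → ℝ, (fun x => A.indicator (fun _ => (1:ℝ)) x * f x) = A.indicator f := by
    intro f; funext x
    by_cases hx : x ∈ A <;> simp [hx]
  rwa [e, e] at this

lemma IK_congr (hY : Y ≤ mX) {F G : X × X → ℝ} (hF : BM inferInstance F) (hG : BM inferInstance G)
    (h : F =ᵐ[nu μ hY] G) : IK μ hY F =ᵐ[μ] IK μ hY G := by
  refine ae_eq_test (hF.IK hY) (hG.IK hY) fun φ hφ => ?_
  rw [IK_mul hY hF hφ, IK_mul hY hG hφ]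
  refine integral_congr_ae ?_
  filter_upwards [h] with p hp
  rw [hp]

lemma IK_comp (hT : Act μ T) (hY : Y ≤ mX) (hi : InvA T Y) {F : X × X → ℝ}
    (hF : BM inferInstance F) (a : Γ) :
    (fun x => IK μ hY F (T a x)) =ᵐ[μ] IK μ hY (fun p => F (dT T a p)) := by
  have hF' : BM inferInstance (fun p => F (dT T a p)) := hF.comp (dT_meas hT a)
  refine ae_eq_test ((hF.IK hY).comp (hT.meas a)) (hF'.IK hY) fun φ hφ => ?_
  rw [IK_mul hY hF' hφ]
  have h1 := IK_mul (μ := μ) hY hF (hφ.comp (hT.meas (-a)))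
  rw [← hT.int a, ← (dT_act hT hY hi).int a] at h1
  simpa [dT, hT.neg_cancel] using h1

/-- The kernel argument: `x ↦ ∫ G(x,y) f(y) dμ_x(y)` is almost periodic. -/
lemma SAP_kernel (hT : Act μ T) (hY : Y ≤ mX) (hi : InvA T Y) (hf : BM mX f) {G : X × X → ℝ}
    (hG : BM inferInstance G) (hinv : ∀ l ∈ Λ, (fun p => G (dT T l p)) =ᵐ[nu μ hY] G)
    (happ : ∀ δ : ℝ, 0 < δ → ∃ (ι : Type) (_ : Fintype ι) (w : ι → ℝ) (u : ι → Γ),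
      (∀ i, 0 ≤ w i) ∧ ∑ i, w i = 1 ∧
      ∫ p, |G p - ∑ i, w i * (f (T (u i) p.1) * f (T (u i) p.2))| ∂(nu μ hY) ≤ δ) :
    SAP μ T Y Λ (IK μ hY fun p => G p * f p.2) := by
  have hGf : BM inferInstance (fun p : X × X => G p * f p.2) := hG.mul (hf.comp measurable_snd)
  refine ⟨(hGf.IK hY).1, (hGf.IK hY).integrable, fun ε hε η hη => ?_⟩
  obtain ⟨C, hC0, hC⟩ := hf.bd
  obtain ⟨ι, _, w, u, hw, hsum, hd⟩ := happ (ε/(2*C) * η) (by positivity)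
  obtain ⟨K, _, val, q, hq, hval⟩ := disc (C * C) (ε/(2*C)) (by positivity)
  have hfT : ∀ a, BM mX (fun x => f (T a x)) := fun a => hf.comp (hT.meas a)
  set H' : X × X → ℝ := fun p => ∑ i, w i * (f (T (u i) p.1) * f (T (u i) p.2)) with hH'
  have hH'b : BM inferInstance H' := BM.sum _ fun i _ => (BM.const _).mul ((hfT (u i)).tens (hfT (u i)))
  have hq1 : BM inferInstance (fun p => |G p - H' p|) := (hG.sub hH'b).abs
  set q1 := IK μ hY (fun p => |G p - H' p|) with hq1d
  have hq1b : BM mX q1 := hq1.IK hY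
  have hq1E : BM Y (cE μ Y q1) := hq1b.cE
  refine ⟨{x | cE μ Y q1 x ≤ ε/(2*C)}, hq1E.1 measurableSet_Iic, ?_, ι → K, inferInstance,
    fun k x => ∑ i, w i * (f (T (u i) x) * val (k i)), fun k => ?_, fun l hl => ?_⟩
  · have h0 : ∀ x, 0 ≤ cE μ Y q1 x := cE_nonneg fun x => integral_nonneg fun y => abs_nonneg _
    have h1 := mul_meas_ge_le_integral_of_nonneg (μ := μ) (Eventually.of_forall h0)
      (hq1E.mono hY).integrable (ε/(2*C))
    rw [cE_int hY hq1b, IK_int hY hq1] at h1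
    have h2 : μ.real {x | cE μ Y q1 x ≤ ε/(2*C)}ᶜ ≤ μ.real {x | ε/(2*C) ≤ cE μ Y q1 x} :=
      measureReal_mono fun x hx => by
        simp only [Set.mem_compl_iff, Set.mem_ofPred_eq, not_le] at hx
        exact hx.le
    have h3 : 0 < ε/(2*C) := by positivity
    have h4 : ε/(2*C) * μ.real {x | ε/(2*C) ≤ cE μ Y q1 x} ≤ ε/(2*C) * η := h1.trans hd
    exact h2.trans (le_of_mul_le_mul_left h4 h3)
  · have : BM mX (fun x => ∑ i, w i * (f (T (u i) x) * val (k i))) :=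
      BM.sum _ fun i _ => (BM.const _).mul ((hfT (u i)).mul (BM.const _))
    exact ⟨this.1, this.integrable⟩
  · set c : ι → X → ℝ := fun i => cE μ Y (fun y => f (T (u i) y) * f (T l y)) with hc
    have hcb : ∀ i, BM Y (c i) := fun i => ((hfT (u i)).mul (hfT l)).cE
    have hcC : ∀ i x, |c i x| ≤ C * C := fun i x => cE_abs_le_of_bd (fun y => by
      rw [abs_mul]
      exact mul_le_mul (hC _) (hC _) (abs_nonneg _) hC0.le) x
    have hκ : ColM Y (fun x i => q (c i x)) := ColM.pi fun i k => (hcb i).1 (hq k)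
    refine ⟨fun x i => q (c i x), hκ, fun B hB hBW => ?_⟩
    have hgs : BM mX (fun x => ∑ i, w i * (f (T (u i) x) * val (q (c i x)))) := by
      refine BM.select (F := fun (k : ι → K) x => ∑ i, w i * (f (T (u i) x) * val (k i)))
        (fun k => BM.sum _ fun i _ => (BM.const _).mul ((hfT (u i)).mul (BM.const _))) (hκ.mono hY)
    -- the shifted function
    have e1 : (fun x => IK μ hY (fun p => G p * f p.2) (T l x)) =ᵐ[μ]
        IK μ hY (fun p => G p * f (T l p.2)) := by
      refine (IK_comp hT hY hi hGf l).trans (IK_congr hY (hGf.comp (dT_meas hT l))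
        (hG.mul ((hfT l).comp measurable_snd)) ?_)
      filter_upwards [hinv l hl] with p hp
      rw [hp]; rfl
    have e2 : ∀ x, |IK μ hY (fun p => G p * f (T l p.2)) x
        - ∑ i, w i * (f (T (u i) x) * val (q (c i x)))| ≤ C * q1 x + ε/2 := by
      intro x
      have hs1 : BM mX (fun y => G (x, y) * f (T l y)) := (hG.slice x).mul (hfT l)
      have hs2 : BM mX (fun y => H' (x, y) * f (T l y)) := (hH'b.slice x).mul (hfT l)
      have e3 : IK μ hY (fun p => H' p * f (T l p.2)) x = ∑ i, w i * (f (T (u i) x) * c i x) := by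
        have : (fun y => H' (x, y) * f (T l y)) = fun y => ∑ i, (w i * f (T (u i) x)) *
            (f (T (u i) y) * f (T l y)) := by
          funext y
          simp only [hH']
          rw [Finset.sum_mul]
          exact Finset.sum_congr rfl fun i _ => by ring
        have e : IK μ hY (fun p => H' p * f (T l p.2)) x =
          ∫ y, H' (x, y) * f (T l y) ∂(kY μ hY x) := rfl
        rw [e, this, integral_finsetSum _ fun i _ =>
          ((BM.const _).mul ((hfT (u i)).mul (hfT l))).integrable]
        refine Finset.sum_congr rfl fun i _ => ?_
        rw [integral_const_mul, ← cE_eq hY, mul_assoc]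
      have e4 : |IK μ hY (fun p => G p * f (T l p.2)) x - IK μ hY (fun p => H' p * f (T l p.2)) x|
          ≤ C * q1 x := by
        have e : IK μ hY (fun p => G p * f (T l p.2)) x - IK μ hY (fun p => H' p * f (T l p.2)) x
          = ∫ y, (G (x, y) * f (T l y) - H' (x, y) * f (T l y)) ∂(kY μ hY x) :=
          (integral_sub hs1.integrable hs2.integrable).symm
        rw [e]
        refine abs_integral_le_integral_abs.trans ?_
        have e' : C * q1 x = ∫ y, C * |G (x, y) - H' (x, y)| ∂(kY μ hY x) := by
          rw [integral_const_mul]; rfl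
        rw [e']
        refine integral_mono (hs1.sub hs2).abs.integrable
          ((BM.const C).mul (hq1.slice x)).integrable fun y => ?_
        simp only
        rw [← sub_mul, abs_mul, mul_comm]
        exact mul_le_mul_of_nonneg_right (hC _) (abs_nonneg _)
      have e5 : |∑ i, w i * (f (T (u i) x) * c i x) - ∑ i, w i * (f (T (u i) x) * val (q (c i x)))|
          ≤ ε/2 := by
        rw [← Finset.sum_sub_distrib]
        calc |∑ i, (w i * (f (T (u i) x) * c i x) - w i * (f (T (u i) x) * val (q (c i x))))|
            ≤ ∑ i, |w i * (f (T (u i) x) * c i x) - w i * (f (T (u i) x) * val (q (c i x)))| :=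
              Finset.abs_sum_le_sum_abs _ _
          _ ≤ ∑ i, w i * (ε/2) := by
              refine Finset.sum_le_sum fun i _ => ?_
              rw [← mul_sub, ← mul_sub, abs_mul, abs_mul, abs_of_nonneg (hw i)]
              have h1 := hval _ (hcC i x)
              rw [abs_sub_comm] at h1
              refine mul_le_mul_of_nonneg_left ?_ (hw i)
              calc _ ≤ C * (ε/(2*C)) := mul_le_mul (hC _) h1 (abs_nonneg _) hC0.le
                _ = ε/2 := by field_simp
          _ = ε/2 := by rw [← Finset.sum_mul, hsum, one_mul]
      rw [e3] at e4
      have := abs_sub_le (IK μ hY (fun p => G p * f (T l p.2)) x)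
        (∑ i, w i * (f (T (u i) x) * c i x)) (∑ i, w i * (f (T (u i) x) * val (q (c i x))))
      linarith
    calc ∫ x in B, |IK μ hY (fun p => G p * f p.2) (T l x)
          - ∑ i, w i * (f (T (u i) x) * val (q (c i x)))| ∂μ
        = ∫ x in B, |IK μ hY (fun p => G p * f (T l p.2)) x
          - ∑ i, w i * (f (T (u i) x) * val (q (c i x)))| ∂μ := by
          refine setIntegral_congr_ae (hY _ hB) ?_
          filter_upwards [e1] with x hx _
          rw [hx]
      _ ≤ ∫ x in B, (C * q1 x + ε/2) ∂μ :=
          integral_mono (((hG.mul ((hfT l).comp measurable_snd)).IK hY).sub hgs).abs.integrable.integrableOn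
            (((BM.const C).mul hq1b).add (BM.const _)).integrable.integrableOn e2
      _ = C * ∫ x in B, cE μ Y q1 x ∂μ + ε/2 * μ.real B := by
          rw [integral_add ((BM.const C).mul hq1b).integrable.integrableOn
            (integrable_const _), integral_const_mul, cE_setInt hY hq1b hB]
          simp [mul_comm]
      _ ≤ C * ∫ x in B, ε/(2*C) ∂μ + ε/2 * μ.real B := by
          refine add_le_add (mul_le_mul_of_nonneg_left ?_ hC0.le) le_rfl
          exact setIntegral_mono_on (hq1E.mono hY).integrable.integrableOn
            (integrable_const _).integrableOn (hY _ hB) fun x hx => hBW hx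
      _ = ε * μ.real B := by
          simp
          field_simp
          ring

lemma lemA {V : Type} [AddCommGroup V] (hT : Act μ T) (hY : Y ≤ mX) (hi : InvA T Y) (L : V →+ Γ)
    (hf : BM mX f) (h0 : cE μ (ZA hT hY L.range) f =ᵐ[μ] fun _ => 0) (hg : BM mX g) :
    NullS (fun v => ∫ x, (cE μ Y (fun x => g x * f (T (L v) x)) x)^2 ∂μ) := by
  have hfT : ∀ a, BM mX (fun x => f (T a x)) := fun a => hf.comp (hT.meas a)
  obtain ⟨C, hC0, hC⟩ := hf.bd
  set h := toE (nu μ hY) (fun p => f p.1 * f p.2) with hh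
  have hU : ∀ a, Uop hT hY hi a h = toE (nu μ hY) (fun p => f (T a p.1) * f (T a p.2)) :=
    fun a => compMP_toE (dT_mp hT hY hi a) (hf.tens hf)
  obtain ⟨H, hHinv, hHh, happ⟩ := mean_erg (fun v => Uop hT hY hi (L v))
    (fun u v x => by simp only [map_add]; exact Uop_add hT hY hi _ _ x) h
  have hHm : Measurable (H : X × X → ℝ) := (Lp.stronglyMeasurable H).measurable
  set G : X × X → ℝ := fun p => clip (C * C) (H p) with hG
  have hGb : BM inferInstance G := ⟨(clip_cont _).measurable.comp hHm, C * C, fun p =>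
    clip_abs (by positivity) _⟩
  have hHi : Integrable (H : X × X → ℝ) (nu μ hY) := (Lp.memLp H).integrable (by norm_num)
  have hH'b : ∀ (ι : Type) [Fintype ι] (w : ι → ℝ) (u : ι → Γ), BM inferInstance
      (fun p : X × X => ∑ i, w i * (f (T (u i) p.1) * f (T (u i) p.2))) := fun ι _ w u =>
    BM.sum _ fun i _ => (BM.const _).mul ((hfT (u i)).tens (hfT (u i)))
  have happ2 : ∀ δ : ℝ, 0 < δ → ∃ (ι : Type) (_ : Fintype ι) (w : ι → ℝ) (u : ι → Γ),
      (∀ i, 0 ≤ w i) ∧ ∑ i, w i = 1 ∧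
      ∫ p, |H p - ∑ i, w i * (f (T (u i) p.1) * f (T (u i) p.2))| ∂(nu μ hY) ≤ δ ∧
      ∫ p, |G p - ∑ i, w i * (f (T (u i) p.1) * f (T (u i) p.2))| ∂(nu μ hY) ≤ δ := by
    intro δ hδ
    obtain ⟨ι, _, w, u, hw, hs, hn⟩ := happ δ hδ
    have hb := hH'b ι w (fun i => L (u i))
    have e1 : toE (nu μ hY) (fun p : X × X => ∑ i, w i * (f (T (L (u i)) p.1) * f (T (L (u i)) p.2)))
        = ∑ i, w i • Uop hT hY hi (L (u i)) h := by
      rw [toE_sum _ fun i => (BM.const _).mul ((hfT (L (u i))).tens (hfT (L (u i))))]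
      refine Finset.sum_congr rfl fun i _ => ?_
      rw [toE_smul ((hfT (L (u i))).tens (hfT (L (u i)))), hU]
    rw [← e1] at hn
    have h1 : ∫ p, |H p - ∑ i, w i * (f (T (L (u i)) p.1) * f (T (L (u i)) p.2))| ∂(nu μ hY) ≤ δ := by
      refine le_trans (le_trans (le_of_eq ?_) (int_abs_le_norm _)) hn
      refine integral_congr_ae ?_
      filter_upwards [Lp.coeFn_sub (toE (nu μ hY) (fun p : X × X =>
        ∑ i, w i * (f (T (L (u i)) p.1) * f (T (L (u i)) p.2)))) H, toE_coe (ν := nu μ hY) hb] with p h1 h2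
      rw [h1, Pi.sub_apply, h2, abs_sub_comm]
    refine ⟨ι, inferInstance, w, fun i => L (u i), hw, hs, h1, le_trans ?_ h1⟩
    refine integral_mono (hGb.sub hb).abs.integrable (hHi.sub hb.integrable).abs fun p => ?_
    simp only
    rw [abs_sub_comm, abs_sub_comm (H p)]
    refine clip_le ?_
    calc _ ≤ ∑ i, |w i * (f (T (L (u i)) p.1) * f (T (L (u i)) p.2))| :=
          Finset.abs_sum_le_sum_abs _ _
      _ ≤ ∑ i, w i * (C * C) := by
          refine Finset.sum_le_sum fun i _ => ?_
          rw [abs_mul, abs_mul, abs_of_nonneg (hw i)]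
          exact mul_le_mul_of_nonneg_left (mul_le_mul (hC _) (hC _) (abs_nonneg _) hC0.le) (hw i)
      _ = C * C := by rw [← Finset.sum_mul, hs, one_mul]
  have hHG : (H : X × X → ℝ) =ᵐ[nu μ hY] G := by
    have h1 : ∫ p, |H p - G p| ∂(nu μ hY) ≤ 0 := by
      refine le_of_forall_pos_le_add fun ε hε => ?_
      obtain ⟨ι, _, w, u, hw, hs, h1, h2⟩ := happ2 (ε/2) (by positivity)
      have hb := hH'b ι w u
      have i1 := (hHi.sub hb.integrable).abs
      have i2 := (hGb.sub hb).abs.integrable (μ := nu μ hY)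
      calc ∫ p, |H p - G p| ∂(nu μ hY) ≤ ∫ p, (|H p - ∑ i, w i * (f (T (u i) p.1) * f (T (u i) p.2))|
            + |G p - ∑ i, w i * (f (T (u i) p.1) * f (T (u i) p.2))|) ∂(nu μ hY) := by
            refine integral_mono (hHi.sub hGb.integrable).abs (i1.add i2) fun p => ?_
            simp only [Pi.add_apply]
            rw [abs_sub_comm (G p)]
            exact abs_sub_le _ _ _
        _ = _ := integral_add i1 i2
        _ ≤ 0 + ε := by linarith
    have h2 : ∫ p, |H p - G p| ∂(nu μ hY) = 0 := le_antisymm h1 (integral_nonneg fun _ => abs_nonneg _)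
    have hi3 : Integrable (fun p => |H p - G p|) (nu μ hY) := (hHi.sub hGb.integrable).abs
    rw [integral_eq_zero_iff_of_nonneg (fun _ => abs_nonneg _) hi3] at h2
    filter_upwards [h2] with p hp
    simp only [Pi.zero_apply, abs_eq_zero] at hp
    linarith
  have hinv : ∀ l ∈ L.range, (fun p => G (dT T l p)) =ᵐ[nu μ hY] G := by
    rintro _ ⟨v, rfl⟩
    have e := Uop_coe hT hY hi (L v) H
    rw [hHinv v] at e
    filter_upwards [e] with p hp
    simp only [hG]
    rw [hp]
  have hS := SAP_kernel (Λ := L.range) hT hY hi hf hGb hinv fun δ hδ => by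
    obtain ⟨ι, _, w, u, hw, hs, h1, h2⟩ := happ2 δ hδ
    exact ⟨ι, inferInstance, w, u, hw, hs, h2⟩
  have hKb : BM (ZA hT hY L.range) (IK μ hY fun p => G p * f p.2) :=
    ⟨hS.measurable hT hY, ((hGb.mul (hf.comp measurable_snd)).IK hY).2⟩
  have hz : ∫ p, f p.1 * (G p * f p.2) ∂(nu μ hY) = 0 := by
    rw [← IK_mul hY (hGb.mul (hf.comp measurable_snd)) hf]
    have := cE_int_mul (μ := μ) (ZA_le hT hY) hf hKb
    simp only [mul_comm (f _)]
    rw [← this]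
    rw [integral_congr_ae (g := fun _ => (0:ℝ)) (by filter_upwards [h0] with x hx; rw [hx, mul_zero])]
    simp
  have hH0 : H = 0 := by
    have : ‖H‖^2 = 0 := by
      rw [← hHh, hh, inner_toE _ (hf.tens hf), ← hz]
      refine integral_congr_ae ?_
      filter_upwards [hHG] with p hp
      rw [hp]; ring
    simpa using this
  intro ε hε
  set e := toE (nu μ hY) (fun p => g p.1 * g p.2) with he
  obtain ⟨ι, _, w, u, hw, hs, hn⟩ := happ (ε / (‖e‖ + 1)) (by positivity)
  rw [hH0, sub_zero] at hn
  refine ⟨ι, inferInstance, w, u, hw, hs, fun v => ?_⟩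
  have e1 : ∀ a, ∫ x, (cE μ Y (fun x => g x * f (T a x)) x)^2 ∂μ = inner ℝ e (Uop hT hY hi a h) := by
    intro a
    rw [sq_cE_eq hY (hg.mul (hfT a)), hU, he, inner_toE' (hg.tens hg) ((hfT a).tens (hfT a))]
    refine integral_congr_ae (Eventually.of_forall fun p => ?_)
    simp only
    ring
  calc ∑ i, w i * ∫ x, (cE μ Y (fun x => g x * f (T (L (v + u i)) x)) x)^2 ∂μ
      = inner ℝ e (Uop hT hY hi (L v) (∑ i, w i • Uop hT hY hi (L (u i)) h)) := by
        rw [map_sum, inner_sum]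
        refine Finset.sum_congr rfl fun i _ => ?_
        rw [e1, map_add, Uop_add, map_smul, inner_smul_right]
    _ ≤ ‖e‖ * ‖Uop hT hY hi (L v) (∑ i, w i • Uop hT hY hi (L (u i)) h)‖ := real_inner_le_norm _ _
    _ ≤ ‖e‖ * (ε / (‖e‖ + 1)) := by
        rw [LinearIsometry.norm_map]
        gcongr
    _ ≤ ε := by
        rw [mul_div_assoc', div_le_iff₀ (by positivity)]
        nlinarith [norm_nonneg e]

/-- Jensen/Cauchy-Schwarz -/
lemma sq_int_abs_le (hf : BM mX f) : (∫ x, |f x| ∂μ)^2 ≤ ∫ x, (f x)^2 ∂μ := by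
  set c := ∫ x, |f x| ∂μ
  have h0 : 0 ≤ ∫ x, (|f x| - c)^2 ∂μ := integral_nonneg fun x => sq_nonneg _
  have e : ∫ x, (|f x| - c)^2 ∂μ = ∫ x, (f x)^2 ∂μ - 2 * c * c + c^2 := by
    have : (fun x => (|f x| - c)^2) = fun x => ((f x)^2 - 2 * c * |f x|) + c^2 := by
      funext x
      rw [← sq_abs (f x)]
      ring
    rw [this, integral_add ((hf.pow 2).sub ((BM.const _).mul hf.abs)).integrable (integrable_const _),
      integral_sub (hf.pow 2).integrable ((BM.const _).mul hf.abs).integrable, integral_const_mul]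
    simp
    exact Or.inl rfl
  nlinarith

lemma lemB (hT : Act μ T) (hY : Y ≤ mX) (hi : InvA T Y) {C : ℝ}
    (hw : WAP μ Y mX C (fun (l : Λ) x => f (T l x)))
    (h0 : cE μ (ZA hT hY Λ) f =ᵐ[μ] fun _ => 0) : f =ᵐ[μ] fun _ => 0 := by
  have hf : BM mX f := by simpa [hT.zero] using hw.bm 0
  have hC : ∀ x, |f x| ≤ C := fun x => by simpa [hT.zero] using (hw.1 0).2 x
  have hfT : ∀ a, BM mX (fun x => f (T a x)) := fun a => hf.comp (hT.meas a)
  have hX : Nonempty X := nonempty_of_isProbabilityMeasure μ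
  have hC0 : 0 ≤ C := (abs_nonneg _).trans (hC hX.some)
  have hmain : ∫ x, (f x)^2 ∂μ ≤ 0 := by
    refine le_of_forall_pos_le_add fun ε hε => ?_
    obtain ⟨K, _, g, hg, hκ⟩ := hw.2 (ε/(2*(C+1))) (by positivity)
    have hgb : ∀ k, BM mX (g k) := fun k => ⟨(hg k).1, C, (hg k).2⟩
    have hnull : NullS (fun l : Λ => ∑ k, ∫ x, |cE μ Y (fun x => g k x * f (T l x)) x| ∂μ) := by
      refine NullS.sum _ fun k _ => ?_
      have := lemA hT hY hi Λ.subtype hf (by rwa [AddSubgroup.range_subtype]) (hgb k)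
      exact this.of_sq fun l => sq_int_abs_le ((((hgb k).mul (hfT l)).cE).mono hY)
    obtain ⟨ι, _, w, u, hw, hs, hn⟩ := hnull (ε/2) (by positivity)
    have key : ∀ l : Λ, ∫ x, (f x)^2 ∂μ ≤ ∑ k, ∫ x, |cE μ Y (fun x => g k x * f (T l x)) x| ∂μ
        + ε/2 := by
      intro l
      obtain ⟨κ, h1, h2⟩ := hκ l
      have hs : BM mX (fun x => g (κ x) x) := BM.select hgb (h1.mono hY)
      have e1 : ∫ x, (f x)^2 ∂μ = ∫ x, g (κ x) x * f (T l x) ∂μ +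
          ∫ x, f (T l x) * (f (T l x) - g (κ x) x) ∂μ := by
        rw [← hT.int l, ← integral_add (hs.mul (hfT l)).integrable
          ((hfT l).mul ((hfT l).sub hs)).integrable]
        congr 1; funext x; ring
      have e2 : ∫ x, f (T l x) * (f (T l x) - g (κ x) x) ∂μ ≤ ε/2 := by
        calc _ ≤ ∫ x, C * |f (T l x) - g (κ x) x| ∂μ := by
              refine integral_mono ((hfT l).mul ((hfT l).sub hs)).integrable
                ((BM.const C).mul ((hfT l).sub hs).abs).integrable fun x => ?_
              simp only
              refine (le_abs_self _).trans ?_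
              rw [abs_mul]
              exact mul_le_mul_of_nonneg_right (hC _) (abs_nonneg _)
          _ ≤ C * (ε/(2*(C+1))) := by rw [integral_const_mul]; gcongr
          _ ≤ ε/2 := by
              rw [mul_div_assoc', div_le_div_iff₀ (by positivity) (by positivity)]
              nlinarith
      have e3 : ∫ x, g (κ x) x * f (T l x) ∂μ ≤
          ∑ k, ∫ x, |cE μ Y (fun x => g k x * f (T l x)) x| ∂μ := by
        have hk : ∀ k, BM mX (fun x => g k x * f (T l x)) := fun k => (hgb k).mul (hfT l)
        have hb : BM mX (fun x => g (κ x) x * f (T l x)) := hs.mul (hfT l)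
        rw [← cE_int hY hb]
        have hsel := cE_select (μ := μ) (g := fun k x => g k x * f (T l x)) le_rfl hY hk h1
        rw [integral_congr_ae hsel, ← integral_finsetSum _ fun k _ =>
          (((hk k).cE).mono hY).abs.integrable]
        refine integral_mono_ae ?_ (BM.sum _ fun k _ => (((hk k).cE).mono hY).abs).integrable
          (Eventually.of_forall fun x => ?_)
        · exact (BM.select (F := fun k => cE μ Y (fun x => g k x * f (T l x)))
            (fun k => ((hk k).cE).mono hY) (h1.mono hY)).integrable
        · exact (le_abs_self _).trans (Finset.single_le_sum
            (f := fun k => |cE μ Y (fun x => g k x * f (T l x)) x|)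
            (fun k _ => abs_nonneg _) (Finset.mem_univ (κ x)))
      linarith
    calc ∫ x, (f x)^2 ∂μ = ∑ i, w i * ∫ x, (f x)^2 ∂μ := by rw [← Finset.sum_mul, hs, one_mul]
      _ ≤ ∑ i, w i * (∑ k, ∫ x, |cE μ Y (fun x => g k x * f (T (0 + u i : Λ) x)) x| ∂μ + ε/2) :=
          Finset.sum_le_sum fun i _ => mul_le_mul_of_nonneg_left (key _) (hw i)
      _ = ∑ i, w i * (∑ k, ∫ x, |cE μ Y (fun x => g k x * f (T (0 + u i : Λ) x)) x| ∂μ) + ε/2 := by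
          simp only [mul_add]
          rw [Finset.sum_add_distrib, ← Finset.sum_mul _ _ (ε/2), hs, one_mul]
      _ ≤ 0 + ε := by linarith [hn 0]
  have h2 : ∫ x, (f x)^2 ∂μ = 0 := le_antisymm hmain (integral_nonneg fun _ => sq_nonneg _)
  rw [integral_eq_zero_iff_of_nonneg (fun _ => sq_nonneg _) (hf.pow 2).integrable] at h2
  filter_upwards [h2] with x hx
  simpa using hx

end lemA
end PS6bfile

section PS6cfile
open Filter Topology
open scoped Classical symmDiff
open MeasureTheory ProbabilityTheory

/-! ### Maximality of the compact directions -/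
section wm
set_option linter.unusedSectionVars false
variable {X Γ : Type} {Y Z : MeasurableSpace X} {f g : X → ℝ} [mX : MeasurableSpace X]
  {μ : Measure X} [IsProbabilityMeasure μ] [AddCommGroup Γ] {T : Γ → X → X} {Λ Λ' : AddSubgroup Γ}

lemma ColM.sigma {K : Type} {K' : K → Type} {κ : X → K} {κ' : ∀ k, X → K' k}
    (h : ColM Y κ) (h' : ∀ k, ColM Y (κ' k)) :
    ColM Y (fun x => (⟨κ x, κ' (κ x) x⟩ : Σ k, K' k)) := by
  rintro ⟨k, k'⟩
  have : (fun x => (⟨κ x, κ' (κ x) x⟩ : Σ k, K' k)) ⁻¹' {⟨k, k'⟩} = κ ⁻¹' {k} ∩ κ' k ⁻¹' {k'} := by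
    ext x
    simp only [Set.mem_preimage, Set.mem_singleton_iff, Set.mem_inter_iff, Sigma.mk.injEq]
    constructor
    · rintro ⟨h1, h2⟩
      subst h1
      exact ⟨rfl, by simpa using h2⟩
    · rintro ⟨h1, h2⟩
      subst h1
      exact ⟨rfl, by simpa using h2⟩
  rw [this]
  exact @MeasurableSet.inter _ Y _ _ (h k) (h' k k')

lemma WAP_sup (hT : Act μ T) (hY : Y ≤ mX) (hi : InvA T Y) {C : ℝ} (hC0 : 0 < C)
    (hw : WAP μ Y (ZA hT hY Λ') C (fun (l : Λ) x => f (T l x))) :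
    WAP μ Y mX C (fun (l : (Λ ⊔ Λ' : AddSubgroup Γ)) x => f (T l x)) := by
  have hf : BM mX f := by simpa [hT.zero] using hw.bm 0
  have hC : ∀ x, |f x| ≤ C := fun x => by simpa [hT.zero] using (hw.1 0).2 x
  refine ⟨fun l => ⟨hf.1.comp (hT.meas _), fun x => hC _⟩, fun ε hε => ?_⟩
  obtain ⟨K, _, g, hg, hκ⟩ := hw.2 (ε/2) (by positivity)
  have hgb : ∀ k, BM (ZA hT hY Λ') (g k) := fun k => ⟨(hg k).1, C, (hg k).2⟩
  have hgm : ∀ k, BM mX (g k) := fun k => (hgb k).mono (ZA_le hT hY)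
  choose K' fK' g' hg' hκ' using fun k => ((hgb k).wap hT hY hC0 (hg k).2).2
    (ε/(2*(Fintype.card K + 1))) (by positivity)
  refine ⟨Σ k, K' k, inferInstance, fun p => g' p.1 p.2, fun p => hg' _ _, ?_⟩
  rintro ⟨l, hl⟩
  obtain ⟨a, ha, b, hb, rfl⟩ := AddSubgroup.mem_sup.1 hl
  obtain ⟨κ, hκm, hκi⟩ := hκ ⟨a, ha⟩
  choose κ' hκm' hκi' using fun k => hκ' k ⟨b, hb⟩
  refine ⟨fun x => ⟨κ (T b x), κ' (κ (T b x)) x⟩, (hκm.comp (hi b)).sigma hκm', ?_⟩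
  simp only at hκi hκi' ⊢
  have hsel : BM mX (fun x => g (κ x) x) := BM.select hgm fun k => hY _ (hκm k)
  have hselT : BM mX (fun x => g (κ (T b x)) (T b x)) := hsel.comp (hT.meas b)
  have hg'b : ∀ k k', BM mX (g' k k') := fun k k' => ⟨(hg' k k').1, C, (hg' k k').2⟩
  have hsel' : ∀ k, BM mX (fun x => g' k (κ' k x) x) :=
    fun k => BM.select (hg'b k) fun j => hY _ (hκm' k j)
  have hS : BM mX (fun x => ∑ k, |g k (T b x) - g' k (κ' k x) x|) :=
    BM.sum _ fun k _ => (((hgm k).comp (hT.meas b)).sub (hsel' k)).abs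
  have hfT : BM mX (fun x => f (T a x)) := hf.comp (hT.meas a)
  have h1b : BM mX (fun x => |f (T a x) - g (κ x) x|) := (hfT.sub hsel).abs
  have h1bT : BM mX (fun x => |f (T a (T b x)) - g (κ (T b x)) (T b x)|) := h1b.comp (hT.meas b)
  have hfin : BM mX (fun x => g' (κ (T b x)) (κ' (κ (T b x)) x) x) :=
    BM.select (F := fun k x => g' k (κ' k x) x) hsel' fun k => hT.meas b (hY _ (hκm k))
  calc ∫ x, |f (T (a+b) x) - g' (κ (T b x)) (κ' (κ (T b x)) x) x| ∂μ
      ≤ ∫ x, (|f (T a (T b x)) - g (κ (T b x)) (T b x)| + ∑ k, |g k (T b x) - g' k (κ' k x) x|) ∂μ := by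
        refine integral_mono (((hf.comp (hT.meas (a+b))).sub hfin).abs).integrable
          (h1bT.add hS).integrable fun x => ?_
        simp only [hT.add]
        have := Finset.single_le_sum (f := fun k => |g k (T b x) - g' k (κ' k x) x|)
          (fun k _ => abs_nonneg _) (Finset.mem_univ (κ (T b x)))
        exact (abs_sub_le _ (g (κ (T b x)) (T b x)) _).trans (add_le_add le_rfl this)
    _ = ∫ x, |f (T a (T b x)) - g (κ (T b x)) (T b x)| ∂μ +
        ∑ k, ∫ x, |g k (T b x) - g' k (κ' k x) x| ∂μ := by
        rw [integral_add h1bT.integrable hS.integrable, integral_finsetSum]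
        exact fun k _ => (((hgm k).comp (hT.meas b)).sub (hsel' k)).abs.integrable
    _ ≤ ε/2 + ∑ _k : K, ε/(2*(Fintype.card K + 1)) := by
        refine add_le_add ?_ (Finset.sum_le_sum fun k _ => hκi' k)
        rw [hT.int b (fun x => |f (T a x) - g (κ x) x|)]
        exact hκi
    _ ≤ ε := by
        rw [Finset.sum_const, Finset.card_univ, nsmul_eq_mul, mul_div_assoc']
        have : (Fintype.card K : ℝ) * ε / (2*(Fintype.card K + 1)) ≤ ε/2 := by
          rw [div_le_div_iff₀ (by positivity) (by positivity)]
          nlinarith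
        linarith

lemma SAP.finite_index (hT : Act μ T) (hY : Y ≤ mX) (hi : InvA T Y) {J : Type} [Fintype J]
    (d : J → Γ) (hd : ∀ l ∈ Λ', ∃ j, ∃ a ∈ Λ, l = a + d j) (hf : SAP μ T Y Λ f) :
    SAP μ T Y Λ' f := by
  refine ⟨hf.1, hf.2.1, fun ε hε η hη => ?_⟩
  choose W hW hWη K fK g hg hκ using fun j => ((hf.comp hY hT hi (d j)).2.2 ε hε
    (η/(Fintype.card J + 1)) (by positivity))
  refine ⟨⋂ j, W j, @MeasurableSet.iInter _ _ Y _ _ hW, ?_, Σ j, K j, inferInstance,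
    fun p => g p.1 p.2, fun p => hg _ _, fun l hl => ?_⟩
  · rw [Set.compl_iInter]
    calc μ.real (⋃ j, (W j)ᶜ) ≤ ∑ j, μ.real (W j)ᶜ := measureReal_iUnion_fintype_le _
      _ ≤ ∑ _j : J, η/(Fintype.card J + 1) := Finset.sum_le_sum fun j _ => hWη j
      _ ≤ η := by
        rw [Finset.sum_const, Finset.card_univ, nsmul_eq_mul, mul_div_assoc',
          div_le_iff₀ (by positivity)]
        nlinarith
  · obtain ⟨j, a, ha, rfl⟩ := hd l hl
    obtain ⟨κ, hκm, hκi⟩ := hκ j a ha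
    refine ⟨fun x => ⟨j, κ x⟩, ?_, fun B hB hBW => ?_⟩
    · rintro ⟨j', k⟩
      by_cases h : j = j'
      · subst h
        have : (fun x => (⟨j, κ x⟩ : Σ j, K j)) ⁻¹' {⟨j, k⟩} = κ ⁻¹' {k} := by
          ext x; simp
        rw [this]; exact hκm k
      · have : (fun x => (⟨j, κ x⟩ : Σ j, K j)) ⁻¹' {⟨j', k⟩} = ∅ := by
          ext x; simp [h]
        rw [this]; exact @MeasurableSet.empty _ Y
    · have := hκi B hB (hBW.trans (Set.iInter_subset _ j))
      simp only [← hT.add] at this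
      rwa [add_comm a]

lemma ZA_finite_index (hT : Act μ T) (hY : Y ≤ mX) (hi : InvA T Y) {J : Type} [Fintype J]
    (d : J → Γ) (hd : ∀ l ∈ Λ', ∃ j, ∃ a ∈ Λ, l = a + d j) : ZA hT hY Λ ≤ ZA hT hY Λ' := by
  refine fun S hS => ⟨hS.1, fun ε hε => ?_⟩
  obtain ⟨k, hk, hk'⟩ := hS.2 ε hε
  exact ⟨k, hk.finite_index hT hY hi d hd, hk'⟩

lemma max_tf (hT : Act μ T) (hY : Y ≤ mX) (hi : InvA T Y) (hne : ZA hT hY Λ ≠ Y)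
    (hmax : ∀ Λ', Λ < Λ' → ZA hT hY Λ' = Y) {γ : Γ} {k : ℤ} (hk : k ≠ 0) (hγ : k • γ ∈ Λ) :
    γ ∈ Λ := by
  by_contra hn
  have hlt : Λ < Λ ⊔ AddSubgroup.zmultiples γ := by
    refine lt_of_le_of_ne le_sup_left fun h => hn ?_
    rw [h]
    exact AddSubgroup.mem_sup_right (AddSubgroup.mem_zmultiples γ)
  refine hne (le_antisymm ?_ (le_ZA hT hY hi))
  refine le_trans ?_ (hmax _ hlt).le
  refine ZA_finite_index hT hY hi (J := Finset.Ico (0:ℤ) |k|) (fun j => (j:ℤ) • γ) ?_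
  intro l hl
  obtain ⟨a, ha, b, hb, rfl⟩ := AddSubgroup.mem_sup.1 hl
  obtain ⟨m, rfl⟩ := AddSubgroup.mem_zmultiples_iff.1 hb
  refine ⟨⟨m % k, ?_⟩, a + (m / k) • (k • γ), add_mem ha (zsmul_mem hγ _), ?_⟩
  · rw [Finset.mem_Ico]
    exact ⟨Int.emod_nonneg _ hk, Int.emod_lt_abs _ hk⟩
  · simp only
    rw [add_assoc, ← mul_smul, ← add_smul, mul_comm, Int.mul_ediv_add_emod]

variable [StandardBorelSpace X]

lemma lemWM {V : Type} [AddCommGroup V] (hT : Act μ T) (hY : Y ≤ mX) (hi : InvA T Y)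
    (hmax : ∀ Λ', Λ < Λ' → ZA hT hY Λ' = Y) (L : V →+ Γ) (hL : ¬ L.range ≤ Λ)
    (hf : BM (ZA hT hY Λ) f) (h0 : cE μ Y f =ᵐ[μ] fun _ => 0) (hg : BM mX g) :
    NullS (fun v => ∫ x, (cE μ Y (fun x => g x * f (T (L v) x)) x)^2 ∂μ) := by
  have hfm : BM mX f := hf.mono (ZA_le hT hY)
  refine lemA hT hY hi L hfm ?_ hg
  obtain ⟨C, hC0, hC⟩ := hf.bd
  set f' := cE μ (ZA hT hY L.range) f with hf'
  have hf'b : BM mX f' := hfm.cE.mono (ZA_le hT hY)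
  have hw : WAP μ Y (ZA hT hY L.range) C (fun (l : Λ) x => f' (T l x)) := by
    refine ((hf.wap hT hY hC0 hC).cE (le_ZA hT hY hi) (ZA_le hT hY)).congr
      (fun l => ⟨hf'b.1.comp (hT.meas _), fun x => cE_abs_le_of_bd hC _⟩) fun l => ?_
    exact hT.cE (ZA_le hT hY) (ZA_inv hT hY hi) hfm l
  have hw2 := WAP_sup hT hY hi hC0 hw
  refine lemB hT hY hi hw2 ?_
  have hlt : Λ < Λ ⊔ L.range := lt_of_le_of_ne le_sup_left fun h => hL (by rw [h]; exact le_sup_right)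
  rw [hmax _ hlt]
  exact (cE_tower (le_ZA hT hY hi) (ZA_le hT hY) hfm).trans h0

end wm
end PS6cfile

section PS7file
open Filter Topology
open scoped Classical symmDiff
open MeasureTheory ProbabilityTheory

/-! ### PET induction: preparations -/
section pet0
variable {V Γ : Type} [AddCommGroup V] [AddCommGroup Γ]

lemma nullS_sparse {B : Set V} {u : V} (h : ∀ k ∈ B, ∀ m : ℕ, 0 < m → k + m • u ∉ B) :
    NullS (fun v => if v ∈ B then (1:ℝ) else 0) := by
  intro ε hε
  obtain ⟨M, hM⟩ := exists_nat_gt (1/ε)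
  have hM0 : 0 < (M:ℝ) := lt_trans (by positivity) hM
  refine ⟨Fin M, inferInstance, fun _ => 1/M, fun j => (j:ℕ) • u, fun _ => by positivity, ?_, fun v => ?_⟩
  · simp [hM0.ne']
  · rw [← Finset.mul_sum]
    have : ∑ j : Fin M, (if v + (j:ℕ) • u ∈ B then (1:ℝ) else 0) ≤ 1 := by
      rw [Finset.sum_boole]
      have : (Finset.univ.filter fun j : Fin M => v + (j:ℕ) • u ∈ B).card ≤ 1 := by
        rw [Finset.card_le_one]
        have key : ∀ i j : Fin M, v + (i:ℕ) • u ∈ B → v + (j:ℕ) • u ∈ B → ¬ i < j := by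
          intro i j hi hj hij
          refine h _ hi ((j:ℕ) - i) (Nat.sub_pos_of_lt hij) ?_
          rwa [add_assoc, ← add_smul, Nat.add_sub_cancel' (le_of_lt hij)]
        intro i hi j hj
        simp only [Finset.mem_filter, Finset.mem_univ, true_and] at hi hj
        exact le_antisymm (not_lt.1 (key j i hj hi)) (not_lt.1 (key i j hi hj))
      exact_mod_cast this
    calc 1/(M:ℝ) * _ ≤ 1/(M:ℝ) * 1 := by gcongr
      _ ≤ ε := by
        rw [mul_one, div_le_iff₀ hM0]
        rw [div_lt_iff₀ hε] at hM
        linarith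

lemma PD_smul_cancel (htf : ∀ (m : ℕ) (γ : Γ), m ≠ 0 → m • γ = 0 → γ = 0) {m : ℕ} (hm : m ≠ 0)
    {d : ℕ} {Q : V → Γ} (h : m • Q ∈ PD V Γ d) : Q ∈ PD V Γ d := by
  induction d generalizing Q with
  | zero =>
    rw [PD_zero_iff] at *
    funext x
    exact htf m _ hm (congrFun h x)
  | succ d ih =>
    intro k
    refine ih ?_
    convert h k using 1
    funext x
    simp [smul_sub]

lemma PD_tf (htf : ∀ (m : ℕ) (γ : Γ), m ≠ 0 → m • γ = 0 → γ = 0) {m : ℕ} (hm : m ≠ 0)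
    {P : V → Γ} {N : ℕ} (hP : P ∈ PD V Γ N) {u : V}
    (h : (fun x => P (x + m • u) - P x) ∈ PD V Γ 1) : (fun x => P (x + u) - P x) ∈ PD V Γ 1 := by
  set Q : V → Γ := fun x => P (x + u) - P x with hQ
  have hQN : Q ∈ PD V Γ N := sub_mem (PD_shift hP u) hP
  have hsum : (fun x => P (x + m • u) - P x) = ∑ j ∈ Finset.range m, fun x => Q (x + j • u) := by
    funext x
    rw [Finset.sum_apply]
    have := Finset.sum_range_sub (fun j => P (x + j • u)) m
    simp only [zero_smul, add_zero] at this
    rw [← this]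
    refine Finset.sum_congr rfl fun j _ => ?_
    simp only [hQ, succ_nsmul, add_assoc]
  by_contra hn
  obtain ⟨e, he, _, h1, h2⟩ := exists_deg PD_mono hQN hn
  refine h2 (PD_smul_cancel htf hm ?_)
  have : m • Q = (fun x => P (x + m • u) - P x) - ∑ j ∈ Finset.range m, fun x => (Q (x + j • u) - Q x) := by
    rw [hsum, ← Finset.sum_sub_distrib]
    funext x
    simp [Finset.sum_apply]
  rw [this]
  refine sub_mem (PD_mono he h) (sum_mem fun j _ => h1 _)

lemma nullS_bad (htf : ∀ (m : ℕ) (γ : Γ), m ≠ 0 → m • γ = 0 → γ = 0) {P Q : V → Γ} {N : ℕ}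
    (hP : P ∈ PD V Γ N) (hP2 : P ∉ PD V Γ 2) :
    NullS (fun k => if k ∈ {k | (fun x => P (x + k) - Q x) ∈ PD V Γ 1} then (1:ℝ) else 0) := by
  rw [PD_succ_iff] at hP2
  push Not at hP2
  obtain ⟨u, hu⟩ := hP2
  refine nullS_sparse (u := u) fun k hk m hm hk' => hu ?_
  refine PD_tf htf hm.ne' hP ?_
  rw [Set.mem_ofPred_eq] at hk hk'
  have h1 := PD_shift (sub_mem hk' hk) (-k)
  convert h1 using 1
  funext x
  simp only [Pi.sub_apply]
  have e1 : x + -k + (k + m • u) = x + m • u := by abel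
  have e2 : x + -k + k = x := by abel
  rw [e1, e2]
  abel

end pet0

section pet1
set_option linter.unusedSectionVars false
variable {X Γ : Type} {Y Z : MeasurableSpace X} {f g : X → ℝ} [mX : MeasurableSpace X]
  [StandardBorelSpace X]
  {μ : Measure X} [IsProbabilityMeasure μ] [AddCommGroup Γ] {T : Γ → X → X} {Λ : AddSubgroup Γ}

/-- squared norm of the conditional expectation -/
noncomputable def qn {X : Type} {mX : MeasurableSpace X} [StandardBorelSpace X]
    (μ : Measure X) [IsProbabilityMeasure μ] (Y : MeasurableSpace X) (F : X → ℝ) : ℝ :=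
  ∫ x, (cE μ Y F x)^2 ∂μ

lemma qn_nonneg (F : X → ℝ) : 0 ≤ qn μ Y F := integral_nonneg fun _ => sq_nonneg _

lemma qn_shift (hT : Act μ T) (hY : Y ≤ mX) (hi : InvA T Y) (hf : BM mX f) (a : Γ) :
    qn μ Y (fun x => f (T a x)) = qn μ Y f := by
  unfold qn
  rw [← hT.int a (fun x => (cE μ Y f x)^2)]
  refine integral_congr_ae ?_
  filter_upwards [hT.cE hY hi hf a] with x hx
  rw [hx]

lemma qn_add (hY : Y ≤ mX) (hf : BM mX f) (hg : BM mX g) :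
    qn μ Y (fun x => f x + g x) ≤ 2 * qn μ Y f + 2 * qn μ Y g := by
  unfold qn
  have h1 : BM mX (fun x => (cE μ Y f x)^2) := (hf.cE.mono hY).pow 2
  have h2 : BM mX (fun x => (cE μ Y g x)^2) := (hg.cE.mono hY).pow 2
  rw [← integral_const_mul, ← integral_const_mul,
    ← integral_add ((BM.const 2).mul h1).integrable ((BM.const 2).mul h2).integrable]
  refine integral_mono (((hf.add hg).cE.mono hY).pow 2).integrable
    (((BM.const 2).mul h1).add ((BM.const 2).mul h2)).integrable fun x => ?_
  simp only
  rw [cE_add hf hg]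
  nlinarith [sq_nonneg (cE μ Y f x - cE μ Y g x)]

lemma qn_le_sq (hY : Y ≤ mX) (hf : BM mX f) : qn μ Y f ≤ ∫ x, (f x)^2 ∂μ := int_sq_cE_le hY hf

lemma qn_inner (hY : Y ≤ mX) (hf : BM mX f) (hg : BM mX g) :
    inner ℝ (toE (nu μ hY) (fun p => f p.1 * f p.2)) (toE (nu μ hY) (fun p => g p.1 * g p.2)) =
      qn μ Y (fun x => f x * g x) := by
  unfold qn
  rw [sq_cE_eq hY (hf.mul hg), inner_toE' (hf.tens hf) (hg.tens hg)]
  refine integral_congr_ae (Eventually.of_forall fun p => ?_)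
  simp only
  ring

lemma qn_congr (hY : Y ≤ mX) (hf : BM mX f) (hg : BM mX g) (h : f =ᵐ[μ] g) :
    qn μ Y f = qn μ Y g := by
  unfold qn
  refine integral_congr_ae ?_
  filter_upwards [cE_congr hY hf hg h] with x hx
  rw [hx]

end pet1
end PS7file

section PS7bfile
open Filter Topology
open scoped Classical symmDiff
open MeasureTheory ProbabilityTheory

/-! ### PET induction -/

/-- essentially distinct polynomial maps -/
structure PSep {V Γ ι : Type} [AddCommGroup V] [AddCommGroup Γ] (Γw : AddSubgroup Γ) (N : ℕ)
    (s : Finset ι) (P : ι → V → Γ) : Prop where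
  deg : ∀ i ∈ s, P i ∈ PD V Γ N
  val : ∀ i ∈ s, ∀ n, P i n ∈ Γw
  sep : ∀ i ∈ s, ∀ j ∈ s, i ≠ j → P i - P j ∉ PD V Γ 1

section pet2
set_option linter.unusedSectionVars false

lemma prod_upd {X ι : Type} [DecidableEq ι] {s : Finset ι} {j : ι} (hj : j ∈ s) (f : ι → X → ℝ) (g : X → ℝ) (z : ι → X) :
    ∏ i ∈ s, (Function.update f j g) i (z i) = g (z j) * ∏ i ∈ s.erase j, f i (z i) := by
  rw [← Finset.mul_prod_erase s _ hj]
  congr 1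
  · simp
  · refine Finset.prod_congr rfl fun i hi => ?_
    rw [Function.update_of_ne (Finset.ne_of_mem_erase hi)]

variable {X Γ V : Type} {Y Z : MeasurableSpace X} [mX : MeasurableSpace X]
  [StandardBorelSpace X] [AddCommGroup V]
  {μ : Measure X} [IsProbabilityMeasure μ] [AddCommGroup Γ] {T : Γ → X → X} {Λ : AddSubgroup Γ}

lemma BM.prodT (hT : Act μ T) {ι : Type} (s : Finset ι) {f : ι → X → ℝ} (hf : ∀ i, BM mX (f i))
    (a : ι → Γ) : BM mX (fun x => ∏ i ∈ s, f i (T (a i) x)) :=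
  BM.prod _ fun i _ => (hf i).comp (hT.meas _)

lemma pet_triv (hT : Act μ T) (hY : Y ≤ mX) (hi : InvA T Y) {ι : Type} {s : Finset ι} {b : ι}
    (hb : b ∈ s) {f : ι → X → ℝ} (hf : ∀ i, BM mX (f i)) (hfY : ∀ i ∈ s, i ≠ b → BM Y (f i))
    (h0 : cE μ Y (f b) =ᵐ[μ] fun _ => 0) (a : ι → Γ) :
    qn μ Y (fun x => ∏ i ∈ s, f i (T (a i) x)) = 0 := by
  have h1 : BM Y (fun x => ∏ i ∈ s.erase b, f i (T (a i) x)) :=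
    BM.prod _ fun i hi' => (hfY i (Finset.mem_of_mem_erase hi') (Finset.ne_of_mem_erase hi')).comp (hi _)
  have h2 : (fun x => ∏ i ∈ s, f i (T (a i) x)) =
      fun x => (∏ i ∈ s.erase b, f i (T (a i) x)) * f b (T (a b) x) := by
    funext x
    rw [mul_comm, Finset.mul_prod_erase s (fun i => f i (T (a i) x)) hb]
  unfold qn
  rw [h2, integral_congr_ae (g := fun _ => (0:ℝ)), integral_zero]
  filter_upwards [cE_mul_left hY ((hf b).comp (hT.meas (a b))) h1, hT.cE hY hi (hf b) (a b),
    hT.ae (a b) h0] with x h3 h4 h5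
  rw [h3, h4, h5]
  simp

lemma pet_base (hT : Act μ T) (hY : Y ≤ mX) (hi : InvA T Y) (hYZ : Y ≤ Z) (hZ : Z ≤ mX) {ι : Type}
    {s : Finset ι} {b : ι} (hb : b ∈ s) {P : ι → V → Γ}
    (H : ∀ f : ι → X → ℝ, (∀ i, BM Z (f i)) → ∀ i0 ∈ s, i0 ≠ b → cE μ Y (f i0) =ᵐ[μ] (fun _ => 0) →
      NullS (fun n => qn μ Y (fun x => ∏ i ∈ s, f i (T (P i n) x))))
    {f : ι → X → ℝ} (hf : ∀ i, BM Z (f i)) (h0 : cE μ Y (f b) =ᵐ[μ] fun _ => 0) :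
    NullS (fun n => qn μ Y (fun x => ∏ i ∈ s, f i (T (P i n) x))) := by
  have key : ∀ (t : Finset ι) (f : ι → X → ℝ), (∀ i, BM Z (f i)) → cE μ Y (f b) =ᵐ[μ] (fun _ => 0) →
      (∀ i ∈ s, i ≠ b → i ∉ t → BM Y (f i)) →
      NullS (fun n => qn μ Y (fun x => ∏ i ∈ s, f i (T (P i n) x))) := by
    intro t
    induction t using Finset.induction_on with
    | empty =>
      intro f hf h0 hfY
      refine NullS.of_const fun n => le_of_eq ?_
      exact pet_triv hT hY hi hb (fun i => (hf i).mono hZ) (fun i h1 h2 => hfY i h1 h2 (by simp)) h0 _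
    | insert j t hj ih =>
      intro f hf h0 hfY
      by_cases hjs : j ∈ s ∧ j ≠ b
      · have hfj : BM mX (f j) := (hf j).mono hZ
        have hE : BM Y (cE μ Y (f j)) := hfj.cE
        have h1 : ∀ i, BM Z (Function.update f j (cE μ Y (f j)) i) := by
          intro i
          by_cases h : i = j
          · subst h; simpa using hE.mono hYZ
          · rw [Function.update_of_ne h]; exact hf i
        have h2 : ∀ i, BM Z (Function.update f j (fun x => f j x - cE μ Y (f j) x) i) := by
          intro i
          by_cases h : i = j
          · subst h; simpa using (hf i).sub (hE.mono hYZ)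
          · rw [Function.update_of_ne h]; exact hf i
        have n1 := ih _ h1 (by rw [Function.update_of_ne hjs.2.symm]; exact h0) (by
          intro i his hib hit
          by_cases h : i = j
          · subst h; simpa using hE
          · rw [Function.update_of_ne h]; exact hfY i his hib (by simp [h, hit]))
        have n2 := H _ h2 j hjs.1 hjs.2 (by
          simp only [Function.update_self]
          filter_upwards [cE_self hY hE] with x hx
          rw [cE_sub hfj (hE.mono hY), hx, sub_self])
        refine ((n1.smul (c := 2) (by norm_num)).add (n2.smul (c := 2) (by norm_num))).mono fun n => ?_
        refine le_trans (le_of_eq ?_) (qn_add hY (BM.prodT hT s (fun i => (h1 i).mono hZ) _)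
          (BM.prodT hT s (fun i => (h2 i).mono hZ) _))
        congr 1
        funext x
        rw [prod_upd hjs.1, prod_upd hjs.1, ← Finset.mul_prod_erase s _ hjs.1]
        ring
      · refine ih f hf h0 fun i his hib hit => hfY i his hib ?_
        rw [Finset.mem_insert, not_or]
        exact ⟨fun h => hjs (h ▸ ⟨his, hib⟩), hit⟩
  exact key s f hf h0 fun i his _ hit => absurd his hit

end pet2
end PS7bfile

section PS7cfile
open Filter Topology
open scoped Classical symmDiff
open MeasureTheory ProbabilityTheory

section pet3
set_option linter.unusedSectionVars false
variable {X Γ V : Type} {Y Z : MeasurableSpace X} [mX : MeasurableSpace X]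
  [StandardBorelSpace X] [AddCommGroup V]
  {μ : Measure X} [IsProbabilityMeasure μ] [AddCommGroup Γ] {T : Γ → X → X} {Γw : AddSubgroup Γ}

/-- index set of the derived family -/
noncomputable def dIdx {V Γ ι : Type} [AddCommGroup V] [AddCommGroup Γ] (s : Finset ι) (Pt : ι → V → Γ) :
    Finset (ι × Bool) :=
  (s ×ˢ Finset.univ).filter fun p => Pt p.1 ∈ PD V Γ 2 → p.2 = false

/-- derived polynomials -/
def dPol {V Γ ι : Type} [AddCommGroup V] [AddCommGroup Γ] (Pt : ι → V → Γ) (h h' : V) :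
    ι × Bool → V → Γ := fun p n => Pt p.1 (n + if p.2 then h' else h)

lemma dIdx_mem {ι : Type} {s : Finset ι} {Pt : ι → V → Γ} {p : ι × Bool} :
    p ∈ dIdx s Pt ↔ p.1 ∈ s ∧ (Pt p.1 ∈ PD V Γ 2 → p.2 = false) := by
  simp [dIdx]

lemma dPol_sep {ι : Type} {s : Finset ι} {Pt : ι → V → Γ} {N : ℕ} (hP : PSep Γw N s Pt) {h h' : V}
    (hgood : ∀ i ∈ s, ∀ j ∈ s, Pt i ∉ PD V Γ 2 → (fun x => Pt i (x + (h - h')) - Pt j x) ∉ PD V Γ 1) :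
    PSep Γw N (dIdx s Pt) (dPol Pt h h') := by
  have hfix : ∀ i ∈ s, ∀ j ∈ s, (i = j → Pt i ∉ PD V Γ 2) →
      (fun x => Pt i (x + h) - Pt j (x + h')) ∉ PD V Γ 1 := by
    intro i his j hjs hij hbad
    have h1 := PD_shift hbad (-h')
    have e1 : (fun x => Pt i (x + -h' + h) - Pt j (x + -h' + h')) =
        fun x => Pt i (x + (h - h')) - Pt j x := by
      funext x
      congr 2 <;> abel
    rw [e1] at h1
    by_cases hl : Pt i ∈ PD V Γ 2
    · have h2 := sub_mem h1 (hl (h - h'))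
      have hne : i ≠ j := fun e => hij e hl
      refine hP.sep i his j hjs hne ?_
      convert h2 using 1
      funext x
      simp
    · exact hgood i his j hjs hl h1
  refine ⟨fun p hp => PD_shift (hP.deg _ (dIdx_mem.1 hp).1) _, fun p hp n => hP.val _ (dIdx_mem.1 hp).1 _, ?_⟩
  rintro ⟨i, a⟩ hp ⟨j, c⟩ hq hpq hbad
  rw [dIdx_mem] at hp hq
  have hsame : ∀ t, i ≠ j → ¬ ((fun x => Pt i (x + t) - Pt j (x + t)) ∈ PD V Γ 1) := by
    intro t hij hb
    refine hP.sep i hp.1 j hq.1 hij ?_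
    have := PD_shift hb (-t)
    simp only [neg_add_cancel_right] at this
    exact this
  cases a <;> cases c
  · exact hsame h (fun e => hpq (by rw [e])) hbad
  · refine hfix i hp.1 j hq.1 (fun e hl => ?_) hbad
    have := hq.2 (by subst e; exact hl)
    simp at this
  · refine hfix j hq.1 i hp.1 (fun e hl => ?_) ?_
    · have := hp.2 (by subst e; exact hl)
      simp at this
    · have := neg_mem hbad
      convert this using 1
      funext x
      simp [dPol]
  · exact hsame h' (fun e => hpq (by rw [e])) hbad

lemma dPol_wt {ι : Type} {s : Finset ι} {Pt : ι → V → Γ} {N : ℕ} (hP : PSep Γw N s Pt) (h h' : V)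
    {i1 : ι} (hi1 : i1 ∈ s) {d0 : ℕ} (hd : Pt i1 ∈ PD V Γ (d0+1)) (hmin : ∀ i ∈ s, Pt i ∉ PD V Γ d0) :
    WR N (wt (PD V Γ) ((fun p => dPol Pt h h' p - dPol Pt h h' (i1, false)) ''
      (((dIdx s Pt).erase (i1, false) : Finset (ι × Bool)) : Set (ι × Bool))))
      (wt (PD V Γ) (Pt '' (s : Set ι))) := by
  refine wt_decrease PD_mono (s.finite_toSet.image _) ?_ (Set.mem_image_of_mem Pt hi1) hd ?_ ?_
  · rintro _ ⟨i, hi, rfl⟩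
    exact hP.deg i hi
  · rintro _ ⟨i, hi, rfl⟩
    exact hmin i hi
  · rintro _ ⟨p, hp, rfl⟩
    have hps := (dIdx_mem.1 (Finset.mem_of_mem_erase (Finset.mem_coe.1 hp))).1
    refine ⟨Pt p.1, Set.mem_image_of_mem Pt hps, fun d hd0 hpd => ?_⟩
    have h1 := hpd (if p.2 then h' else h)
    have h2 := PD_mono (Nat.succ_le_succ hd0) hd h
    convert sub_mem h1 h2 using 1
    funext x
    simp only [Pi.sub_apply, dPol]
    simp only [Bool.false_eq_true, if_false]
    abel

/-- derived functions -/
noncomputable def dFun {X V Γ ι : Type} [AddCommGroup V] [AddCommGroup Γ] (T : Γ → X → X) (Pt : ι → V → Γ)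
    (L : ι → V →+ Γ) (k : V) (f : ι → X → ℝ) (p : ι × Bool) : X → ℝ :=
  if Pt p.1 ∈ PD V Γ 2 then fun x => f p.1 x * f p.1 (T (L p.1 k) x) else f p.1

lemma dFun_prod (hT : Act μ T) {ι : Type} (s : Finset ι) (Pt : ι → V → Γ) (L : ι → V →+ Γ)
    (hL : ∀ i, Pt i ∈ PD V Γ 2 → ∀ x y, Pt i (x + y) = Pt i x + L i y) (h h' n : V)
    (f : ι → X → ℝ) (x : X) :
    (∏ i ∈ s, f i (T (Pt i (n + h)) x)) * (∏ i ∈ s, f i (T (Pt i (n + h')) x)) =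
      ∏ p ∈ dIdx s Pt, dFun T Pt L (h' - h) f p (T (dPol Pt h h' p n) x) := by
  rw [dIdx, Finset.prod_filter, Finset.prod_product, ← Finset.prod_mul_distrib]
  refine Finset.prod_congr rfl fun i _ => ?_
  rw [Fintype.prod_bool]
  by_cases hl : Pt i ∈ PD V Γ 2
  · simp only [hl, dFun, dPol, Bool.true_eq_false, Bool.false_eq_true, if_true, if_false, imp_false,
      not_true, one_mul, imp_true_iff, ← hT.add]
    congr 3
    have e : n + h + (h' - h) = n + h' := by abel
    rw [add_comm (L i _), ← hL i hl, e]
  · simp only [hl, dFun, dPol, false_imp_iff, if_true, Bool.false_eq_true, if_false, false_imp_iff]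
    exact mul_comm _ _

lemma dFun_bm (hiZ : InvA T Z) {ι : Type} (Pt : ι → V → Γ) (L : ι → V →+ Γ) (k : V)
    {f : ι → X → ℝ} (hf : ∀ i, BM Z (f i)) (p : ι × Bool) : BM Z (dFun T Pt L k f p) := by
  unfold dFun
  split_ifs
  · exact (hf _).mul ((hf _).comp (hiZ _))
  · exact hf _

lemma abs_prod_le' {ι : Type} (s : Finset ι) {a : ι → ℝ} {C : ℝ} (h : ∀ i ∈ s, |a i| ≤ C) :
    |∏ i ∈ s, a i| ≤ C ^ s.card := by
  rw [Finset.abs_prod, ← Finset.prod_const]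
  exact Finset.prod_le_prod (fun _ _ => abs_nonneg _) h

lemma int_sq_le {F : X → ℝ} (hF : BM mX F) {C : ℝ} (h : ∀ x, |F x| ≤ C) : ∫ x, (F x)^2 ∂μ ≤ C^2 := by
  calc ∫ x, (F x)^2 ∂μ ≤ ∫ _x, C^2 ∂μ := integral_mono (hF.pow 2).integrable (integrable_const _)
        fun x => sq_le_sq' (abs_le.1 (h x)).1 (abs_le.1 (h x)).2
    _ = C^2 := by simp

set_option maxHeartbeats 1000000 in
theorem pet (hT : Act μ T) (hY : Y ≤ mX) (hi : InvA T Y) (hYZ : Y ≤ Z) (hZ : Z ≤ mX) (hiZ : InvA T Z)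
    (htf : ∀ (m : ℕ) (γ : Γ), m ≠ 0 → m • γ = 0 → γ = 0)
    (hWM : ∀ L : V →+ Γ, (∀ v, L v ∈ Γw) → L ≠ 0 → ∀ f : X → ℝ, BM Z f → cE μ Y f =ᵐ[μ] (fun _ => 0) →
      NullS (fun v => qn μ Y (fun x => f x * f (T (L v) x)))) (N : ℕ) :
    ∀ (w : ℕ → ℕ) (ι : Type) (s : Finset ι) (P : ι → V → Γ) (b : ι), b ∈ s → PSep Γw N s P →
      wt (PD V Γ) ((fun i => P i - P b) '' ((s.erase b : Finset ι) : Set ι)) = w →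
      ∀ (f : ι → X → ℝ), (∀ i, BM Z (f i)) → ∀ i0 ∈ s, cE μ Y (f i0) =ᵐ[μ] (fun _ => 0) →
      NullS (fun n => qn μ Y (fun x => ∏ i ∈ s, f i (T (P i n) x))) := by
  intro w
  induction w using (WR_wf N).induction with
  | _ w ih =>
  intro ι s P b hb hP hw
  suffices H : ∀ f : ι → X → ℝ, (∀ i, BM Z (f i)) → ∀ i0 ∈ s, i0 ≠ b → cE μ Y (f i0) =ᵐ[μ] (fun _ => 0) →
      NullS (fun n => qn μ Y (fun x => ∏ i ∈ s, f i (T (P i n) x))) by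
    intro f hf i0 hi0 h0
    by_cases h : i0 = b
    · subst h
      exact pet_base hT hY hi hYZ hZ hb H hf h0
    · exact H f hf i0 hi0 h h0
  intro f hf i0 hi0 hi0b h0
  have hfm : ∀ i, BM mX (f i) := fun i => (hf i).mono hZ
  set Pt : ι → V → Γ := fun i => P i - P b with hPt
  set s1 := s.erase b with hs1
  have hi01 : i0 ∈ s1 := Finset.mem_erase.2 ⟨hi0b, hi0⟩
  have hPt1 : PSep Γw N s1 Pt := by
    refine ⟨fun i h => sub_mem (hP.deg i (Finset.mem_of_mem_erase h)) (hP.deg b hb),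
      fun i h n => sub_mem (hP.val i (Finset.mem_of_mem_erase h) n) (hP.val b hb n), ?_⟩
    intro i h j h' hij
    have := hP.sep i (Finset.mem_of_mem_erase h) j (Finset.mem_of_mem_erase h') hij
    simpa [hPt] using this
  have hPt0 : ∀ i ∈ s1, Pt i ∉ PD V Γ 1 := fun i h =>
    hP.sep i (Finset.mem_of_mem_erase h) b hb (Finset.ne_of_mem_erase h)
  -- the minimal degree
  obtain ⟨i1, hi1, d0, hd0, hmin⟩ : ∃ i1 ∈ s1, ∃ d0, Pt i1 ∈ PD V Γ (d0+1) ∧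
      ∀ i ∈ s1, Pt i ∉ PD V Γ d0 := by
    have hex : ∃ d, ∃ i ∈ s1, Pt i ∈ PD V Γ d := ⟨N, i0, hi01, hPt1.deg i0 hi01⟩
    obtain ⟨i1, hi1, hd⟩ := Nat.find_spec hex
    have hpos : Nat.find hex ≠ 0 := by
      intro h
      rw [h] at hd
      exact hPt0 i1 hi1 (PD_mono zero_le_one hd)
    obtain ⟨d0, he⟩ := Nat.exists_eq_succ_of_ne_zero hpos
    rw [he] at hd
    refine ⟨i1, hi1, d0, hd, fun i h h' => ?_⟩
    exact Nat.find_min hex (m := d0) (by omega) ⟨i, h, h'⟩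
  choose! L hL using fun i (h : Pt i ∈ PD V Γ 2) => PD_two_hom h
  have hi1' : (i1, false) ∈ dIdx s1 Pt := dIdx_mem.2 ⟨hi1, fun _ => rfl⟩
  have hi0' : (i0, false) ∈ dIdx s1 Pt := dIdx_mem.2 ⟨hi01, fun _ => rfl⟩
  -- induction hypothesis
  have IH : ∀ h h' : V, (∀ i ∈ s1, ∀ j ∈ s1, Pt i ∉ PD V Γ 2 →
      (fun x => Pt i (x + (h - h')) - Pt j x) ∉ PD V Γ 1) →
      ∀ F : ι × Bool → X → ℝ, (∀ p, BM Z (F p)) → cE μ Y (F (i0, false)) =ᵐ[μ] (fun _ => 0) →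
      NullS (fun n => qn μ Y (fun x => ∏ p ∈ dIdx s1 Pt, F p (T (dPol Pt h h' p n) x))) := by
    intro h h' hg F hF hF0
    have hlt := dPol_wt hPt1 h h' hi1 hd0 hmin
    rw [hw] at hlt
    exact ih _ hlt (ι × Bool) (dIdx s1 Pt) (dPol Pt h h') (i1, false) hi1' (dPol_sep hPt1 hg) (by congr!)
      F hF (i0, false) hi0' hF0
  -- uniform bounds
  obtain ⟨C, hC1, hC⟩ : ∃ C : ℝ, 1 ≤ C ∧ ∀ i ∈ s, ∀ x, |f i x| ≤ C := by
    choose c hc0 hc using fun i => (hf i).bd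
    refine ⟨1 + ∑ i ∈ s, c i, by linarith [Finset.sum_nonneg fun i (_ : i ∈ s) => (hc0 i).le], fun i h x => ?_⟩
    have := Finset.single_le_sum (f := c) (fun i _ => (hc0 i).le) h
    linarith [hc i x]
  have hC' : ∀ i ∈ s1, ∀ x, |f i x| ≤ C := fun i h => hC i (Finset.mem_of_mem_erase h)
  set R : V → X → ℝ := fun n x => ∏ i ∈ s1, f i (T (Pt i n) x) with hR
  have hRb : ∀ n, BM mX (R n) := fun n => BM.prodT hT s1 hfm _
  have hRC : ∀ n x, |R n x| ≤ C ^ s1.card := fun n x => abs_prod_le' _ fun i h => hC' i h _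
  set U : V → Lp ℝ 2 (nu μ hY) := fun n => toE (nu μ hY) (fun p => R n p.1 * R n p.2) with hU
  set e := toE (nu μ hY) (fun p => f b p.1 * f b p.2) with he
  have e0 : ∀ n, qn μ Y (fun x => ∏ i ∈ s, f i (T (P i n) x)) = inner ℝ e (U n) := by
    intro n
    rw [he, hU, qn_inner hY (hfm b) (hRb n),
      ← qn_shift hT hY hi ((hfm b).mul (hRb n)) (P b n)]
    congr 1
    funext x
    rw [← Finset.mul_prod_erase s _ hb]
    congr 1
    refine Finset.prod_congr rfl fun i _ => ?_
    rw [← hT.add]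
    simp [hPt]
  simp only [e0]
  have hUU : ∀ n m, inner ℝ (U n) (U m) = qn μ Y (fun x => R n x * R m x) := fun n m =>
    qn_inner hY (hRb n) (hRb m)
  set M : ℝ := (C ^ s1.card * C ^ s1.card)^2 with hM
  have hUM : ∀ n m, inner ℝ (U n) (U m) ≤ M := by
    intro n m
    rw [hUU]
    refine (qn_le_sq hY ((hRb n).mul (hRb m))).trans (int_sq_le ((hRb n).mul (hRb m)) fun x => ?_)
    rw [abs_mul]
    exact mul_le_mul (hRC n x) (hRC m x) (abs_nonneg _) (by positivity)
  -- good pairs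
  obtain ⟨c, hcN, hc0, hc⟩ : ∃ c : V → ℝ, NullS c ∧ (∀ v, 0 ≤ c v) ∧ ∀ h h' : V,
      (∀ i ∈ s1, ∀ j ∈ s1, Pt i ∉ PD V Γ 2 → (fun x => Pt i (x + (h - h')) - Pt j x) ∉ PD V Γ 1) →
      NullS (fun n => inner ℝ (U (n + h)) (U (n + h')) - c (h - h')) := by
    by_cases hl : Pt i0 ∈ PD V Γ 2
    · have hLw : ∀ v, L i0 v ∈ Γw := by
        intro v
        have h1 := hL i0 hl 0 v
        rw [zero_add] at h1
        have : L i0 v = Pt i0 v - Pt i0 0 := by rw [h1]; abel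
        rw [this]
        exact sub_mem (hPt1.val i0 hi01 _) (hPt1.val i0 hi01 _)
      have hL0 : L i0 ≠ 0 := by
        intro h
        refine hPt0 i0 hi01 (PD_one_iff.2 fun x => ?_)
        have h1 := hL i0 hl 0 x
        rw [zero_add, h] at h1
        simpa using h1
      have hn := hWM (-(L i0)) (fun v => neg_mem (hLw v)) (by simpa using hL0) (f i0) (hf i0) h0
      set D : ℝ := ((C * C) ^ ((dIdx s1 Pt).erase (i0, false)).card)^2 with hD
      refine ⟨fun v => 2 * D * qn μ Y (fun x => f i0 x * f i0 (T ((-(L i0)) v) x)),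
        hn.smul (by positivity), fun v => mul_nonneg (by positivity) (qn_nonneg _), fun h h' hg => ?_⟩
      set F := dFun T Pt L (h' - h) f with hF
      have hFb : ∀ p, BM Z (F p) := dFun_bm hiZ Pt L _ hf
      have hFm : ∀ p, BM mX (F p) := fun p => (hFb p).mono hZ
      set G := F (i0, false) with hG
      have hGe : G = fun x => f i0 x * f i0 (T ((-(L i0)) (h - h')) x) := by
        rw [hG, hF, dFun]
        simp only [hl, if_true]
        rw [AddMonoidHom.neg_apply, ← map_neg, neg_sub]
      have hEY : BM Y (cE μ Y G) := (hFm _).cE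
      have hb1 : ∀ p, BM Z (Function.update F (i0, false) (fun x => G x - cE μ Y G x) p) := by
        intro p
        by_cases hp : p = (i0, false)
        · subst hp; simpa using (hFb (i0, false)).sub (hEY.mono hYZ)
        · rw [Function.update_of_ne hp]; exact hFb p
      have hb2 : ∀ p, BM Z (Function.update F (i0, false) (cE μ Y G) p) := by
        intro p
        by_cases hp : p = (i0, false)
        · subst hp; simpa using hEY.mono hYZ
        · rw [Function.update_of_ne hp]; exact hFb p
      have n1 := IH h h' hg _ hb1 (by
        simp only [Function.update_self]
        filter_upwards [cE_self hY hEY] with x hx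
        rw [cE_sub (hFm _) (hEY.mono hY), hx, sub_self])
      refine (n1.smul (c := 2) (by norm_num)).mono fun n => ?_
      rw [hUU]
      have e1 : (fun x => R (n + h) x * R (n + h') x) = fun x =>
          (∏ p ∈ dIdx s1 Pt, (Function.update F (i0, false) (fun x => G x - cE μ Y G x)) p
            (T (dPol Pt h h' p n) x)) +
          ∏ p ∈ dIdx s1 Pt, (Function.update F (i0, false) (cE μ Y G)) p (T (dPol Pt h h' p n) x) := by
        funext x
        rw [hR]
        simp only
        rw [dFun_prod hT s1 Pt L hL, prod_upd hi0', prod_upd hi0', ← Finset.mul_prod_erase _ _ hi0']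
        rw [← add_mul, sub_add_cancel]
      rw [e1]
      have q1 := qn_add (μ := μ) hY (BM.prodT hT (dIdx s1 Pt) (fun p => (hb1 p).mono hZ) (fun p => dPol Pt h h' p n))
        (BM.prodT hT (dIdx s1 Pt) (fun p => (hb2 p).mono hZ) (fun p => dPol Pt h h' p n))
      have hsel : BM mX (fun x => cE μ Y G (T (dPol Pt h h' (i0, false) n) x)) :=
        (hEY.mono hY).comp (hT.meas _)
      have q2 : qn μ Y (fun x => ∏ p ∈ dIdx s1 Pt, (Function.update F (i0, false) (cE μ Y G)) p
          (T (dPol Pt h h' p n) x)) ≤ D * qn μ Y G := by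
        refine (qn_le_sq hY (BM.prodT hT (dIdx s1 Pt) (fun p => (hb2 p).mono hZ) _)).trans ?_
        have : D * qn μ Y G = ∫ x, D * (cE μ Y G (T (dPol Pt h h' (i0, false) n) x))^2 ∂μ := by
          rw [integral_const_mul, hT.int _ (fun x => (cE μ Y G x)^2)]
          rfl
        rw [this]
        refine integral_mono ((BM.prodT hT (dIdx s1 Pt) (fun p => (hb2 p).mono hZ) _).pow 2).integrable
          ((BM.const D).mul (hsel.pow 2)).integrable fun x => ?_
        simp only
        rw [prod_upd hi0', mul_pow, mul_comm]
        refine mul_le_mul_of_nonneg_right ?_ (sq_nonneg _)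
        rw [hD]
        refine sq_le_sq.2 ?_
        rw [abs_of_nonneg (a := (C * C) ^ _) (by positivity)]
        refine abs_prod_le' _ fun p hp => ?_
        have hps := (dIdx_mem.1 (Finset.mem_of_mem_erase hp)).1
        rw [hF, dFun]
        split_ifs
        · rw [abs_mul]
          exact mul_le_mul (hC' _ hps _) (hC' _ hps _) (abs_nonneg _) (by linarith)
        · exact (hC' _ hps _).trans (by nlinarith)
      have q3 : qn μ Y G = qn μ Y (fun x => f i0 x * f i0 (T ((-(L i0)) (h - h')) x)) := by rw [← hGe]
      simp only
      rw [← q3]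
      linarith
    · refine ⟨fun _ => 0, NullS.of_const fun _ => le_rfl, fun _ => le_rfl, fun h h' hg => ?_⟩
      have n1 := IH h h' hg (dFun T Pt L (h' - h) f) (dFun_bm hiZ Pt L _ hf) (by
        simpa [dFun, hl] using h0)
      refine n1.mono fun n => le_of_eq ?_
      rw [hUU, sub_zero]
      congr 1
      funext x
      exact dFun_prod hT s1 Pt L hL h h' n f x
  -- bad pairs
  set bad : ι → ι → V → ℝ := fun i j k => if Pt i ∉ PD V Γ 2 then
    (if k ∈ {k | (fun x => Pt i (x + k) - Pt j x) ∈ PD V Γ 1} then (1:ℝ) else 0) else 0 with hbad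
  have hbad0 : ∀ i j k, 0 ≤ bad i j k := by
    intro i j k
    simp only [hbad]
    split_ifs <;> norm_num
  have hbadN : ∀ i ∈ s1, ∀ j, NullS (bad i j) := by
    intro i h j
    by_cases hl : Pt i ∉ PD V Γ 2
    · simp only [hbad, if_pos hl]
      exact nullS_bad htf (hPt1.deg i h) hl
    · simp only [hbad, if_neg hl]
      exact NullS.of_const fun _ => le_rfl
  refine NullS.vdc U (fun k => c k + M * ∑ i ∈ s1, ∑ j ∈ s1, bad i j k)
    (hcN.add ((NullS.sum _ fun i hi => NullS.sum _ fun j _ => hbadN i hi j).smul (by positivity)))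
    (fun h h' => ?_) e
  by_cases hg : ∀ i ∈ s1, ∀ j ∈ s1, Pt i ∉ PD V Γ 2 → (fun x => Pt i (x + (h - h')) - Pt j x) ∉ PD V Γ 1
  · refine (hc h h' hg).mono fun n => ?_
    have : 0 ≤ M * ∑ i ∈ s1, ∑ j ∈ s1, bad i j (h - h') :=
      mul_nonneg (by positivity) (Finset.sum_nonneg fun i _ => Finset.sum_nonneg fun j _ => hbad0 _ _ _)
    linarith
  · push Not at hg
    obtain ⟨i, h1, j, h2, h3, h4⟩ := hg
    refine NullS.of_const fun n => ?_
    have hb1 : bad i j (h - h') = 1 := by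
      simp only [hbad, if_pos h3]
      exact if_pos h4
    have hb2 : 1 ≤ ∑ i ∈ s1, ∑ j ∈ s1, bad i j (h - h') := by
      rw [← hb1]
      refine le_trans ?_ (Finset.single_le_sum (f := fun i => ∑ j ∈ s1, bad i j (h - h'))
        (fun i _ => Finset.sum_nonneg fun j _ => hbad0 _ _ _) h1)
      exact Finset.single_le_sum (f := fun j => bad i j (h - h')) (fun j _ => hbad0 _ _ _) h2
    have := hUM (n + h) (n + h')
    have hM0 : 0 ≤ M := by positivity
    have := hc0 (h - h')
    nlinarith

end pet3
end PS7cfile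

section PS7dfile
open Filter Topology
open scoped Classical symmDiff
open MeasureTheory ProbabilityTheory

section pet4
set_option linter.unusedSectionVars false
variable {X Γ V : Type} {Y Z : MeasurableSpace X} [mX : MeasurableSpace X]
  [StandardBorelSpace X] [AddCommGroup V]
  {μ : Measure X} [IsProbabilityMeasure μ] [AddCommGroup Γ] {T : Γ → X → X} {Γw : AddSubgroup Γ}

lemma pet_tele (hT : Act μ T) (hY : Y ≤ mX) (hYZ : Y ≤ Z) (hZ : Z ≤ mX) {ι : Type} (s : Finset ι)
    {R : ι → V → Γ}
    (H : ∀ f : ι → X → ℝ, (∀ i, BM Z (f i)) → ∀ i0 ∈ s, cE μ Y (f i0) =ᵐ[μ] (fun _ => 0) →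
      NullS (fun n => qn μ Y (fun x => ∏ i ∈ s, f i (T (R i n) x))))
    {f : ι → X → ℝ} (hf : ∀ i, BM Z (f i)) :
    NullS (fun n => ∫ x, |cE μ Y (fun x => (∏ i ∈ s, f i (T (R i n) x)) -
      ∏ i ∈ s, cE μ Y (f i) (T (R i n) x)) x| ∂μ) := by
  have hfm : ∀ i, BM mX (f i) := fun i => (hf i).mono hZ
  have hE : ∀ i, BM Y (cE μ Y (f i)) := fun i => (hfm i).cE
  have key : ∀ t : Finset ι, t ⊆ s → NullS (fun n => ∫ x, |cE μ Y (fun x => (∏ i ∈ s, f i (T (R i n) x)) -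
      ∏ i ∈ s, (if i ∈ t then cE μ Y (f i) else f i) (T (R i n) x)) x| ∂μ) := by
    intro t
    induction t using Finset.induction_on with
    | empty =>
      intro _
      refine NullS.of_const fun n => ?_
      simp [cE_const]
    | insert j t hj ih =>
      intro hts
      have hjs : j ∈ s := hts (Finset.mem_insert_self _ _)
      have n1 := ih fun i hi => hts (Finset.mem_insert_of_mem hi)
      set ft : ι → X → ℝ := fun i => if i ∈ t then cE μ Y (f i) else f i with hft
      set ft' : ι → X → ℝ := fun i => if i ∈ insert j t then cE μ Y (f i) else f i with hft'
      have hftb : ∀ i, BM Z (ft i) := by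
        intro i
        simp only [hft]
        split_ifs
        · exact (hE i).mono hYZ
        · exact hf i
      have hftb' : ∀ i, BM Z (ft' i) := by
        intro i
        simp only [hft']
        split_ifs
        · exact (hE i).mono hYZ
        · exact hf i
      have hup : ∀ i, BM Z (Function.update ft j (fun x => f j x - cE μ Y (f j) x) i) := by
        intro i
        by_cases h : i = j
        · subst h; simpa using (hf i).sub ((hE i).mono hYZ)
        · rw [Function.update_of_ne h]; exact hftb i
      have hupE : ft' = Function.update ft j (cE μ Y (f j)) := by
        funext i
        by_cases h : i = j
        · subst h; simp [hft']
        · rw [Function.update_of_ne h]; simp [hft', hft, h]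
      have hself : ft = Function.update ft j (f j) := by
        funext i
        by_cases h : i = j
        · subst h; simp [hft, hj]
        · rw [Function.update_of_ne h]
      have n2 := H _ hup j hjs (by
        simp only [Function.update_self]
        filter_upwards [cE_self hY (hE j)] with x hx
        rw [cE_sub (hfm j) ((hE j).mono hY), hx, sub_self])
      have n3 : NullS (fun n => ∫ x, |cE μ Y (fun x => ∏ i ∈ s,
          (Function.update ft j (fun x => f j x - cE μ Y (f j) x)) i (T (R i n) x)) x| ∂μ) :=
        n2.of_sq fun n => sq_int_abs_le ((BM.prodT hT s (fun i => (hup i).mono hZ) _).cE.mono hY)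
      refine (n1.add n3).mono fun n => ?_
      have b1 : BM mX (fun x => (∏ i ∈ s, f i (T (R i n) x)) - ∏ i ∈ s, ft i (T (R i n) x)) :=
        (BM.prodT hT s hfm _).sub (BM.prodT hT s (fun i => (hftb i).mono hZ) _)
      have b2 : BM mX (fun x => ∏ i ∈ s,
          (Function.update ft j (fun x => f j x - cE μ Y (f j) x)) i (T (R i n) x)) :=
        BM.prodT hT s (fun i => (hup i).mono hZ) _
      have e1 : (fun x => (∏ i ∈ s, f i (T (R i n) x)) - ∏ i ∈ s, ft' i (T (R i n) x)) =
          fun x => ((∏ i ∈ s, f i (T (R i n) x)) - ∏ i ∈ s, ft i (T (R i n) x)) +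
          ∏ i ∈ s, (Function.update ft j (fun x => f j x - cE μ Y (f j) x)) i (T (R i n) x) := by
        funext x
        have p1 : ∏ i ∈ s, ft' i (T (R i n) x) = cE μ Y (f j) (T (R j n) x) *
            ∏ i ∈ s.erase j, ft i (T (R i n) x) := by
          rw [hupE, prod_upd hjs]
        have p2 : ∏ i ∈ s, ft i (T (R i n) x) = f j (T (R j n) x) *
            ∏ i ∈ s.erase j, ft i (T (R i n) x) := by
          conv_lhs => rw [hself]
          rw [prod_upd hjs]
        rw [p1, p2, prod_upd hjs]
        ring
      rw [e1, ← integral_add (b1.cE.mono hY).abs.integrable (b2.cE.mono hY).abs.integrable]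
      refine integral_mono ((b1.add b2).cE.mono hY).abs.integrable
        ((b1.cE.mono hY).abs.add (b2.cE.mono hY).abs).integrable fun x => ?_
      simp only
      rw [cE_add b1 b2]
      exact abs_add_le _ _
  have h1 := key s subset_rfl
  refine h1.mono fun n => le_of_eq ?_
  congr 1
  funext x
  congr 2
  funext x
  congr 1
  exact Finset.prod_congr rfl fun i hi => by rw [if_pos hi]

lemma abs_prod_sub_le {ι : Type} (s : Finset ι) {a b : ι → ℝ} (ha : ∀ i ∈ s, |a i| ≤ 1)
    (hb : ∀ i ∈ s, |b i| ≤ 1) : |∏ i ∈ s, a i - ∏ i ∈ s, b i| ≤ ∑ i ∈ s, |a i - b i| := by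
  induction s using Finset.induction_on with
  | empty => simp
  | insert j s hj ih =>
    rw [Finset.prod_insert hj, Finset.prod_insert hj, Finset.sum_insert hj]
    have h1 := ih (fun i hi => ha i (Finset.mem_insert_of_mem hi)) fun i hi => hb i (Finset.mem_insert_of_mem hi)
    have h2 : |∏ i ∈ s, b i| ≤ 1 := by
      have := abs_prod_le' s (a := b) (C := 1) fun i hi => hb i (Finset.mem_insert_of_mem hi)
      simpa using this
    have h3 := ha j (Finset.mem_insert_self _ _)
    have e : a j * ∏ i ∈ s, a i - b j * ∏ i ∈ s, b i =
      a j * (∏ i ∈ s, a i - ∏ i ∈ s, b i) + (a j - b j) * ∏ i ∈ s, b i := by ring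
    rw [e]
    refine (abs_add_le _ _).trans ?_
    rw [abs_mul, abs_mul]
    have := mul_le_mul h3 h1 (abs_nonneg _) zero_le_one
    have := mul_le_mul_of_nonneg_left h2 (abs_nonneg (a j - b j))
    linarith

lemma int_prod_sub (hT : Act μ T) {ι : Type} [Fintype ι] {a b : X → ℝ} (ha : BM mX a) (hb : BM mX b)
    (ha1 : ∀ x, |a x| ≤ 1) (hb1 : ∀ x, |b x| ≤ 1) (r : ι → Γ) :
    |∫ x, ∏ i, a (T (r i) x) ∂μ - ∫ x, ∏ i, b (T (r i) x) ∂μ| ≤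
      Fintype.card ι * ∫ x, |a x - b x| ∂μ := by
  have h1 : BM mX (fun x => ∏ i, a (T (r i) x)) := BM.prodT hT Finset.univ (fun _ => ha) r
  have h2 : BM mX (fun x => ∏ i, b (T (r i) x)) := BM.prodT hT Finset.univ (fun _ => hb) r
  rw [← integral_sub h1.integrable h2.integrable]
  refine abs_integral_le_integral_abs.trans ?_
  calc ∫ x, |∏ i, a (T (r i) x) - ∏ i, b (T (r i) x)| ∂μ
      ≤ ∫ x, ∑ i, |a (T (r i) x) - b (T (r i) x)| ∂μ :=
        integral_mono (h1.sub h2).abs.integrable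
          (BM.sum _ fun i _ => ((ha.comp (hT.meas (r i))).sub (hb.comp (hT.meas (r i)))).abs).integrable
          fun x => abs_prod_sub_le _ (fun i _ => ha1 _) fun i _ => hb1 _
    _ = ∑ i, ∫ x, |a x - b x| ∂μ := by
        rw [integral_finsetSum _ fun i _ =>
          ((ha.comp (hT.meas (r i))).sub (hb.comp (hT.meas (r i)))).abs.integrable]
        exact Finset.sum_congr rfl fun i _ => hT.int (r i) (fun x => |a x - b x|)
    _ = _ := by simp

/-- polynomial recurrence with weakly almost periodic families -/
lemma pet_wap (hT : Act μ T) (hY : Y ≤ mX) (hi : InvA T Y) (hYZ : Y ≤ Z) (hZ : Z ≤ mX) {ι : Type} [Fintype ι]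
    {R : ι → V → Γ}
    (H : ∀ f : ι → X → ℝ, (∀ i, BM Z (f i)) → ∀ i0 ∈ Finset.univ, cE μ Y (f i0) =ᵐ[μ] (fun _ => 0) →
      NullS (fun n => qn μ Y (fun x => ∏ i, f i (T (R i n) x))))
    {F : V → X → ℝ} (hF : WAP μ Y Z 1 F) :
    NullS (fun n => |∫ x, ∏ i, F n (T (R i n) x) ∂μ - ∫ x, ∏ i, cE μ Y (F n) (T (R i n) x) ∂μ|) := by
  refine NullS.of_approx fun ε hε => ?_
  set m : ℝ := (Fintype.card ι : ℝ) with hm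
  have hm0 : 0 ≤ m := by positivity
  set δ : ℝ := ε / (2 * m + 1) with hδ
  have hδ0 : 0 < δ := by positivity
  have hδε : 2 * m * δ ≤ ε := by
    have : δ * (2 * m + 1) = ε := div_mul_cancel₀ _ (by positivity)
    nlinarith
  obtain ⟨K, _, g, hg, hκ⟩ := hF.2 δ hδ0
  have hgb : ∀ k, BM Z (g k) := fun k => ⟨(hg k).1, 1, (hg k).2⟩
  have hgm : ∀ k, BM mX (g k) := fun k => (hgb k).mono hZ
  refine ⟨fun n => ∑ k : ι → K, ∫ x, |cE μ Y (fun x => (∏ i, g (k i) (T (R i n) x)) -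
      ∏ i, cE μ Y (g (k i)) (T (R i n) x)) x| ∂μ,
    NullS.sum _ fun k _ => pet_tele hT hY hYZ hZ Finset.univ H (fun i => hgb (k i)), fun n => ?_⟩
  obtain ⟨κ, h1, h2⟩ := hκ n
  set φ : X → ℝ := fun x => g (κ x) x with hφ
  set ψ : X → ℝ := fun x => cE μ Y (g (κ x)) x with hψ
  have hφb : BM mX φ := BM.select hgm (h1.mono hY)
  have hψb : BM mX ψ := BM.select (fun k => (hgm k).cE.mono hY) (h1.mono hY)
  have hFn := hF.bm n
  have hEψ : cE μ Y φ =ᵐ[μ] ψ := cE_select le_rfl hY hgm h1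
  have d1 := int_prod_sub (μ := μ) hT hFn hφb (hF.1 n).2 (fun x => (hg _).2 x) (fun i => R i n)
  have d2 := int_prod_sub (μ := μ) hT (hFn.cE (Y := Y) (μ := μ) |>.mono hY) hψb (cE_abs_le_of_bd (hF.1 n).2)
    (fun x => cE_abs_le_of_bd (hg _).2 x) (fun i => R i n)
  have d3 : ∫ x, |cE μ Y (F n) x - ψ x| ∂μ ≤ δ := by
    refine le_trans (le_of_eq ?_) ((int_abs_cE_le hY (hFn.sub hφb)).trans h2)
    refine integral_congr_ae ?_
    filter_upwards [hEψ] with x hx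
    rw [cE_sub hFn hφb, hx]
  set kk : X → ι → K := fun x i => κ (T (R i n) x) with hkk
  have hkc : ColM Y kk := ColM.pi fun i => h1.comp (hi _)
  set Hk : (ι → K) → X → ℝ := fun k x => (∏ i, g (k i) (T (R i n) x)) -
      ∏ i, cE μ Y (g (k i)) (T (R i n) x) with hHk
  have hHb : ∀ k, BM mX (Hk k) := fun k => (BM.prodT hT Finset.univ (fun i => hgm (k i)) _).sub
    (BM.prodT hT Finset.univ (fun i => (hgm (k i)).cE.mono hY) _)
  have hsel : BM mX (fun x => Hk (kk x) x) := BM.select hHb (hkc.mono hY)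
  have d4 : |∫ x, ∏ i, φ (T (R i n) x) ∂μ - ∫ x, ∏ i, ψ (T (R i n) x) ∂μ| ≤
      ∑ k : ι → K, ∫ x, |cE μ Y (Hk k) x| ∂μ := by
    rw [← integral_sub (BM.prodT hT Finset.univ (fun _ => hφb) _).integrable
      (BM.prodT hT Finset.univ (fun _ => hψb) _).integrable]
    have e1 : ∫ x, (∏ i, φ (T (R i n) x) - ∏ i, ψ (T (R i n) x)) ∂μ = ∫ x, cE μ Y (Hk (kk x)) x ∂μ := by
      rw [← integral_congr_ae (cE_select le_rfl hY hHb hkc), cE_int hY hsel]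
    rw [e1]
    refine abs_integral_le_integral_abs.trans ?_
    rw [← integral_finsetSum _ fun k _ => ((hHb k).cE.mono hY).abs.integrable]
    refine integral_mono ((BM.select (fun k => (hHb k).cE.mono hY) (hkc.mono hY)).abs).integrable
      (BM.sum _ fun k _ => ((hHb k).cE.mono hY).abs).integrable fun x => ?_
    exact Finset.single_le_sum (f := fun k => |cE μ Y (Hk k) x|) (fun _ _ => abs_nonneg _) (Finset.mem_univ (kk x))
  have d1' : |∫ x, ∏ i, F n (T (R i n) x) ∂μ - ∫ x, ∏ i, φ (T (R i n) x) ∂μ| ≤ m * δ :=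
    d1.trans (mul_le_mul_of_nonneg_left h2 hm0)
  have d2' := d2.trans (mul_le_mul_of_nonneg_left d3 hm0)
  rw [abs_le] at d1' d2' d4 ⊢
  constructor <;> linarith

end pet4
end PS7dfile

section PS8file
open Filter Topology
open scoped Classical symmDiff
open MeasureTheory ProbabilityTheory

section szp
set_option linter.unusedSectionVars false
variable {X Γ : Type} {Y Z : MeasurableSpace X} {f : X → ℝ} [mX : MeasurableSpace X]
  [StandardBorelSpace X]
  {μ : Measure X} [IsProbabilityMeasure μ] [AddCommGroup Γ] {T : Γ → X → X} {Λ : AddSubgroup Γ}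

lemma cE_le_of_setInt (hY : Y ≤ mX) (hf : BM mX f) {W : Set X} (hW : MeasurableSet[Y] W) {ε : ℝ}
    (h : ∀ B, MeasurableSet[Y] B → B ⊆ W → ∫ x in B, f x ∂μ ≤ ε * μ.real B) :
    ∀ᵐ x ∂μ, x ∈ W → cE μ Y f x ≤ ε := by
  have hE : BM Y (cE μ Y f) := hf.cE
  set B := W ∩ {x | ε < cE μ Y f x} with hB
  have hBm : MeasurableSet[Y] B := hW.inter (@measurableSet_lt _ _ _ _ _ Y _ _ _ _ _ measurable_const hE.1)
  have h1 := h B hBm Set.inter_subset_left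
  rw [← cE_setInt hY hf hBm] at h1
  have hEi := ((hE.mono hY).integrable (μ := μ)).integrableOn (s := B)
  have h2 : ∫ x in B, (cE μ Y f x - ε) ∂μ ≤ 0 := by
    rw [integral_sub hEi (integrable_const _)]
    simp only [integral_const, smul_eq_mul, measureReal_restrict_apply MeasurableSet.univ, Set.univ_inter]
    linarith
  have h3 : 0 ≤ᵐ[μ.restrict B] fun x => cE μ Y f x - ε := by
    rw [EventuallyLE, ae_restrict_iff' (hY _ hBm)]
    exact Eventually.of_forall fun x hx => sub_nonneg.2 (le_of_lt hx.2)
  have h4 := (integral_eq_zero_iff_of_nonneg_ae h3 (hEi.sub (integrable_const _))).1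
    (le_antisymm h2 (integral_nonneg_of_ae h3))
  rw [EventuallyEq, ae_restrict_iff' (hY _ hBm)] at h4
  filter_upwards [h4] with x hx hxW
  by_contra hn
  push Not at hn
  have := hx ⟨hxW, hn⟩
  simp only [Pi.zero_apply] at this
  linarith

lemma markov (hf : BM mX f) (h0 : ∀ x, 0 ≤ f x) (ε : ℝ) :
    ε * μ.real {x | ε < f x} ≤ ∫ x, f x ∂μ := by
  have hm : MeasurableSet {x | ε < f x} := measurableSet_lt measurable_const hf.1
  calc ε * μ.real {x | ε < f x} = ∫ x in {x | ε < f x}, ε ∂μ := by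
        simp [mul_comm]
    _ ≤ ∫ x in {x | ε < f x}, f x ∂μ := setIntegral_mono_on (integrable_const _) hf.integrable.integrableOn hm
        fun x hx => le_of_lt hx
    _ ≤ _ := setIntegral_le_integral hf.integrable (Eventually.of_forall h0)

lemma good_set (hT : Act μ T) (hY : Y ≤ mX) (hi : InvA T Y) {A : Set X}
    (hA : MeasurableSet[ZA hT hY Λ] A) (hμA : 0 < μ.real A) (J : Type) [Fintype J] :
    ∃ δ : ℝ, 0 < δ ∧ ∃ B, MeasurableSet[Y] B ∧ 0 < μ.real B ∧ ∃ (K : Type) (_ : Fintype K)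
      (κ : Λ → X → K), ∀ (Q : J → Λ) (l : Λ), ∀ᵐ z ∂μ, z ∈ B → T l z ∈ B →
        (∀ j, T ((Q j : Γ) + l) z ∈ B) → (∀ j, κ (Q j + l) z = κ l z) →
        δ ≤ cE μ Y (fun x => ∏ j, A.indicator (fun _ => (1:ℝ)) (T (Q j) x)) (T l z) := by
  set β := μ.real A / 2 with hβ
  have hβ0 : 0 < β := by positivity
  have hβ1 : β ≤ 1 := by have : μ.real A ≤ 1 := measureReal_le_one; linarith
  have hAm := hA.1
  set a : X → ℝ := A.indicator (fun _ => (1:ℝ)) with ha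
  have hab : BM mX a := BM.ind hAm
  have ha0 : ∀ x, 0 ≤ a x := fun x => Set.indicator_nonneg (fun _ _ => zero_le_one) x
  have ha1 : ∀ x, |a x| ≤ 1 := fun x => by by_cases h : x ∈ A <;> simp [ha, h]
  have ha1' : ∀ x, a x ≤ 1 := fun x => (le_abs_self _).trans (ha1 x)
  have haI : ∫ x, a x ∂μ = μ.real A := by
    rw [ha, integral_indicator hAm]; simp
  set c : ℝ := (Fintype.card J : ℝ) with hc
  have hc0 : 0 ≤ c := by positivity
  set ε : ℝ := β / (8 * (c + 1)) with hε
  have hε0 : 0 < ε := by positivity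
  have hεc : c * (4 * ε) ≤ β / 2 := by
    have : ε * (8 * (c + 1)) = β := div_mul_cancel₀ _ (by positivity)
    nlinarith
  -- approximant
  obtain ⟨h', hs', hd'⟩ := hA.2 (ε * (β / 8)) (by positivity)
  have hs : SAP μ T Y Λ (fun x => clip 1 (h' x)) := by
    refine hs'.op hY hT (SAP.const 0) (φ := fun u _ => clip 1 u) ((clip_cont 1).comp continuous_fst)
      (C := 1) one_pos fun u v u' v' => ?_
    have := clip_lip 1 u u'
    have := abs_nonneg (v - v')
    linarith
  set h : X → ℝ := fun x => clip 1 (h' x) with hh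
  have hb : BM mX h := ⟨hs.1, 1, fun x => clip_abs zero_le_one _⟩
  have hd : ∫ x, |a x - h x| ∂μ ≤ ε * (β / 8) := by
    refine le_trans (integral_mono (hab.sub hb).abs.integrable ?_ fun x => ?_) hd'
    · exact (hab.integrable.sub hs'.2.1).abs
    · exact clip_le (ha1 x)
  obtain ⟨W, hW, hWη, K, _, g', hg', hκ'⟩ := hs.2.2 ε hε0 (β/4) (by positivity)
  set g : K → X → ℝ := fun k x => clip 1 (g' k x) with hg
  have hgb : ∀ k, BM mX (g k) := fun k => ⟨(clip_cont 1).measurable.comp (hg' k).1, 1,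
    fun x => clip_abs zero_le_one _⟩
  choose κ hκc hκ using fun l : Λ => hκ' l l.2
  set φ : Λ → X → ℝ := fun l x => g (κ l x) x with hφ
  have hφb : ∀ l, BM mX (φ l) := fun l => BM.select hgb ((hκc l).mono hY)
  have hhT : ∀ l : Γ, BM mX (fun x => h (T l x)) := fun l => hb.comp (hT.meas _)
  have haT : ∀ l : Γ, BM mX (fun x => a (T l x)) := fun l => hab.comp (hT.meas _)
  set u : Λ → X → ℝ := fun l x => |h (T l x) - φ l x| with hu
  have hub : ∀ l, BM mX (u l) := fun l => ((hhT l).sub (hφb l)).abs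
  have hu1 : ∀ l, ∀ᵐ z ∂μ, z ∈ W → cE μ Y (u l) z ≤ ε := by
    intro l
    refine cE_le_of_setInt hY (hub l) hW fun B hB hBW => le_trans ?_ (hκ l B hB hBW)
    have hsm := select_mi (μ := μ) hY hg' (hκc l)
    refine integral_mono (hub l).integrable.integrableOn
      (((hhT l).integrable.sub hsm.2).abs).integrableOn fun x => ?_
    exact clip_le (clip_abs zero_le_one _)
  set d : X → ℝ := fun x => |a x - h x| with hdd
  have hdb : BM mX d := (hab.sub hb).abs
  have hdT : ∀ l : Γ, BM mX (fun x => d (T l x)) := fun l => hdb.comp (hT.meas _)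
  have hEa : BM Y (cE μ Y a) := hab.cE
  have hEd : BM Y (cE μ Y d) := hdb.cE
  set B0 : Set X := {x | β ≤ cE μ Y a x} with hB0
  set W1 : Set X := {x | cE μ Y d x ≤ ε} with hW1
  have hB0m : MeasurableSet[Y] B0 := @measurableSet_le _ _ _ _ _ Y _ _ _ _ _ measurable_const hEa.1
  have hW1m : MeasurableSet[Y] W1 := @measurableSet_le _ _ _ _ _ Y _ _ _ _ _ hEd.1 measurable_const
  have hB0μ : β ≤ μ.real B0 := by
    have h1 : ∫ x, cE μ Y a x ∂μ ≤ ∫ x, (B0.indicator (fun _ => (1:ℝ)) x + β) ∂μ := by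
      refine integral_mono (hEa.mono hY).integrable
        (((BM.ind hB0m).mono hY).add (BM.const β)).integrable fun x => ?_
      by_cases hx : x ∈ B0
      · have := (le_abs_self _).trans (cE_abs_le_of_bd (μ := μ) (Y := Y) ha1 x)
        simp only [hx, Set.indicator_of_mem]
        linarith
      · simp only [hx, not_false_eq_true, Set.indicator_of_notMem, zero_add]
        exact le_of_lt (not_le.1 hx)
    rw [cE_int hY hab, haI, integral_add ((BM.ind hB0m).mono hY).integrable (integrable_const _),
      integral_indicator (hY _ hB0m)] at h1
    simp at h1
    linarith
  have hW1μ : μ.real W1ᶜ ≤ β / 8 := by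
    have h1 := markov (μ := μ) (hEd.mono hY) (fun x => cE_nonneg (fun _ => abs_nonneg _) x) ε
    rw [cE_int hY hdb] at h1
    have e : W1ᶜ = {x | ε < cE μ Y d x} := by
      ext x
      simp [hW1]
    rw [e]
    exact le_of_mul_le_mul_left (h1.trans hd) hε0
  set B := B0 ∩ W1 ∩ W with hB
  have hBm : MeasurableSet[Y] B := (hB0m.inter hW1m).inter hW
  refine ⟨β/2, by positivity, B, hBm, ?_, K, inferInstance, κ, ?_⟩
  · have h1 : B0 ⊆ B ∪ (W1ᶜ ∪ Wᶜ) := by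
      intro x hx
      by_cases h1 : x ∈ W1
      · by_cases h2 : x ∈ W
        · exact Or.inl ⟨⟨hx, h1⟩, h2⟩
        · exact Or.inr (Or.inr h2)
      · exact Or.inr (Or.inl h1)
    have h2 := (measureReal_mono (μ := μ) h1).trans ((measureReal_union_le _ _).trans
      (add_le_add le_rfl (measureReal_union_le _ _)))
    linarith
  intro Q l
  have hF : BM mX (fun x => ∏ j, a (T (Q j) x)) := BM.prod _ fun j _ => haT _
  have hdiff : ∀ j, BM mX (fun x => |h (T (Q j) x) - h x|) := fun j => ((hhT _).sub hb).abs
  -- the key estimate at each j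
  have key : ∀ j, ∀ᵐ z ∂μ, z ∈ W → κ (Q j + l) z = κ l z →
      cE μ Y (fun x => |h (T (Q j) x) - h x|) (T l z) ≤ 2 * ε := by
    intro j
    have hsel : cE μ Y (fun x => |φ (Q j + l) x - φ l x|) =ᵐ[μ]
        fun z => cE μ Y (fun x => |g (κ (Q j + l) z) x - g (κ l z) x|) z :=
      cE_select (g := fun (k : K × K) x => |g k.1 x - g k.2 x|) le_rfl hY
        (fun k => ((hgb _).sub (hgb _)).abs) ((hκc (Q j + l)).prod (hκc l))
    filter_upwards [hu1 (Q j + l), hu1 l, hsel, hT.cE hY hi (hdiff j) l] with z h1 h2 h3 h4 hz hk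
    rw [← h4]
    have hm : BM mX (fun x => |φ (Q j + l) x - φ l x|) := ((hφb _).sub (hφb _)).abs
    have h5 : cE μ Y (fun x => |h (T (Q j) (T l x)) - h (T l x)|) z ≤
        cE μ Y (fun x => (u (Q j + l) x + u l x) + |φ (Q j + l) x - φ l x|) z := by
      refine cE_mono ((hdiff j).comp (hT.meas l)) (((hub _).add (hub _)).add hm) (fun x => ?_) z
      simp only [hu]
      rw [AddSubgroup.coe_add, hT.add]
      have e : h (T (Q j) (T l x)) - h (T l x) = (h (T (Q j) (T l x)) - φ (Q j + l) x) +
        (φ (Q j + l) x - φ l x) - (h (T l x) - φ l x) := by ring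
      rw [e]
      refine (abs_sub _ _).trans ?_
      have := abs_add_le (h (T (Q j) (T l x)) - φ (Q j + l) x) (φ (Q j + l) x - φ l x)
      linarith
    rw [cE_add ((hub _).add (hub _)) hm, cE_add (hub _) (hub _), h3, hk] at h5
    simp only [sub_self, abs_zero, cE_const] at h5
    linarith [h1 hz, h2 hz]
  have keyd : ∀ j, ∀ᵐ z ∂μ, T ((Q j : Γ) + l) z ∈ W1 → cE μ Y (fun x => d (T (Q j) x)) (T l z) ≤ ε := by
    intro j
    filter_upwards [hT.ae l (hT.cE hY hi hdb (Q j))] with z h1 h2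
    rw [h1, ← hT.add]
    exact h2
  filter_upwards [ae_all_iff.2 key, ae_all_iff.2 keyd] with z hk hkd hz hlz hQz hκz
  set p := T l z with hp
  have h1 : cE μ Y a p ≤ cE μ Y (fun x => (∏ j, a (T (Q j) x)) +
      ∑ j, ((d (T (Q j) x) + |h (T (Q j) x) - h x|) + d x)) p := by
    refine cE_mono hab (hF.add (BM.sum _ fun j _ => ((hdT _).add (hdiff j)).add hdb)) (fun x => ?_) p
    have hnn : ∀ j, 0 ≤ (d (T (Q j) x) + |h (T (Q j) x) - h x|) + d x := fun j => by
      simp only [hdd]; positivity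
    by_cases hall : ∀ j, T (Q j) x ∈ A
    · have : ∏ j, a (T (Q j) x) = 1 := Finset.prod_eq_one fun j _ => by simp [ha, hall j]
      rw [this]
      have := Finset.sum_nonneg fun j (_ : j ∈ Finset.univ) => hnn j
      linarith [ha1' x]
    · push Not at hall
      obtain ⟨j, hj⟩ := hall
      have e0 : a (T (Q j) x) = 0 := by simp [ha, hj]
      have e1 : ∏ j, a (T (Q j) x) = 0 := Finset.prod_eq_zero (Finset.mem_univ j) e0
      have e2 := Finset.single_le_sum (f := fun j => (d (T (Q j) x) + |h (T (Q j) x) - h x|) + d x)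
        (fun j _ => hnn j) (Finset.mem_univ j)
      rw [e1, zero_add]
      refine le_trans ?_ e2
      simp only [hdd]
      rw [e0]
      have t1 := abs_sub_abs_le_abs_sub (h x) (h (T (Q j) x))
      have t2 := neg_abs_le (0 - h (T (Q j) x))
      have t3 := le_abs_self (a x - h x)
      have t4 := le_abs_self (h (T (Q j) x) - h x)
      have t5 := neg_abs_le (h (T (Q j) x) - h x)
      have t6 := le_abs_self (0 - h (T (Q j) x))
      linarith
  rw [cE_add hF (BM.sum _ fun j _ => ((hdT _).add (hdiff j)).add hdb),
    cE_sum _ fun j _ => ((hdT _).add (hdiff j)).add hdb] at h1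
  have h2 : ∑ j, cE μ Y (fun x => (d (T (Q j) x) + |h (T (Q j) x) - h x|) + d x) p ≤ ∑ _j : J, 4 * ε := by
    refine Finset.sum_le_sum fun j _ => ?_
    rw [cE_add ((hdT _).add (hdiff j)) hdb, cE_add (hdT _) (hdiff j)]
    have t1 := hk j hz.2 (hκz j)
    have t2 := hkd j (hQz j).1.2
    have t3 : cE μ Y d p ≤ ε := hlz.1.2
    linarith
  have h3 : β ≤ cE μ Y a p := hlz.1.1
  rw [Finset.sum_const, nsmul_eq_mul, Finset.card_univ] at h2
  linarith

end szp
end PS8file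

section PS8bfile
open Filter Topology
open scoped Classical symmDiff
open MeasureTheory ProbabilityTheory

section szp2
set_option linter.unusedSectionVars false

lemma Synd.preimage {V W : Type} [AddCommGroup V] [AddCommGroup W] {S : Set V} (h : Synd S) (φ : W ≃+ V) :
    Synd (φ ⁻¹' S) := by
  obtain ⟨F, hF⟩ := h
  refine ⟨F.image φ.symm, fun w => ?_⟩
  obtain ⟨u, hu, h⟩ := hF (φ w)
  exact ⟨φ.symm u, Finset.mem_image_of_mem _ hu, by simpa using h⟩

/-- currying -/
def curE (ι ι' V : Type) [AddCommGroup V] : (ι × ι' → V) ≃+ (ι → ι' → V) where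
  toFun f i j := f (i, j)
  invFun f p := f p.1 p.2
  left_inv _ := rfl
  right_inv _ := rfl
  map_add' _ _ := rfl

lemma sH_curE {ι ι' V : Type} [AddCommGroup V] (α : Finset ι) (β : Finset ι') (f : ι × ι' → V) :
    sH β (sH α (curE ι ι' V f)) = sH (α ×ˢ β) f := by
  simp only [sH_apply, Finset.sum_apply, Finset.sum_product]
  rw [Finset.sum_comm]
  rfl

variable {X Γ : Type} {Y Z : MeasurableSpace X} {f : X → ℝ} [mX : MeasurableSpace X]
  [StandardBorelSpace X]
  {μ : Measure X} [IsProbabilityMeasure μ] [AddCommGroup Γ] {T : Γ → X → X} {Λ : AddSubgroup Γ}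

/-- The polynomial Szemeredi property for a factor. -/
def SZP {X Γ : Type} [mX : MeasurableSpace X] [AddCommGroup Γ] (μ : Measure X) (T : Γ → X → X)
    (Y : MeasurableSpace X) : Prop :=
  ∀ (V : Type) (_ : AddCommGroup V) (J : Type) (_ : Fintype J) (P : J → V → Γ),
    (∀ j, PolyMap (P j)) → (∀ j, P j 0 = 0) → ∀ A, MeasurableSet[Y] A → 0 < μ.real A →
    ∃ c : ℝ, 0 < c ∧ ∃ (ι : Type) (_ : Fintype ι), Synd {n : ι → V | ∃ α : Finset ι, α.Nonempty ∧
      c ≤ μ.real {x | ∀ j, T (P j (sH α n)) x ∈ A}}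

lemma szp_lower (hT : Act μ T) (hY : Y ≤ mX) (hi : InvA T Y) (hS : SZP μ T Y) {A : Set X}
    (hA : MeasurableSet[ZA hT hY Λ] A) (hμA : 0 < μ.real A) {V I J : Type} [AddCommGroup V]
    [Fintype I] [Fintype J] (R : I → V → Γ) (hR : ∀ i, PolyMap (R i)) (hR0 : ∀ i, R i 0 = 0)
    (Q : J → V → Λ) (hQ : ∀ i, PolyMap (Q i)) (hQ0 : ∀ i, Q i 0 = 0) :
    ∃ c : ℝ, 0 < c ∧ ∃ (ι : Type) (_ : Fintype ι), Synd {n : ι → V | ∃ α : Finset ι, α.Nonempty ∧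
      c ≤ ∫ x, ∏ i, cE μ Y (fun x => ∏ j, A.indicator (fun _ => (1:ℝ)) (T (Q j (sH α n)) x))
        (T (R i (sH α n)) x) ∂μ} := by
  obtain ⟨δ, hδ, B, hB, hμB, K, hK, κ, hκ⟩ := good_set hT hY hi hA hμA J
  obtain ⟨ι, hι, AA, hAA, w, hw, hw0, hχ⟩ := ip_vdw (Γ := Γ × Λ)
    (fun (p : I × Option J) v => ((R p.1 v, (p.2.elim 0 (fun j => Q j v) : Λ)) : Γ × Λ))
    (by
      rintro ⟨i, _ | j⟩
      · exact polyMap_prodMk (hR i) PolyMap.zero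
      · exact polyMap_prodMk (hR i) (hQ j))
    (by rintro ⟨i, _ | j⟩ <;> simp [hR0, hQ0]) K
  let vv : AA → (ι → V) → Γ := fun a n => (w a n).1
  let lam : AA → (ι → V) → Λ := fun a n => (w a n).2
  have hvv : ∀ a, PolyMap (vv a) := fun a => (hw a).map (AddMonoidHom.fst Γ Λ)
  have hlam : ∀ a, PolyMap (lam a) := fun a => (hw a).map (AddMonoidHom.snd Γ Λ)
  have hvv0 : ∀ a, vv a 0 = 0 := fun a => by simp [vv, hw0]
  have hlam0 : ∀ a, lam a 0 = 0 := fun a => by simp [lam, hw0]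
  let base : (AA × Finset ι) × I → (ι → V) → Γ := fun p n => vv p.1.1 n + R p.2 (sH p.1.2 n)
  let ex : AA → Option (Option J) → Finset ι → (ι → V) → Λ := fun a o α n =>
    o.elim 0 (fun o' => o'.elim (lam a n) (fun j => Q j (sH α n) + lam a n))
  have hbase : ∀ p, PolyMap (base p) := fun p => (hvv _).add ((hR _).comp_hom _)
  have hbase0 : ∀ p, base p 0 = 0 := fun p => by simp [base, hvv0, hR0]
  have hex : ∀ a o α, PolyMap (ex a o α) := by
    rintro a (_ | _ | j) α
    · exact PolyMap.zero
    · exact hlam a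
    · exact ((hQ j).comp_hom (sH α)).add (hlam a)
  have hex0 : ∀ a o α, ex a o α 0 = 0 := by
    rintro a (_ | _ | j) α <;> simp [ex, hlam0, hQ0]
  obtain ⟨c0, hc0, ι', hι', hSy⟩ := hS (ι → V) inferInstance
    (((AA × Finset ι) × I) × Option (Option J)) inferInstance
    (fun p n => (ex p.1.1.1 p.2 p.1.1.2 n : Γ) + base p.1 n)
    (fun p => ((hex _ _ _).map Λ.subtype).add (hbase _)) (fun p => by simp [hex0, hbase0]) B hB hμB
  set M : ℝ := (Fintype.card (AA × Finset ι) : ℝ) with hM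
  have hM0 : 0 ≤ M := by positivity
  set F : V → X → ℝ := fun m x => ∏ j, A.indicator (fun _ => (1:ℝ)) (T (Q j m) x) with hF
  have hFb : ∀ m, BM mX (F m) := fun m => BM.prodT hT Finset.univ (fun j => BM.ind hA.1) (fun j => (Q j m : Γ))
  have hcb : ∀ m, BM mX (cE μ Y (F m)) := fun m => ((hFb m).cE (Y := Y) (μ := μ)).mono hY
  have hc_nn : ∀ m, ∀ᵐ x ∂μ, 0 ≤ cE μ Y (F m) x := fun m =>
    Eventually.of_forall (cE_nonneg fun x => Finset.prod_nonneg fun j _ => Set.indicator_nonneg (fun _ _ => zero_le_one) _)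
  refine ⟨δ ^ (Fintype.card I) * (c0 / (M + 1)), by positivity, ι' × ι, inferInstance, ?_⟩
  refine (hSy.preimage (curE ι' ι V)).mono ?_
  rintro N' ⟨β, hβ, hc⟩
  set n := sH β (curE ι' ι V N') with hn
  set S := {x | ∀ (j : ((AA × Finset ι) × I) × Option (Option J)),
    T ((ex j.1.1.1 j.2 j.1.1.2 n : Γ) + base j.1 n) x ∈ B} with hSdef
  let E : AA × Finset ι → Set X := fun q => {y | q.2.Nonempty ∧
    ∀ i, δ ≤ cE μ Y (F (sH q.2 n)) (T (R i (sH q.2 n)) (T ((lam q.1 n : Γ) + vv q.1 n) y))}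
  have hsub : ∀ᵐ y ∂μ, y ∈ S → y ∈ ⋃ q ∈ (Finset.univ : Finset (AA × Finset ι)), E q := by
    have hall : ∀ᵐ y ∂μ, ∀ p : (AA × Finset ι) × I, T (base p n) y ∈ B →
        T (lam p.1.1 n) (T (base p n) y) ∈ B →
        (∀ j, T ((Q j (sH p.1.2 n) : Γ) + lam p.1.1 n) (T (base p n) y) ∈ B) →
        (∀ j, κ (Q j (sH p.1.2 n) + lam p.1.1 n) (T (base p n) y) = κ (lam p.1.1 n) (T (base p n) y)) →
        δ ≤ cE μ Y (F (sH p.1.2 n)) (T (lam p.1.1 n) (T (base p n) y)) := by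
      rw [ae_all_iff]
      intro p
      exact hT.ae (base p n) (hκ (fun j => Q j (sH p.1.2 n)) (lam p.1.1 n))
    filter_upwards [hall] with y hy hyS
    obtain ⟨a, α, hα, hcol⟩ := hχ n (fun q => κ q.2 (T q.1 y))
    simp only [Set.mem_iUnion]
    refine ⟨(a, α), Finset.mem_univ _, hα, fun i => ?_⟩
    have h1 := hy ((a, α), i) (by simpa [ex] using hyS (((a, α), i), none))
      (by simpa [ex, hT.add] using hyS (((a, α), i), some none))
      (fun j => by simpa [ex, hT.add] using hyS (((a, α), i), some (some j)))
      (fun j => by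
        have e1 := hcol (i, some j)
        have e2 := hcol (i, none)
        simp only [Prod.fst_add, Prod.snd_add, Option.elim, add_zero] at e1 e2
        rw [add_comm (Q j _)]
        exact e1.trans e2.symm)
    convert h1 using 1
    rw [← hT.add, ← hT.add]
    congr 2
    simp only [base]
    abel
  have hle : c0 ≤ ∑ q : AA × Finset ι, μ.real (E q) := by
    have h1 : μ S ≤ μ (⋃ q ∈ (Finset.univ : Finset (AA × Finset ι)), E q) := measure_mono_ae hsub
    have h2 : μ.real S ≤ μ.real (⋃ q ∈ (Finset.univ : Finset (AA × Finset ι)), E q) :=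
      ENNReal.toReal_mono (measure_ne_top _ _) h1
    exact hc.trans (h2.trans (measureReal_biUnion_finset_le _ _))
  obtain ⟨q, hq⟩ : ∃ q, c0 / (M + 1) ≤ μ.real (E q) := by
    by_contra hno
    push Not at hno
    have h1 : ∑ q : AA × Finset ι, μ.real (E q) ≤ ∑ q : AA × Finset ι, c0 / (M+1) :=
      Finset.sum_le_sum fun q _ => (hno q).le
    rw [Finset.sum_const, Finset.card_univ, nsmul_eq_mul, ← hM] at h1
    have h2 : M * (c0 / (M+1)) < c0 := by
      rw [mul_div_assoc', div_lt_iff₀ (by positivity)]; nlinarith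
    linarith
  have hqn : q.2.Nonempty := by
    by_contra hno
    have : E q = ∅ := by ext y; simp [E, hno]
    rw [this] at hq
    simp at hq
    have : 0 < c0 / (M+1) := by positivity
    linarith
  refine ⟨β ×ˢ q.2, hβ.product hqn, ?_⟩
  rw [← sH_curE, ← hn]
  set m := sH q.2 n with hm
  show _ ≤ ∫ x, ∏ i, cE μ Y (F m) (T (R i m) x) ∂μ
  rw [← hT.int ((lam q.1 n : Γ) + vv q.1 n)]
  have hTm : ∀ a, Measurable (T a) := fun a => (hT.mp a).measurable
  have hEm : MeasurableSet (E q) := by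
    have : E q = ⋂ i, {y | δ ≤ cE μ Y (F m) (T (R i m) (T ((lam q.1 n : Γ) + vv q.1 n) y))} := by
      ext y; simp [E, hqn, hm]
    rw [this]
    refine MeasurableSet.iInter fun i => measurableSet_le measurable_const ?_
    exact (hcb m).1.comp ((hTm _).comp (hTm _))
  have hprod : BM mX (fun x => ∏ i, cE μ Y (F m) (T (R i m) (T ((lam q.1 n : Γ) + vv q.1 n) x))) := by
    have := BM.prodT hT Finset.univ (f := fun (_ : I) => cE μ Y (F m)) (fun j => hcb m) (fun i => R i m + ((lam q.1 n : Γ) + vv q.1 n))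
    simpa only [hT.add] using this
  have hnn : ∀ᵐ x ∂μ, ∀ i, 0 ≤ cE μ Y (F m) (T (R i m) (T ((lam q.1 n : Γ) + vv q.1 n) x)) := by
    rw [ae_all_iff]
    intro i
    exact hT.ae _ (hT.ae _ (hc_nn m))
  calc δ ^ (Fintype.card I) * (c0 / (M + 1)) ≤ δ ^ (Fintype.card I) * μ.real (E q) := by gcongr
    _ = ∫ x, (E q).indicator (fun _ => δ ^ (Fintype.card I)) x ∂μ := by
        rw [integral_indicator hEm]; simp [mul_comm]
    _ ≤ _ := by
        refine integral_mono_ae ((integrable_const _).indicator hEm) hprod.integrable ?_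
        filter_upwards [hnn] with x hx
        by_cases hxE : x ∈ E q
        · simp only [Set.indicator_of_mem hxE]
          rw [← Finset.card_univ, ← Finset.prod_const]
          exact Finset.prod_le_prod (fun _ _ => hδ.le) fun i _ => hxE.2 i
        · simp only [Set.indicator_of_notMem hxE]
          exact Finset.prod_nonneg fun i _ => hx i

set_option maxHeartbeats 400000 in
lemma szp_step (hT : Act μ T) (hY : Y ≤ mX) (hi : InvA T Y) (hS : SZP μ T Y)
    (hmax : ∀ Λ' : AddSubgroup Γ, Λ < Λ' → ZA hT hY Λ' = Y)
    (htf : ∀ (m : ℕ) (γ : Γ), m ≠ 0 → m • γ = 0 → γ = 0)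
    (πw : Γ →+ Γ) (πl : Γ →+ Λ) (hadd : ∀ γ, (πl γ : Γ) + πw γ = γ) (hdis : ∀ γ, πw γ ∈ Λ → πw γ = 0) :
    SZP μ T (ZA hT hY Λ) := by
  intro V _ J _ P hP hP0 A hA hμA
  let I := Set.range (fun j v => πw (P j v))
  let R : I → V → Γ := fun i => i.1
  have : Fintype I := Fintype.ofFinite _
  let Q : J → V → Λ := fun j v => πl (P j v)
  have hR : ∀ i, PolyMap (R i) := by
    rintro ⟨_, j, rfl⟩
    exact (hP j).map πw
  have hR0 : ∀ i, R i 0 = 0 := by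
    rintro ⟨_, j, rfl⟩
    simp [R, hP0]
  have hRw : ∀ i n, R i n ∈ πw.range := by
    rintro ⟨_, j, rfl⟩ n
    exact ⟨P j n, rfl⟩
  have hQ : ∀ j, PolyMap (Q j) := fun j => (hP j).map πl
  have hQ0 : ∀ j, Q j 0 = 0 := fun j => by simp [Q, hP0]
  obtain ⟨c, hc, ι, hι, hSy⟩ := szp_lower hT hY hi hS hA hμA R hR hR0 Q hQ hQ0
  set F : V → X → ℝ := fun m x => ∏ j, A.indicator (fun _ => (1:ℝ)) (T (Q j m) x) with hF
  obtain ⟨N, hN⟩ := polyMap_bound hR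
  have hYZ : Y ≤ ZA hT hY Λ := le_ZA hT hY hi
  have hZ : ZA hT hY Λ ≤ mX := ZA_le hT hY
  have hiZ : InvA T (ZA hT hY Λ) := ZA_inv hT hY hi
  have hsep : PSep πw.range N Finset.univ R := by
    refine ⟨fun i _ => hN i, fun i _ n => hRw i n, fun i _ j _ hij hd => hij ?_⟩
    rw [PD_one_iff] at hd
    apply Subtype.ext
    funext n
    have := hd n
    simp only [Pi.sub_apply, hR0, sub_zero, sub_eq_zero] at this
    exact this
  have hab : BM (ZA hT hY Λ) (A.indicator (fun _ => (1:ℝ))) := BM.ind hA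
  have hFw : WAP μ Y (ZA hT hY Λ) 1 F := by
    refine WAP.prod hY hZ Finset.univ fun j _ => ?_
    exact (hab.wapZ hT hY hi one_pos (fun x => by by_cases h : x ∈ A <;> simp [h])).comp (Q j)
  have hnull := pet_wap hT hY hi hYZ hZ (R := R) (F := F) (by
    intro f hf i0 _ h0
    refine pet hT hY hi hYZ hZ hiZ htf ?_ N _ I Finset.univ R i0 (Finset.mem_univ _) hsep rfl f hf i0 (Finset.mem_univ _) h0
    intro L hL hL0 f hf h0
    refine lemWM hT hY hi hmax L ?_ hf h0 (hf.mono hZ)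
    intro hle
    apply hL0
    ext v
    obtain ⟨γ, hγ⟩ := hL v
    have := hle ⟨v, rfl⟩
    rw [← hγ] at this ⊢
    exact hdis γ this) hFw
  have hbad := hnull.indicator (fun _ => abs_nonneg _) (half_pos hc)
  set bad := {v | c/2 ≤ |∫ (x : X), ∏ i, F v (T (R i v) x) ∂μ - ∫ (x : X), ∏ i, cE μ Y (F v) (T (R i v) x) ∂μ|} with hbd
  obtain ⟨B2, hB2⟩ : ∃ B2 : Set (ι → V), ∀ n, n ∈ B2 ↔ ∃ α : Finset ι, α.Nonempty ∧ sH α n ∈ bad :=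
    ⟨{n : ι → V | ∃ α : Finset ι, α.Nonempty ∧ sH α n ∈ bad}, fun _ => Iff.rfl⟩
  have hbad2 : NullS (fun n : ι → V => if n ∈ B2 then (1:ℝ) else 0) := by
    refine NullS.mono (NullS.sum (Finset.univ.filter fun α : Finset ι => α.Nonempty)
      (a := fun α n => if sH α n ∈ bad then (1:ℝ) else 0)
      fun α hα => hbad.comp_surj (sH α) (sH_surj (Finset.mem_filter.1 hα).2)) ?_
    intro n
    split_ifs with h
    · obtain ⟨α, hα, hb⟩ := (hB2 n).1 h
      have := Finset.single_le_sum (f := fun α : Finset ι => if sH α n ∈ bad then (1:ℝ) else 0)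
        (s := Finset.univ.filter fun α : Finset ι => α.Nonempty) (fun β _ => by split_ifs <;> norm_num)
        (Finset.mem_filter.2 ⟨Finset.mem_univ α, hα⟩)
      simpa [hb] using this
    · exact Finset.sum_nonneg fun β _ => by split_ifs <;> norm_num
  have key : ∀ m, m ∉ bad → c ≤ ∫ (x : X), ∏ i, cE μ Y (F m) (T (R i m) x) ∂μ →
      c/2 ≤ μ.real {x | ∀ j, T (P j m) x ∈ A} := by
    intro m h3 h1'
    have h4 : |∫ (x : X), ∏ i, F m (T (R i m) x) ∂μ - ∫ (x : X), ∏ i, cE μ Y (F m) (T (R i m) x) ∂μ| < c/2 :=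
      not_le.1 h3
    have h5 : c/2 ≤ ∫ (x : X), ∏ i, F m (T (R i m) x) ∂μ := by
      have := (abs_lt.1 h4).1
      linarith
    refine h5.trans ?_
    have hTm : ∀ a, Measurable (T a) := fun a => (hT.mp a).measurable
    have hSm : MeasurableSet {x | ∀ j, T (P j m) x ∈ A} := by
      have : {x | ∀ j, T (P j m) x ∈ A} = ⋂ j, T (P j m) ⁻¹' A := by ext; simp
      rw [this]
      exact MeasurableSet.iInter fun j => hTm _ hA.1
    have hFb : BM mX (F m) := BM.prodT hT Finset.univ (fun j => BM.ind hA.1) (fun j => (Q j m : Γ))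
    have hI : BM mX (fun x => ∏ i, F m (T (R i m) x)) := BM.prodT hT Finset.univ (f := fun (_ : I) => F m) (fun _ => hFb) _
    have h01 : ∀ x, 0 ≤ A.indicator (fun _ => (1:ℝ)) x ∧ A.indicator (fun _ => (1:ℝ)) x ≤ 1 := fun x => by
      by_cases h : x ∈ A <;> simp [h]
    have hF01 : ∀ x, 0 ≤ F m x ∧ F m x ≤ 1 := fun x =>
      ⟨Finset.prod_nonneg fun j _ => (h01 _).1, Finset.prod_le_one (fun j _ => (h01 _).1) fun j _ => (h01 _).2⟩
    calc ∫ (x : X), ∏ i, F m (T (R i m) x) ∂μ ≤ ∫ x, {x | ∀ j, T (P j m) x ∈ A}.indicator (fun _ => (1:ℝ)) x ∂μ := by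
          refine integral_mono hI.integrable ((integrable_const _).indicator hSm) fun x => ?_
          by_cases hx : x ∈ {x | ∀ j, T (P j m) x ∈ A}
          · simp only [Set.indicator_of_mem hx]
            exact Finset.prod_le_one (fun i _ => (hF01 _).1) fun i _ => (hF01 _).2
          · simp only [Set.indicator_of_notMem hx]
            simp only [Set.mem_ofPred_eq, not_forall] at hx
            obtain ⟨j, hj⟩ := hx
            refine le_of_eq (Finset.prod_eq_zero (Finset.mem_univ (⟨_, j, rfl⟩ : I)) ?_)
            refine Finset.prod_eq_zero (Finset.mem_univ j) ?_
            rw [← hT.add]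
            simp only [R, Q, hadd]
            simp [hj]
      _ = _ := by rw [integral_indicator hSm]; simp
  refine ⟨c/2, half_pos hc, ι, hι, (hSy.diff_null hbad2).mono ?_⟩
  rintro n ⟨⟨α, hα, h1⟩, h2⟩
  exact ⟨α, hα, key _ (fun h => h2 ((hB2 n).2 ⟨α, hα, h⟩)) h1⟩

end szp2
end PS8bfile

section PS9file
open Filter Topology
open scoped Classical symmDiff
open MeasureTheory ProbabilityTheory

section zornsec
set_option linter.unusedSectionVars false

variable {X Γ : Type} {Y Z : MeasurableSpace X} {f : X → ℝ} [mX : MeasurableSpace X]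
  [StandardBorelSpace X]
  {μ : Measure X} [IsProbabilityMeasure μ] [AddCommGroup Γ] {T : Γ → X → X} {Λ : AddSubgroup Γ}

lemma szp_bot : SZP μ T ⊥ := by
  intro V _ J _ P hP hP0 A hA hμA
  rw [MeasurableSpace.measurableSet_bot_iff] at hA
  rcases hA with rfl | rfl
  · simp at hμA
  · refine ⟨1, one_pos, Unit, inferInstance, {0}, fun v => ⟨0, by simp, Finset.univ, by simp, ?_⟩⟩
    simp

lemma inv_bot : InvA T (⊥ : MeasurableSpace X) := by
  intro a
  rw [measurable_iff_le_map]
  exact bot_le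

lemma inv_sSup {c : Set (MeasurableSpace X)} (h : ∀ Y ∈ c, InvA T Y) : InvA T (sSup c) := by
  intro a
  rw [measurable_iff_le_map]
  refine sSup_le fun Y hY => ?_
  have := (measurable_iff_le_map.1 (h Y hY a))
  exact this.trans (MeasurableSpace.map_mono (le_sSup hY))

lemma chain_approx {c : Set (MeasurableSpace X)} (hc : IsChain (· ≤ ·) c) (hne : c.Nonempty)
    (hle : sSup c ≤ mX) {A : Set X} (hA : MeasurableSet[sSup c] A) {ε : ℝ} (hε : 0 < ε) :
    ∃ Y ∈ c, ∃ A0, MeasurableSet[Y] A0 ∧ μ.real (A ∆ A0) < ε := by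
  have halg : IsSetAlgebra {s : Set X | ∃ m ∈ c, MeasurableSet[m] s} := by
    refine ⟨?_, ?_, ?_⟩
    · obtain ⟨m, hm⟩ := hne
      exact ⟨m, hm, @MeasurableSet.empty _ m⟩
    · rintro s ⟨m, hm, hs⟩
      exact ⟨m, hm, hs.compl⟩
    · rintro s t ⟨m, hm, hs⟩ ⟨m', hm', ht⟩
      rcases hc.total hm hm' with h | h
      · exact ⟨m', hm', (h _ hs).union ht⟩
      · exact ⟨m, hm, hs.union (h _ ht)⟩
  have hgen : sSup c = MeasurableSpace.generateFrom {s : Set X | ∃ m ∈ c, MeasurableSet[m] s} := by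
    ext s
    exact MeasurableSpace.measurableSet_sSup
  have hd := @Measure.MeasureDense.of_generateFrom_isSetAlgebra_finite X (sSup c) (μ.trim hle) _
    (isFiniteMeasure_trim hle) halg hgen
  obtain ⟨A0, ⟨m, hm, hA0⟩, h⟩ := @Measure.MeasureDense.approx X (sSup c) _ _ hd A hA (by rw [trim_measurableSet_eq hle hA]; exact measure_ne_top _ _) ε hε
  refine ⟨m, hm, A0, hA0, ?_⟩
  have hA0' : MeasurableSet[sSup c] A0 := (le_sSup hm : m ≤ sSup c) _ hA0
  rw [trim_measurableSet_eq hle (hA.symmDiff hA0')] at h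
  exact (ENNReal.toReal_lt_of_lt_ofReal h)

lemma szp_apx (hT : Act μ T) (hY : Y ≤ mX) (hi : InvA T Y) (hS : SZP μ T Y)
    {V J : Type} [AddCommGroup V] [Fintype J] (P : J → V → Γ) (hP : ∀ j, PolyMap (P j)) (hP0 : ∀ j, P j 0 = 0)
    {A A0 : Set X} (hAm : MeasurableSet A) (hA0 : MeasurableSet[Y] A0) {ε η : ℝ}
    (hε : ε = 1 / (2 * ((Fintype.card J : ℝ) + 1))) (hη2 : η + η / ε < μ.real A) (hd : μ.real (A ∆ A0) < η) :
    ∃ c : ℝ, 0 < c ∧ ∃ (ι : Type) (_ : Fintype ι), Synd {n : ι → V | ∃ α : Finset ι, α.Nonempty ∧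
      c ≤ μ.real {x | ∀ j, T (P j (sH α n)) x ∈ A}} := by
  set k : ℝ := (Fintype.card J : ℝ) with hk
  have hk0 : 0 ≤ k := by positivity
  have hε0 : 0 < ε := by rw [hε]; positivity
  have hA0m := hY _ hA0
  set D := A0 \ A with hD
  have hDm : MeasurableSet D := hA0m.diff hAm
  have hDη : μ.real D ≤ η := (measureReal_mono (by
    intro x hx; exact Or.inr hx)).trans hd.le
  have hDb : BM mX (D.indicator (fun _ => (1:ℝ))) := BM.ind hDm
  set h := cE μ Y (D.indicator (fun _ => (1:ℝ))) with hh
  have hhY : BM Y h := hDb.cE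
  have hhb : BM mX h := hhY.mono hY
  have hh0 : ∀ x, 0 ≤ h x := cE_nonneg fun x => Set.indicator_nonneg (fun _ _ => zero_le_one) _
  have hhint : ∫ x, h x ∂μ = μ.real D := by
    rw [hh, cE_int hY hDb, integral_indicator hDm]; simp
  set G := A0 ∩ {x | h x ≤ ε} with hG
  have hGm : MeasurableSet[Y] G := hA0.inter (@measurableSet_le _ _ _ _ _ Y _ _ _ _ _ hhY.1 measurable_const)
  have hGpos : 0 < μ.real G := by
    have h1 := markov hhb hh0 ε (μ := μ)
    rw [hhint] at h1
    have h2 : μ.real {x | ε < h x} ≤ η / ε := by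
      rw [le_div_iff₀ hε0, mul_comm]; exact h1.trans hDη
    have h3 : A ⊆ G ∪ ({x | ε < h x} ∪ A ∆ A0) := by
      intro x hx
      by_cases hx0 : x ∈ A0
      · by_cases hxh : h x ≤ ε
        · exact Or.inl ⟨hx0, hxh⟩
        · exact Or.inr (Or.inl (not_le.1 hxh))
      · exact Or.inr (Or.inr (Or.inl ⟨hx, hx0⟩))
    have h4 : μ.real A ≤ μ.real G + (μ.real {x | ε < h x} + μ.real (A ∆ A0)) :=
      (measureReal_mono h3).trans ((measureReal_union_le _ _).trans (by gcongr; exact measureReal_union_le _ _))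
    linarith
  obtain ⟨c0, hc0, ι, hι, hSy⟩ := hS V inferInstance J inferInstance P hP hP0 G hGm hGpos
  refine ⟨c0 / 2, half_pos hc0, ι, hι, hSy.mono ?_⟩
  rintro n ⟨α, hα, h1⟩
  refine ⟨α, hα, ?_⟩
  generalize sH α n = m at h1
  set S := {x | ∀ j, T (P j m) x ∈ G} with hSd
  have hSm : MeasurableSet[Y] S := by
    have : S = ⋂ j, T (P j m) ⁻¹' G := by ext; simp [hSd]
    rw [this]
    exact MeasurableSet.iInter fun j => hi _ hGm
  have hj : ∀ j, μ.real (S ∩ T (P j m) ⁻¹' D) ≤ ε * μ.real S := by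
    intro j
    set Sj := T (-P j m) ⁻¹' S with hSj
    have hSjm : MeasurableSet[Y] Sj := hi _ hSm
    have e1 : S ∩ T (P j m) ⁻¹' D = T (P j m) ⁻¹' (Sj ∩ D) := by
      ext x
      simp only [Set.mem_inter_iff, Set.mem_preimage, hSj]
      rw [← hT.add, neg_add_cancel, hT.zero]
    have e2 : μ.real (T (P j m) ⁻¹' (Sj ∩ D)) = μ.real (Sj ∩ D) :=
      (hT.mp _).measureReal_preimage ((hY _ hSjm).inter hDm).nullMeasurableSet
    have e3 : μ.real Sj = μ.real S := (hT.mp _).measureReal_preimage (hY _ hSm).nullMeasurableSet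
    have e4 : μ.real (Sj ∩ D) = ∫ x in Sj, h x ∂μ := by
      rw [hh, cE_setInt hY hDb hSjm, setIntegral_indicator hDm]; simp
    rw [e1, e2, e4, ← e3]
    calc ∫ x in Sj, h x ∂μ ≤ ∫ x in Sj, ε ∂μ := by
          refine setIntegral_mono_on hhb.integrable.integrableOn (integrable_const _) (hY _ hSjm) ?_
          intro x hx
          have := hx j
          rw [← hT.add, add_neg_cancel, hT.zero] at this
          exact this.2
      _ = _ := by simp [mul_comm]
  have hsub : S ⊆ {x | ∀ j, T (P j m) x ∈ A} ∪ ⋃ j ∈ (Finset.univ : Finset J), (S ∩ T (P j m) ⁻¹' D) := by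
    intro x hx
    by_cases hxA : ∀ j, T (P j m) x ∈ A
    · exact Or.inl hxA
    · push Not at hxA
      obtain ⟨j, hj⟩ := hxA
      right
      simp only [Set.mem_iUnion]
      exact ⟨j, Finset.mem_univ _, hx, (hx j).1, hj⟩
  have h5 : μ.real S ≤ μ.real {x | ∀ j, T (P j m) x ∈ A} + ∑ j : J, ε * μ.real S :=
    (measureReal_mono hsub).trans ((measureReal_union_le _ _).trans (by
      gcongr
      exact (measureReal_biUnion_finset_le _ _).trans (Finset.sum_le_sum fun j _ => hj j)))
  rw [Finset.sum_const, Finset.card_univ, nsmul_eq_mul, ← hk] at h5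
  have h6 : k * (ε * μ.real S) ≤ μ.real S / 2 := by
    have : k * ε ≤ 1/2 := by
      rw [hε, mul_one_div, div_le_div_iff₀ (by positivity) (by norm_num)]; linarith
    have h0 : 0 ≤ μ.real S := measureReal_nonneg
    nlinarith
  linarith

lemma szp_sSup (hT : Act μ T) {c : Set (MeasurableSpace X)} (hc : IsChain (· ≤ ·) c) (hne : c.Nonempty)
    (hc' : ∀ Y ∈ c, Y ≤ mX ∧ InvA T Y ∧ SZP μ T Y) : SZP μ T (sSup c) := by
  have hle : sSup c ≤ mX := sSup_le fun Y hY => (hc' Y hY).1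
  intro V _ J _ P hP hP0 A hA hμA
  set ε : ℝ := 1 / (2 * ((Fintype.card J : ℝ) + 1)) with hε
  have hε0 : 0 < ε := by positivity
  have hAm := hle _ hA
  obtain ⟨η, hη, hη2⟩ : ∃ η : ℝ, 0 < η ∧ η + η / ε < μ.real A := by
    refine ⟨μ.real A / (2 * (1 + 1/ε)), by positivity, ?_⟩
    have : μ.real A / (2 * (1 + 1/ε)) + μ.real A / (2 * (1 + 1/ε)) / ε = μ.real A / 2 := by
      field_simp
    rw [this]; linarith
  obtain ⟨Y, hYc, A0, hA0, hd⟩ := chain_approx (μ := μ) hc hne hle hA hη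
  obtain ⟨hY, hi, hS⟩ := hc' Y hYc
  exact szp_apx (mX := mX) hT hY hi hS P hP hP0 hAm hA0 hε hη2 hd

lemma szp_contra (hT : Act μ T) [Module.Finite ℤ Γ] (htf : ∀ (m : ℕ) (γ : Γ), m ≠ 0 → m • γ = 0 → γ = 0)
    (hY : Y ≤ mX) (hi : InvA T Y) (hS : SZP μ T Y)
    (hmaxY : ∀ ⦃Z : MeasurableSpace X⦄, (Z ≤ mX ∧ InvA T Z ∧ SZP (mX := mX) μ T Z) → Y ≤ Z → Z ≤ Y) (hYm : ¬ Y = mX) : False := by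
  have hwf : WellFounded ((· > ·) : AddSubgroup Γ → AddSubgroup Γ → Prop) := by
    have h0 : WellFounded ((· > ·) : Submodule ℤ Γ → Submodule ℤ Γ → Prop) := wellFounded_gt
    refine Subrelation.wf (r := InvImage (· > ·) (AddSubgroup.toIntSubmodule (M := Γ))) ?_ (InvImage.wf _ h0)
    intro a b hab
    exact (AddSubgroup.toIntSubmodule (M := Γ)).lt_iff_lt.2 hab
  obtain ⟨Λ, hΛ, hΛmax⟩ := hwf.has_min {Λ : AddSubgroup Γ | ZA hT hY Λ ≠ Y} ⟨⊥, fun h => hYm (le_antisymm hY (h ▸ ZA_bot hT hY))⟩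
  have hmax : ∀ Λ' : AddSubgroup Γ, Λ < Λ' → ZA hT hY Λ' = Y := by
    intro Λ' h
    by_contra hno
    exact hΛmax Λ' hno h
  let Λm : Submodule ℤ Γ := AddSubgroup.toIntSubmodule Λ
  have htfq : Module.IsTorsionFree ℤ (Γ ⧸ Λm) := by
    refine Module.IsTorsionFree.of_smul_eq_zero fun r m hrm => ?_
    obtain ⟨γ, rfl⟩ := Λm.mkQ_surjective m
    by_cases hr : r = 0
    · exact Or.inl hr
    right
    rw [← map_smul] at hrm
    have h1 : r • γ ∈ Λm := (Submodule.Quotient.mk_eq_zero _).1 hrm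
    exact (Submodule.Quotient.mk_eq_zero _).2 (show γ ∈ Λ from max_tf hT hY hi hΛ hmax hr h1)
  obtain ⟨s, hs⟩ := Module.projective_lifting_property Λm.mkQ (LinearMap.id : (Γ ⧸ Λm) →ₗ[ℤ] (Γ ⧸ Λm)) Λm.mkQ_surjective
  have hs' : ∀ q, Λm.mkQ (s q) = q := fun q => LinearMap.congr_fun hs q
  let πw : Γ →+ Γ := (s.comp Λm.mkQ).toAddMonoidHom
  let πl : Γ →+ Λ := (AddMonoidHom.id Γ - πw).codRestrict Λ (by
    intro γ
    show γ - s (Λm.mkQ γ) ∈ Λm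
    rw [← Submodule.Quotient.mk_eq_zero]
    show Λm.mkQ (γ - s (Λm.mkQ γ)) = 0
    rw [map_sub, hs', sub_self])
  have hZS : SZP μ T (ZA hT hY Λ) := szp_step hT hY hi hS hmax htf πw πl (by
      intro γ
      show γ - πw γ + πw γ = γ
      abel) (by
      intro γ hγ
      have h1 : Λm.mkQ (s (Λm.mkQ γ)) = 0 := (Submodule.Quotient.mk_eq_zero _).2 hγ
      rw [hs'] at h1
      show s (Λm.mkQ γ) = 0
      rw [h1, map_zero])
  have := hmaxY ⟨ZA_le hT hY, ZA_inv hT hY hi, hZS⟩ (le_ZA hT hY hi)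
  exact hΛ (le_antisymm this (le_ZA hT hY hi))

theorem szp_top (hT : Act μ T) [Module.Finite ℤ Γ] (htf : ∀ (m : ℕ) (γ : Γ), m ≠ 0 → m • γ = 0 → γ = 0) :
    SZP μ T mX := by
  obtain ⟨Y, hYmax⟩ := zorn_le₀ {Y : MeasurableSpace X | Y ≤ mX ∧ InvA T Y ∧ SZP (mX := mX) μ T Y} (by
    intro c hc hch
    rcases c.eq_empty_or_nonempty with rfl | hne
    · exact ⟨⊥, ⟨bot_le, inv_bot, szp_bot⟩, by simp⟩
    · exact ⟨sSup c, ⟨sSup_le fun Y hY => (hc hY).1, inv_sSup fun Y hY => (hc hY).2.1,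
        szp_sSup hT hch hne fun Y hY => hc hY⟩, fun z hz => le_sSup hz⟩)
  obtain ⟨⟨hY, hi, hS⟩, hmaxY⟩ := hYmax
  by_cases hYm : Y = mX
  · rwa [hYm] at hS
  exact (szp_contra (mX := mX) hT htf hY hi hS hmaxY hYm).elim

end zornsec
end PS9file

section PS10file
open Filter Topology
open scoped Classical symmDiff
open MeasureTheory ProbabilityTheory

section tenA

lemma synd_of_sums {V ι : Type} [AddCommGroup V] [Fintype ι] {R : Set V}
    (h : Synd {n : ι → V | ∃ α : Finset ι, α.Nonempty ∧ sH α n ∈ R}) : Synd R := by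
  by_contra hno
  have hno' : ∀ F : Finset V, ∃ v, ∀ u ∈ F, v + u ∉ R := by
    intro F
    by_contra hF
    push Not at hF
    exact hno ⟨F, hF⟩
  obtain ⟨F0, hF0⟩ := h
  have key : ∀ s : Finset ι, ∃ N : ι → V, ∀ α ⊆ s, α.Nonempty → ∀ u ∈ F0, sH α N + sH α u ∉ R := by
    intro s
    induction s using Finset.induction_on with
    | empty =>
      refine ⟨0, fun α hα hne => ?_⟩
      rw [Finset.subset_empty.1 hα] at hne
      exact absurd hne (by simp)
    | insert i s hi ih =>
      obtain ⟨N, hN⟩ := ih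
      obtain ⟨v, hv⟩ := hno' ((s.powerset ×ˢ F0).image fun q => sH q.1 N + sH (insert i q.1) q.2)
      refine ⟨Function.update N i v, fun α hα hne u hu => ?_⟩
      have hupd : ∀ β ⊆ s, sH β (Function.update N i v) = sH β N := by
        intro β hβ
        rw [sH_apply, sH_apply]
        refine Finset.sum_congr rfl fun k hk => ?_
        rw [Function.update_of_ne]
        rintro rfl
        exact hi (hβ hk)
      by_cases hiα : i ∈ α
      · set β := α.erase i with hβ
        have hβs : β ⊆ s := by
          rw [hβ]
          exact Finset.subset_insert_iff.1 hα
        have hins : insert i β = α := Finset.insert_erase hiα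
        have h1 := hv _ (Finset.mem_image.2 ⟨(β, u), Finset.mem_product.2 ⟨Finset.mem_powerset.2 hβs, hu⟩, rfl⟩)
        simp only [hins] at h1
        have h2 : sH α (Function.update N i v) = v + sH β N := by
          rw [← hupd β hβs, ← hins, sH_apply, Finset.sum_insert (fun h => hi (hβs h)), Function.update_self, sH_apply]
        rw [h2, add_assoc]
        exact h1
      · have hαs : α ⊆ s := by
          intro k hk
          rcases Finset.mem_insert.1 (hα hk) with rfl | h
          · exact absurd hk hiα
          · exact h
        rw [hupd α hαs]
        exact hN α hαs hne u hu
  obtain ⟨N, hN⟩ := key Finset.univ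
  obtain ⟨u, hu, α, hα, hR⟩ := hF0 N
  rw [map_add] at hR
  exact hN α (Finset.subset_univ _) hα u hu hR

lemma HasPosLowerBanachDensity.of_synd {R : Set ℤ} (h : Synd R) : HasPosLowerBanachDensity R := by
  obtain ⟨F, hF⟩ := h
  have hFne : F.Nonempty := by obtain ⟨u, hu, _⟩ := hF 0; exact ⟨u, hu⟩
  set k : ℕ := ∑ u ∈ F, u.natAbs with hk
  have hku : ∀ u ∈ F, u.natAbs ≤ k := fun u hu =>
    Finset.single_le_sum (f := fun u : ℤ => u.natAbs) (fun _ _ => Nat.zero_le _) hu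
  have hc0 : (0:ℝ) < F.card := by exact_mod_cast hFne.card_pos
  refine ⟨1 / (2 * F.card), by positivity, 4 * k, fun M N hN => ?_⟩
  set W := (Finset.Ico M (M + (N : ℤ))).filter (fun d => d ∈ R) with hW
  have hsub : Finset.Ico (M + k) (M + N - k) ⊆ F.biUnion fun u => W.image (fun d => d - u) := by
    intro v hv
    rw [Finset.mem_Ico] at hv
    obtain ⟨u, hu, hR⟩ := hF v
    have := hku u hu
    rw [Finset.mem_biUnion]
    refine ⟨u, hu, Finset.mem_image.2 ⟨v + u, ?_, by ring⟩⟩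
    rw [hW, Finset.mem_filter, Finset.mem_Ico]
    refine ⟨?_, hR⟩
    omega
  have h1 := (Finset.card_le_card hsub).trans (Finset.card_biUnion_le_card_mul F _ W.card fun u _ => Finset.card_image_le)
  rw [Int.card_Ico] at h1
  have h2 : N ≤ 2 * (F.card * W.card) := by omega
  have h3 : (N:ℝ) ≤ 2 * (F.card * W.card) := by exact_mod_cast h2
  rw [one_div, inv_mul_le_iff₀ (by positivity)]
  linarith

lemma HasPosLowerBanachDensity.mono {R S : Set ℤ} (h : HasPosLowerBanachDensity R) (hs : R ⊆ S) :
    HasPosLowerBanachDensity S := by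
  obtain ⟨c, hc, N0, h⟩ := h
  refine ⟨c, hc, N0, fun M N hN => (h M N hN).trans ?_⟩
  have := Finset.card_le_card (Finset.monotone_filter_right (Finset.Ico M (M + (N:ℤ))) (p := fun d => d ∈ R) (q := fun d => d ∈ S) (fun d _ hd => hs hd))
  exact_mod_cast this

lemma poly_PD : ∀ (d : ℕ) (p : Polynomial ℤ), p.degree < d → (fun n : ℤ => p.eval n) ∈ PD ℤ ℤ d := by
  intro d
  induction d with
  | zero =>
    intro p hp
    have : p = 0 := by
      rw [← Polynomial.degree_eq_bot]
      rw [Nat.cast_zero] at hp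
      exact Nat.WithBot.lt_zero_iff.1 hp
    subst this
    simp only [Polynomial.eval_zero]
    exact (PD ℤ ℤ 0).zero_mem
  | succ d ih =>
    intro p hp
    rw [PD_succ_iff]
    intro h
    by_cases hp0 : p = 0
    · subst hp0
      convert (PD ℤ ℤ d).zero_mem using 1
      funext x; simp
    have hd : (Polynomial.taylor h p - p).degree < d := by
      have h1 : (Polynomial.taylor h p - p).degree < (Polynomial.taylor h p).degree := by
        refine Polynomial.degree_sub_lt_left (Polynomial.degree_taylor p h) ?_ ?_
        · intro h0; exact hp0 ((Polynomial.taylor_injective h) (by simpa using h0))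
        · exact Polynomial.leadingCoeff_taylor h p
      rw [Polynomial.degree_taylor] at h1
      rcases lt_or_ge (Polynomial.taylor h p - p).degree (d : WithBot ℕ) with h2 | h2
      · exact h2
      · have h3 := lt_of_le_of_lt h2 h1
        have h4 : p.natDegree < d + 1 := (Polynomial.natDegree_lt_iff_degree_lt hp0).2 (by exact_mod_cast hp)
        rw [Polynomial.degree_eq_natDegree hp0] at h3
        have : d < p.natDegree := by exact_mod_cast h3
        omega
    have := ih _ hd
    convert this using 1
    funext x
    simp [Polynomial.taylor_eval, add_comm]

lemma poly_PolyMap (p : Polynomial ℤ) : PolyMap (fun n : ℤ => p.eval n) :=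
  ⟨p.natDegree + 1, poly_PD _ p (by
    refine lt_of_le_of_lt Polynomial.degree_le_natDegree ?_
    exact_mod_cast Nat.lt_succ_self _)⟩

end tenA
end PS10file

section PS11file
open Filter Topology
open scoped Classical symmDiff

section corr
open MeasureTheory ProbabilityTheory

/-- Empirical measure. -/
noncomputable def empM {G X : Type*} [MeasurableSpace X] (F : Finset G) (x : G → X) : Measure X :=
  ((F.card : ENNReal))⁻¹ • ∑ u ∈ F, Measure.dirac (x u)

lemma empM_prob {G X : Type*} [MeasurableSpace X] {F : Finset G} (hF : F.Nonempty) (x : G → X) :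
    IsProbabilityMeasure (empM F x) := by
  refine ⟨?_⟩
  simp only [empM, Measure.smul_apply, Measure.coe_finsetSum, Finset.sum_apply, measure_univ, Finset.sum_const,
    nsmul_eq_mul, mul_one, smul_eq_mul]
  exact ENNReal.inv_mul_cancel (by simpa using hF.ne_empty) (by simp)

lemma empM_real {G X : Type*} [MeasurableSpace X] {F : Finset G} (x : G → X) {C : Set X}
    (hC : MeasurableSet C) : (empM F x).real C = ((F.filter (fun u => x u ∈ C)).card : ℝ) / F.card := by
  simp only [Measure.real, empM, Measure.smul_apply, Measure.coe_finsetSum, Finset.sum_apply,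
    Measure.dirac_apply' _ hC, Set.indicator_apply, Pi.one_apply, smul_eq_mul, ENNReal.toReal_mul, ENNReal.toReal_inv,
    ENNReal.toReal_natCast]
  rw [Finset.sum_boole, ENNReal.toReal_natCast, div_eq_inv_mul]

lemma empM_int {G X : Type*} [MeasurableSpace X] [MeasurableSingletonClass X] {F : Finset G} (x : G → X) (f : X → ℝ) :
    ∫ y, f y ∂(empM F x) = (∑ u ∈ F, f (x u)) / F.card := by
  rw [empM, integral_smul_measure, integral_finsetSum_measure]
  · simp [integral_dirac, div_eq_inv_mul]
  · intro i _
    exact integrable_dirac (by simp)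

lemma sum_symmDiff_le {G : Type*} (A B : Finset G) (h : G → ℝ) {C : ℝ} (hC : ∀ u, |h u| ≤ C) :
    |∑ u ∈ A, h u - ∑ u ∈ B, h u| ≤ C * (A ∆ B).card := by
  have e1 : ∑ u ∈ A, h u = ∑ u ∈ A \ B, h u + ∑ u ∈ A ∩ B, h u := by
    rw [add_comm, Finset.sum_inter_add_sum_sdiff]
  have e2 : ∑ u ∈ B, h u = ∑ u ∈ B \ A, h u + ∑ u ∈ A ∩ B, h u := by
    rw [add_comm, Finset.inter_comm, Finset.sum_inter_add_sum_sdiff]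
  have b1 : |∑ u ∈ A \ B, h u| ≤ (A \ B).card * C := by
    refine (Finset.abs_sum_le_sum_abs _ _).trans ((Finset.sum_le_sum fun u _ => hC u).trans ?_)
    simp
  have b2 : |∑ u ∈ B \ A, h u| ≤ (B \ A).card * C := by
    refine (Finset.abs_sum_le_sum_abs _ _).trans ((Finset.sum_le_sum fun u _ => hC u).trans ?_)
    simp
  have e3 : ((A ∆ B).card : ℝ) = (A \ B).card + (B \ A).card := by
    have : A ∆ B = A \ B ∪ B \ A := rfl
    rw [this, Finset.card_union_of_disjoint disjoint_sdiff_sdiff]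
    push_cast; ring
  rw [e1, e2, e3, add_sub_add_right_eq_sub]
  refine (abs_sub _ _).trans ?_
  linarith

/-- hom from exponents -/
def phiH {G : Type*} [AddCommGroup G] {l : ℕ} (g : Fin l → G) : (Fin l → ℤ) →+ G where
  toFun γ := ∑ i, γ i • g i
  map_zero' := by simp
  map_add' := by intro a b; simp [add_smul, Finset.sum_add_distrib]

lemma phiH_single {G : Type*} [AddCommGroup G] {l : ℕ} (g : Fin l → G) (i : Fin l) (k : ℤ) :
    phiH g (Pi.single i k) = k • g i := by
  show ∑ j, (Pi.single i k : Fin l → ℤ) j • g j = _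
  rw [Finset.sum_eq_single i]
  · simp
  · intro b _ hb; simp [hb]
  · simp

/-- shift -/
def shT {Γ : Type} [AddCommGroup Γ] (a : Γ) (x : Γ → Bool) : Γ → Bool := fun γ => x (γ + a)

lemma shT_cont {Γ : Type} [AddCommGroup Γ] (a : Γ) : Continuous (shT a) :=
  continuous_pi fun γ => continuous_apply (γ + a)

/-- name of a point -/
noncomputable def nameP {Γ : Type} {G : Type*} [AddCommGroup Γ] [AddCommGroup G] (φ : Γ →+ G) (E : Set G) (u : G) : Γ → Bool :=
  fun γ => decide (u + φ γ ∈ E)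

lemma shT_nameP {Γ : Type} {G : Type*} [AddCommGroup Γ] [AddCommGroup G] (φ : Γ →+ G) (E : Set G) (a : Γ) (u : G) :
    shT a (nameP φ E u) = nameP φ E (φ a + u) := by
  funext γ
  simp only [shT, nameP, map_add]
  congr 2
  abel

theorem correspondence {Γ : Type} [AddCommGroup Γ] [Countable Γ] {G : Type*} [AddCommGroup G] (φ : Γ →+ G) (E : Set G)
    (𝒩 : FolnerNet G) (h : 0 < Filter.limsup
      (fun θ => ((((𝒩.F θ).filter (fun u => u ∈ E)).card : ℝ) / ((𝒩.F θ).card : ℝ))) Filter.atTop) :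
    ∃ μ : Measure (Γ → Bool), IsProbabilityMeasure μ ∧ Act μ (shT (Γ := Γ)) ∧
      0 < μ.real {x | x 0 = true} ∧ ∀ C : Set (Γ → Bool), IsClopen C → 0 < μ.real C →
        0 < Filter.limsup (fun θ => ((((𝒩.F θ).filter (fun u => nameP φ E u ∈ C)).card : ℝ) / ((𝒩.F θ).card : ℝ)))
          Filter.atTop := by
  set d : Set G → 𝒩.Θ → ℝ := fun S θ => (((𝒩.F θ).filter (fun u => u ∈ S)).card : ℝ) / ((𝒩.F θ).card : ℝ) with hd
  have hd0 : ∀ S θ, 0 ≤ d S θ := fun S θ => by positivity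
  have hd1 : ∀ S θ, d S θ ≤ 1 := fun S θ => by
    refine div_le_one_of_le₀ ?_ (by positivity)
    exact_mod_cast Finset.card_filter_le _ _
  have hbdd : ∀ S, IsBoundedUnder (· ≤ ·) atTop (d S) := fun S => isBoundedUnder_of ⟨1, hd1 S⟩
  have hbdd' : ∀ S, IsBoundedUnder (· ≥ ·) atTop (d S) := fun S => isBoundedUnder_of ⟨0, hd0 S⟩
  obtain ⟨c, hc0, hc⟩ := exists_between (show 0 < limsup (d E) atTop from h)
  have hfr : ∃ᶠ θ in atTop, c < d E θ := frequently_lt_of_lt_limsup (hbdd' E).isCoboundedUnder_le hc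
  have hne : NeBot (atTop ⊓ 𝓟 {θ | c < d E θ}) := frequently_mem_iff_neBot.1 hfr
  set 𝒰 : Ultrafilter 𝒩.Θ := Ultrafilter.of (atTop ⊓ 𝓟 {θ | c < d E θ}) with h𝒰
  have hU : (𝒰 : Filter 𝒩.Θ) ≤ atTop ⊓ 𝓟 {θ | c < d E θ} := Ultrafilter.of_le _
  have hU1 : (𝒰 : Filter 𝒩.Θ) ≤ atTop := hU.trans inf_le_left
  have hU2 : ∀ᶠ θ in (𝒰 : Filter 𝒩.Θ), c < d E θ := by
    have := hU.trans inf_le_right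
    exact le_principal_iff.1 this
  set x : G → (Γ → Bool) := nameP φ E with hx
  let ν : 𝒩.Θ → ProbabilityMeasure (Γ → Bool) := fun θ => ⟨empM (𝒩.F θ) x, empM_prob (𝒩.nonempty θ) x⟩
  obtain ⟨μ, -, hμ⟩ := isCompact_iff_ultrafilter_le_nhds.1 (isCompact_univ (X := ProbabilityMeasure (Γ → Bool)))
    (𝒰.map ν) (by simp)
  have hμt : Tendsto ν 𝒰 (𝓝 μ) := hμ
  have hclop : ∀ C : Set (Γ → Bool), IsClopen C → Tendsto (d (x ⁻¹' C)) 𝒰 (𝓝 ((μ : Measure (Γ → Bool)).real C)) := by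
    intro C hC
    have h1 := ProbabilityMeasure.tendsto_measure_of_null_frontier_of_tendsto' hμt (E := C) (by rw [hC.frontier_eq]; simp)
    have h2 := (ENNReal.tendsto_toReal (measure_ne_top (μ : Measure (Γ → Bool)) C)).comp h1
    refine h2.congr fun θ => ?_
    exact empM_real x hC.isClosed.measurableSet
  have hA : IsClopen {y : Γ → Bool | y 0 = true} := (isClopen_discrete {true}).preimage (continuous_apply (0 : Γ))
  refine ⟨μ, inferInstance, ⟨?_, ?_, ?_⟩, ?_, ?_⟩
  · intro y; funext γ; simp [shT]
  · intro a b y; funext γ; simp [shT, add_assoc]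
  · intro a
    refine ⟨(shT_cont a).measurable, ?_⟩
    have t1 : Tendsto (fun θ => (ν θ).map (shT_cont a).measurable.aemeasurable) 𝒰
        (𝓝 (μ.map (shT_cont a).measurable.aemeasurable)) :=
      ProbabilityMeasure.tendsto_map_of_tendsto_of_continuous ν μ hμt (shT_cont a)
    have t2 : Tendsto (fun θ => (ν θ).map (shT_cont a).measurable.aemeasurable) 𝒰 (𝓝 μ) := by
      rw [ProbabilityMeasure.tendsto_iff_forall_integral_tendsto] at hμt ⊢
      intro f
      have h1 := hμt f
      have h2 : Tendsto (fun θ => ‖f‖ * (((((𝒩.F θ).image (φ a + ·)) ∆ (𝒩.F θ)).card : ℝ) / ((𝒩.F θ).card : ℝ))) 𝒰 (𝓝 0) := by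
        have := ((𝒩.folner (φ a)).mono_left hU1).const_mul ‖f‖
        simpa using this
      have h3 : Tendsto (fun θ => ∫ y, f y ∂((ν θ).map (shT_cont a).measurable.aemeasurable : Measure (Γ → Bool))
          - ∫ y, f y ∂(ν θ : Measure (Γ → Bool))) 𝒰 (𝓝 0) := by
        refine squeeze_zero_norm (fun θ => ?_) h2
        rw [ProbabilityMeasure.toMeasure_map, integral_map (shT_cont a).measurable.aemeasurable
          f.continuous.aestronglyMeasurable]
        show ‖∫ y, f (shT a y) ∂(empM (𝒩.F θ) x) - ∫ y, f y ∂(empM (𝒩.F θ) x)‖ ≤ _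
        rw [empM_int, empM_int, ← sub_div, Real.norm_eq_abs, abs_div, Nat.abs_cast, mul_div_assoc']
        refine div_le_div_of_nonneg_right ?_ (by positivity)
        have e1 : ∑ u ∈ 𝒩.F θ, f (shT a (x u)) = ∑ u ∈ (𝒩.F θ).image (φ a + ·), f (x u) := by
          rw [Finset.sum_image (by intro u _ v _ h; exact add_left_cancel h)]
          refine Finset.sum_congr rfl fun u _ => ?_
          rw [hx, shT_nameP]
        rw [e1]
        exact sum_symmDiff_le _ _ (fun u => f (x u)) (fun u => f.norm_coe_le_norm (x u))
      have h4 := h3.add h1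
      simpa using h4
    have := tendsto_nhds_unique t1 t2
    have h5 := congrArg (fun m : ProbabilityMeasure (Γ → Bool) => (m : Measure (Γ → Bool))) this
    simpa only [ProbabilityMeasure.toMeasure_map] using h5
  · refine lt_of_lt_of_le hc0 (ge_of_tendsto (hclop _ hA) ?_)
    filter_upwards [hU2] with θ hθ
    refine hθ.le.trans (le_of_eq ?_)
    congr 3
    ext u
    simp [hx, nameP]
  · intro C hC hpos
    have h1 := (hclop C hC).eventually (lt_mem_nhds (half_lt_self hpos))
    have h2 : ∃ᶠ θ in atTop, (μ : Measure (Γ → Bool)).real C / 2 ≤ d (x ⁻¹' C) θ :=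
      (h1.frequently.filter_mono hU1).mono fun θ h => h.le
    exact (half_pos hpos).trans_le (le_limsup_of_frequently_le h2 (hbdd _))

end corr

section final
open MeasureTheory

lemma final_aux {G : Type*} [AddCommGroup G]
    (l : ℕ) (p : Fin l → Polynomial ℤ) (hp : ∀ i, (p i).eval 0 = 0)
    (E : Set G) (hE : HasPosUpperBanachDensityNet E)
    (g : Fin l → G) :
    HasPosLowerBanachDensity
      {d : ℤ | HasPosUpperBanachDensityNet {u ∈ E | ∀ i, u + ((p i).eval d) • g i ∈ E}} := by
  obtain ⟨𝒩, h𝒩⟩ := hE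
  obtain ⟨μ, hμ, hT, hpos, hC⟩ := correspondence (phiH g) E 𝒩 h𝒩
  have hA : IsClopen {y : (Fin l → ℤ) → Bool | y 0 = true} :=
    (isClopen_discrete {true}).preimage (continuous_apply (0 : Fin l → ℤ))
  let P : Option (Fin l) → ℤ → (Fin l → ℤ) := fun o n => o.elim 0 (fun i => Pi.single i ((p i).eval n))
  obtain ⟨c, hc, ι, hι, hS⟩ := szp_top hT (by
      intro m γ hm h
      exact (smul_eq_zero.1 h).resolve_left hm) ℤ inferInstance (Option (Fin l)) inferInstance P
    (by
      rintro (_ | i)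
      · exact PolyMap.zero
      · exact (poly_PolyMap (p i)).map (AddMonoidHom.single (fun _ : Fin l => ℤ) i))
    (by rintro (_ | i) <;> simp [P, hp]) _ hA.isClosed.measurableSet hpos
  have hS2 := synd_of_sums (R := {d : ℤ | c ≤ μ.real {x | ∀ j, shT (P j d) x ∈ {y : (Fin l → ℤ) → Bool | y 0 = true}}}) hS
  refine (HasPosLowerBanachDensity.of_synd hS2).mono ?_
  intro d hd
  refine ⟨𝒩, ?_⟩
  have hcl : IsClopen {x | ∀ j, shT (P j d) x ∈ {y : (Fin l → ℤ) → Bool | y 0 = true}} := by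
    have : {x | ∀ j, shT (P j d) x ∈ {y : (Fin l → ℤ) → Bool | y 0 = true}}
        = ⋂ j, shT (P j d) ⁻¹' {y : (Fin l → ℤ) → Bool | y 0 = true} := by ext; simp
    rw [this]
    exact isClopen_iInter_of_finite fun j => hA.preimage (shT_cont _)
  have h1 := hC _ hcl (lt_of_lt_of_le hc hd)
  convert h1 using 6 with θ
  ext u
  simp only [Finset.mem_filter]
  refine and_congr_right fun _ => ?_
  constructor
  · rintro ⟨hu, hi⟩
    rintro (_ | i)
    · simpa [P, shT, nameP] using hu
    · simpa [P, shT, nameP, phiH_single] using hi i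
  · intro h
    refine ⟨by simpa [P, shT, nameP] using h none, fun i => ?_⟩
    simpa [P, shT, nameP, phiH_single] using h (some i)

end final
end PS11file

/-- **Corollary 3.4.**  Let `(G,+)` be a discrete abelian group with the counting measure and
let `p_1, …, p_l ∈ ℤ[t]` with `p_i(0) = 0`.  If `E ⊆ G` has positive upper Banach density
with respect to Følner nets, then for any `g_1, …, g_l ∈ G` the set
`{d ∈ ℤ : BD*({u ∈ E : u + p_i(d) g_i ∈ E for all i}) > 0}`
has positive lower Banach density in `ℤ`. -/
theorem polynomial_szemeredi_discrete {G : Type*} [AddCommGroup G]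
    (l : ℕ) (p : Fin l → Polynomial ℤ) (hp : ∀ i, (p i).eval 0 = 0)
    (E : Set G) (hE : HasPosUpperBanachDensityNet E)
    (g : Fin l → G) :
    HasPosLowerBanachDensity
      {d : ℤ | HasPosUpperBanachDensityNet {u ∈ E | ∀ i, u + ((p i).eval d) • g i ∈ E}} := by
  exact final_aux l p hp E hE g
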